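/- The reachability problem for VASSB reduces to the reachability problem for VASS: there is a computable function mapping each triple (V, s1, s2) of a VASSB and two semiconfigurations to a triple (V', c1', c2') of a VASS and two VASS configurations such that V has a run s1 →* s2 if and only if V' has a run c1' →* c2'. -/

import Mathlib

/-!
Formalization of context-bounded liveness for dynamic networks of concurrent
pushdown systems (DCPS) and VASS with balloons (VASSB).
Global states, stack symbols, places, balloon states etc. are drawn from ℕ;
the finite components of the systems are recorded as `Finset`s.
-/

noncomputable section

namespace CBL

/-! ### VASS with balloons (VASSB) -/

/-- A vector in `ℕ^P` (finitely supported, places drawn from `ℕ`). -/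
abbrev Vec : Type := ℕ →₀ ℕ

/-- A vector in `ℤ^P`. -/
abbrev ZVec : Type := ℕ →₀ ℤ

/-- A balloon: a balloon state together with its contents, a vector over the
balloon places. -/
abbrev Balloon : Type := ℕ × Vec

/-- A representation of a semilinear subset of `ℕ^Φ`: a finite union of
linear sets, each given by a base vector and a list of period vectors. -/
abbrev SemilinRep : Type := List (Vec × List Vec)

/-- Membership in the semilinear set denoted by a representation. -/
def memSL (k : Vec) (L : SemilinRep) : Prop :=
  ∃ bp ∈ L, ∃ cs : List ℕ, cs.length = bp.2.length ∧
    k = bp.1 + (List.zipWith (fun (c : ℕ) (v : Vec) => c • v) cs bp.2).sum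

/-- Operations labelling the edges of a VASSB. -/
inductive VOp : Type where
  | delta : ZVec → VOp
  | inflate : ℕ → SemilinRep → VOp
  | deflate : ℕ → ℕ → ℕ → ℕ → VOp
  | burst : ℕ → VOp

/-- An edge of a VASSB: source state, operation, target state. -/
abbrev VEdge : Type := ℕ × VOp × ℕ

/-- A VASS with balloons `(Q, P, Ω, Φ, E)`. -/
structure VASSB where
  states : Finset ℕ
  places : Finset ℕ
  bstates : Finset ℕ
  bplaces : Finset ℕ
  edges : Finset VEdge

/-- A configuration `(q, m, n)` of a VASSB. -/
structure VConfig where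
  q : ℕ
  m : Vec
  bag : Multiset Balloon

/-- The effect of an operation on the places and the multiset of balloons. -/
def OpRel : VOp → Vec → Multiset Balloon → Vec → Multiset Balloon → Prop
  | .delta d, m, n, m', n' =>
      (∀ p, (m' p : ℤ) = (m p : ℤ) + d p) ∧ n' = n
  | .inflate s L, m, n, m', n' =>
      m' = m ∧ ∃ k : Vec, memSL k L ∧ n' = n + {(s, k)}
  | .deflate s s' pl p, m, n, m', n' =>
      ∃ (k : Vec) (n0 : Multiset Balloon),
        n = n0 + {(s, k)} ∧ m' = m + Finsupp.single p (k pl) ∧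
        n' = n0 + {(s', Finsupp.erase pl k)}
  | .burst s, m, n, m', n' =>
      m' = m ∧ ∃ (k : Vec) (n0 : Multiset Balloon), n = n0 + {(s, k)} ∧ n' = n0

/-- The step relation induced by the edge `e`. -/
def EdgeRel (e : VEdge) (c c' : VConfig) : Prop :=
  c.q = e.1 ∧ c'.q = e.2.2 ∧ OpRel e.2.1 c.m c.bag c'.m c'.bag

/-- One step of the VASSB `V`. -/
def VStep (V : VASSB) (c c' : VConfig) : Prop :=
  ∃ e ∈ V.edges, EdgeRel e c c'

/-- Reachability in a VASSB. -/
def VReach (V : VASSB) : VConfig → VConfig → Prop :=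
  Relation.ReflTransGen (VStep V)

/-- Semiconfigurations: configurations with no balloons. -/
def IsSemi (c : VConfig) : Prop := c.bag = 0

/-- An infinite run of the VASSB `V` from `c0`, given by its sequence of
configurations and the sequence of edges taken. -/
def IsInfRunV (V : VASSB) (c0 : VConfig) (rho : ℕ → VConfig) (es : ℕ → VEdge) : Prop :=
  rho 0 = c0 ∧ ∀ i, es i ∈ V.edges ∧ EdgeRel (es i) (rho i) (rho (i + 1))

/-- A finite run of length `n` of the VASSB `V` (the first `n` steps). -/
def IsFinRunV (V : VASSB) (n : ℕ) (rho : ℕ → VConfig) (es : ℕ → VEdge) : Prop :=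
  ∀ i < n, es i ∈ V.edges ∧ EdgeRel (es i) (rho i) (rho (i + 1))

/-- The step from `c` to `c'` via the edge `e` applies a deflate or a burst
operation to (an instance of) the balloon `b`. -/
def Touches (e : VEdge) (c c' : VConfig) (b : Balloon) : Prop :=
  (∃ (s' pl p : ℕ), e.2.1 = VOp.deflate b.1 s' pl p ∧
     ∃ n0, c.bag = n0 + {b} ∧ c'.bag = n0 + {(s', Finsupp.erase pl b.2)}) ∨
  (e.2.1 = VOp.burst b.1 ∧ ∃ n0, c.bag = n0 + {b} ∧ c'.bag = n0)

/-- A progressive infinite run: every balloon present in some configuration is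
deflated or burst at some later point, and every place carrying a token is
decremented by some later edge. -/
def ProgressiveV (V : VASSB) (c0 : VConfig) (rho : ℕ → VConfig) (es : ℕ → VEdge) : Prop :=
  IsInfRunV V c0 rho es ∧
  (∀ k, ∀ b ∈ (rho k).bag, ∃ j ≥ k, Touches (es j) (rho j) (rho (j + 1)) b) ∧
  (∀ k p, (rho k).m p ≠ 0 → ∃ j ≥ k, ∃ d : ZVec, (es j).2.1 = VOp.delta d ∧ d p < 0)

/-- `V` has an infinite progressive run from `c0`. -/
def HasProgRunV (V : VASSB) (c0 : VConfig) : Prop :=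
  ∃ rho es, ProgressiveV V c0 rho es

/-- A run of a VASSB is shallow if there is a bound `B` such that every
balloon inflated along the run contains at most `B` tokens. -/
def ShallowVRun (rho : ℕ → VConfig) (es : ℕ → VEdge) : Prop :=
  ∃ B, ∀ (i : ℕ) (s : ℕ) (L : SemilinRep) (k : Vec),
    (es i).2.1 = VOp.inflate s L →
    (rho (i + 1)).bag = (rho i).bag + {(s, k)} →
    (k.sum fun _ x => x) ≤ B

/-- A VASSB is zero-base if every linear set occurring in an inflate label of
one of its edges has base vector `0`. -/
def ZeroBase (V : VASSB) : Prop :=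
  ∀ e ∈ V.edges, ∀ (s : ℕ) (L : SemilinRep), e.2.1 = VOp.inflate s L →
    ∀ bp ∈ L, bp.1 = (0 : Vec)

/-! ### Effective encodings of VASSB and their configurations -/

def encodeVec (v : Vec) : ℕ := Encodable.encode v.graph.val

def encodeZVec (v : ZVec) : ℕ := Encodable.encode v.graph.val

def encodeSL (L : SemilinRep) : ℕ :=
  Encodable.encode (L.map fun bp => (encodeVec bp.1, bp.2.map encodeVec))

def encodeVOp : VOp → ℕ
  | .delta d => Nat.pair 0 (encodeZVec d)
  | .inflate s L => Nat.pair 1 (Nat.pair s (encodeSL L))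
  | .deflate s s' pl p => Nat.pair 2 (Encodable.encode (s, s', pl, p))
  | .burst s => Nat.pair 3 s

/-- An effective encoding of VASSB by natural numbers. -/
def encodeVASSB (V : VASSB) : ℕ :=
  Encodable.encode (V.states.val, V.places.val, V.bstates.val, V.bplaces.val,
    V.edges.val.map fun e => (e.1, encodeVOp e.2.1, e.2.2))

def encodeBalloon (b : Balloon) : ℕ := Encodable.encode (b.1, encodeVec b.2)

/-- An effective encoding of VASSB configurations by natural numbers. -/
def encodeVConfig (c : VConfig) : ℕ :=
  Encodable.encode (c.q, encodeVec c.m, c.bag.map encodeBalloon)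

/-! ### Vector addition systems with states (VASS) -/

/-- A VASS: states and places from `ℕ`, edges labelled by vectors in `ℤ^P`. -/
structure VASS where
  states : Finset ℕ
  places : Finset ℕ
  edges : Finset (ℕ × ZVec × ℕ)

/-- One step of the VASS `W` on configurations in `Q × ℕ^P`. -/
def VassStep (W : VASS) (c c' : ℕ × Vec) : Prop :=
  ∃ e ∈ W.edges, c.1 = e.1 ∧ c'.1 = e.2.2 ∧
    ∀ p, (c'.2 p : ℤ) = (c.2 p : ℤ) + e.2.1 p

/-- Reachability in a VASS. -/
def VassReach (W : VASS) : (ℕ × Vec) → (ℕ × Vec) → Prop :=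
  Relation.ReflTransGen (VassStep W)

/-- An effective encoding of VASS by natural numbers. -/
def encodeVASS (W : VASS) : ℕ :=
  Encodable.encode (W.states.val, W.places.val,
    W.edges.val.map fun e => (e.1, encodeZVec e.2.1, e.2.2))

/-- An effective encoding of VASS configurations by natural numbers. -/
def encodeVassConfig (c : ℕ × Vec) : ℕ := Encodable.encode (c.1, encodeVec c.2)

/-! ### Vectors given by lists of pairs -/

/-- A vector over `ℕ` presented as a list of (place, amount) pairs. -/
abbrev PairList : Type := List (ℕ × ℕ)

/-- The vector presented by a list of pairs; repeated places are added up. -/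
def toVec (l : PairList) : Vec := (l.map fun x => Finsupp.single x.1 x.2).sum

@[simp] theorem toVec_nil : toVec [] = 0 := rfl

@[simp] theorem toVec_cons (x : ℕ × ℕ) (l : PairList) :
    toVec (x :: l) = Finsupp.single x.1 x.2 + toVec l := rfl

@[simp] theorem toVec_append (l l' : PairList) : toVec (l ++ l') = toVec l + toVec l' := by
  simp [toVec]

/-- The total amount a list of pairs assigns to a place. -/
def amount (l : PairList) (i : ℕ) : ℕ := ((l.filter fun x => x.1 = i).map Prod.snd).sum

theorem amount_eq (l : PairList) (i : ℕ) : amount l i = toVec l i := by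
  induction l with
  | nil => simp [amount]
  | cons x l ih =>
    rw [toVec_cons, Finsupp.add_apply, ← ih, Finsupp.single_apply]
    by_cases h : x.1 = i <;> simp [amount, h]

theorem toVec_filter_ne (l : PairList) (i : ℕ) :
    toVec (l.filter fun x => x.1 ≠ i) = (toVec l).erase i := by
  induction l with
  | nil => simp
  | cons x l ih =>
    rw [toVec_cons, Finsupp.erase_add, ← ih]
    by_cases h : x.1 = i
    · simp [h]
    · simp [h]

/-- The integer vector of a natural vector. -/
def toZ : Vec →+ ZVec := Finsupp.mapRange.addMonoidHom (Nat.castAddMonoidHom ℤ)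

@[simp] theorem toZ_apply (v : Vec) (p : ℕ) : toZ v p = (v p : ℤ) := by
  simp [toZ]

theorem toZ_injective : Function.Injective toZ := fun v w h => by
  ext p
  have := DFunLike.congr_fun h p
  simpa using this

/-! ### Petri nets with states -/

/-- A Petri-net transition with source state, consumed tokens, produced tokens and target
state. -/
abbrev PetriEdge : Type := ℕ × PairList × PairList × ℕ

/-- One step of the Petri net with states `N`. -/
def PetriStep (N : List PetriEdge) (c c' : ℕ × Vec) : Prop :=
  ∃ e ∈ N, ∃ r : Vec, c = (e.1, r + toVec e.2.1) ∧ c' = (e.2.2.2, r + toVec e.2.2.1)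

/-- Reachability in a Petri net with states. -/
def PetriReach (N : List PetriEdge) : ℕ × Vec → ℕ × Vec → Prop :=
  Relation.ReflTransGen (PetriStep N)

/-- The two VASS edges simulating a Petri-net transition: first consume, then produce. -/
def splitEdge (e : PetriEdge) : List (ℕ × ZVec × ℕ) :=
  [(2 * e.1, - toZ (toVec e.2.1), 2 * Encodable.encode e + 1),
    (2 * Encodable.encode e + 1, toZ (toVec e.2.2.1), 2 * e.2.2.2)]

/-- The VASS simulating a Petri net with states. -/
def petriVASS (N : List PetriEdge) : VASS where
  states := ∅
  places := ∅
  edges := (N.flatMap splitEdge).toFinset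

theorem petriVASS_step_iff (N : List PetriEdge) (c c' : ℕ × Vec) :
    VassStep (petriVASS N) c c' ↔ ∃ e ∈ N,
      (c.1 = 2 * e.1 ∧ c'.1 = 2 * Encodable.encode e + 1 ∧ c.2 = c'.2 + toVec e.2.1) ∨
      (c.1 = 2 * Encodable.encode e + 1 ∧ c'.1 = 2 * e.2.2.2 ∧
        c'.2 = c.2 + toVec e.2.2.1) := by
  have h1 : ∀ a b v : Vec, (∀ p, (b p : ℤ) = (a p : ℤ) + (-toZ v) p) ↔ a = b + v := by
    intro a b v
    constructor
    · intro h
      ext p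
      have := h p
      simp at this ⊢
      omega
    · rintro rfl p
      simp
  have h2 : ∀ a b v : Vec, (∀ p, (b p : ℤ) = (a p : ℤ) + (toZ v) p) ↔ b = a + v := by
    intro a b v
    constructor
    · intro h
      ext p
      have := h p
      simp at this ⊢
      omega
    · rintro rfl p
      simp
  simp only [VassStep, petriVASS, List.mem_toFinset, List.mem_flatMap, splitEdge]
  constructor
  · rintro ⟨x, ⟨e, he, hx⟩, h⟩
    refine ⟨e, he, ?_⟩
    simp only [List.mem_cons, List.not_mem_nil, or_false] at hx
    rcases hx with rfl | rfl
    · left; rw [h1] at h; exact h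
    · right; rw [h2] at h; exact h
  · rintro ⟨e, he, h | h⟩
    · refine ⟨_, ⟨e, he, List.mem_cons_self⟩, ?_⟩
      rw [h1]; exact h
    · refine ⟨_, ⟨e, he, List.mem_cons_of_mem _ List.mem_cons_self⟩, ?_⟩
      rw [h2]; exact h

theorem petriVASS_reach_iff (N : List PetriEdge) (q₁ q₂ : ℕ) (m₁ m₂ : Vec) :
    VassReach (petriVASS N) (2 * q₁, m₁) (2 * q₂, m₂) ↔ PetriReach N (q₁, m₁) (q₂, m₂) := by
  constructor
  · intro h
    suffices H : ∀ c, VassReach (petriVASS N) (2 * q₁, m₁) c →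
        (∀ q, c.1 = 2 * q → PetriReach N (q₁, m₁) (q, c.2)) ∧
        (∀ e : PetriEdge, c.1 = 2 * Encodable.encode e + 1 →
          PetriReach N (q₁, m₁) (e.1, c.2 + toVec e.2.1)) from
      (H _ h).1 q₂ rfl
    intro c hc
    induction hc with
    | refl =>
      refine ⟨fun q hq => ?_, fun e he => ?_⟩
      · obtain rfl : q₁ = q := by simpa using hq
        exact Relation.ReflTransGen.refl
      · simp at he; omega
    | @tail b c _ hbc ih =>
      obtain ⟨e, he, ⟨h1, h2, h3⟩ | ⟨h1, h2, h3⟩⟩ := (petriVASS_step_iff _ _ _).1 hbc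
      · refine ⟨fun q hq => by omega, fun e' he' => ?_⟩
        obtain rfl : e = e' := Encodable.encode_injective (by omega)
        rw [← h3]
        exact ih.1 _ h1
      · refine ⟨fun q hq => ?_, fun e' he' => by omega⟩
        obtain rfl : q = e.2.2.2 := by omega
        refine Relation.ReflTransGen.tail (ih.2 e h1) ⟨e, he, b.2, rfl, ?_⟩
        rw [h3]
  · intro h
    suffices H : ∀ c, PetriReach N (q₁, m₁) c →
        VassReach (petriVASS N) (2 * q₁, m₁) (2 * c.1, c.2) from H _ h
    intro c hc
    induction hc with
    | refl => exact Relation.ReflTransGen.refl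
    | tail _ hbc ih =>
      obtain ⟨e, he, r, rfl, rfl⟩ := hbc
      refine (ih.tail (b := (2 * e.1, r + toVec e.2.1))
        (c := (2 * Encodable.encode e + 1, r)) ?_).tail ?_
      · exact (petriVASS_step_iff _ _ _).2 ⟨e, he, Or.inl ⟨rfl, rfl, rfl⟩⟩
      · exact (petriVASS_step_iff _ _ _).2 ⟨e, he, Or.inr ⟨rfl, rfl, rfl⟩⟩

/-! ### List presentations of VASSB edges -/

/-- A list presentation of an edge label of a VASSB. -/
inductive LOp : Type where
  | delta : PairList → PairList → LOp
  | inflate : ℕ → List (PairList × List PairList) → LOp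
  | deflate : ℕ → ℕ → ℕ → ℕ → LOp
  | burst : ℕ → LOp

/-- The edge label presented by a list presentation. -/
def LOp.toV : LOp → VOp
  | .delta neg pos => .delta (toZ (toVec pos) - toZ (toVec neg))
  | .inflate s L => .inflate s (L.map fun bp => (toVec bp.1, bp.2.map toVec))
  | .deflate s s' pl p => .deflate s s' pl p
  | .burst s => .burst s

/-- A presented edge. -/
abbrev LEdge : Type := ℕ × LOp × ℕ

/-- The presented linear sets of an edge. -/
def LOp.linearSets : LOp → List (PairList × List PairList)
  | .inflate _ L => L
  | _ => []

/-- The balloon places deflated by an edge. -/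
def LOp.deflated : LOp → List ℕ
  | .deflate _ _ pl _ => [pl]
  | _ => []

/-- All presented linear sets of a list of edges. -/
def linearSets (E : List LEdge) : List (PairList × List PairList) :=
  E.flatMap fun e => e.2.1.linearSets

/-- The increasing duplicate-free list with the same members as `l`. -/
def sortDedup (l : List ℕ) : List ℕ := (List.range (l.sum + 1)).filter (· ∈ l)

theorem mem_sortDedup {l : List ℕ} {x : ℕ} : x ∈ sortDedup l ↔ x ∈ l := by
  simp only [sortDedup, List.mem_filter, List.mem_range, decide_eq_true_eq, and_iff_right_iff_imp]
  exact fun h => Nat.lt_succ_of_le (List.le_sum_of_mem h)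

theorem nodup_sortDedup (l : List ℕ) : (sortDedup l).Nodup :=
  List.nodup_range.filter _

/-- The balloon places that are ever deflated. -/
def deflPlaces (E : List LEdge) : List ℕ :=
  sortDedup (E.flatMap fun e => e.2.1.deflated)

/-- All sublists of a list. -/
def subl (l : PairList) : List PairList :=
  l.foldr (fun x acc => acc ++ acc.map (x :: ·)) [[]]

theorem filter_mem_subl (P : ℕ × ℕ → Bool) (l : PairList) : l.filter P ∈ subl l := by
  induction l with
  | nil => simp [subl]
  | cons x l ih =>
    change _ ∈ subl l ++ (subl l).map (x :: ·)
    rw [List.mem_append]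
    by_cases h : P x
    · exact Or.inr (List.mem_map.2 ⟨_, ih, by simp [h]⟩)
    · exact Or.inl (by simpa [h] using ih)

/-- The contents of balloons that have been inflated to a base vector. -/
def baseContents (E : List LEdge) : List PairList :=
  (linearSets E).flatMap fun bp => subl bp.1

/-- A bound on the number of balloons that need contents other than a base vector. -/
def slotBound (E : List LEdge) : ℕ :=
  (2 * (E.length + 1)) ^ (2 * (E.length + 1) *
    (((linearSets E).length + 1) * (E.length + 3) + 1))

/-! ### The Petri net simulating a VASSB -/

/-- Place `p` of the VASSB. -/
def plP (p : ℕ) : ℕ := Nat.pair 0 p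
/-- Slot `j` is unused. -/
def plAv (j : ℕ) : ℕ := Nat.pair 1 j
/-- Balloons with state `s` and contents `k`. -/
def plBase (s : ℕ) (k : PairList) : ℕ := Nat.pair 2 (Nat.pair s (Encodable.encode k))
/-- The balloon of slot `j` has state `s`. -/
def plSpec (j s : ℕ) : ℕ := Nat.pair 3 (Nat.pair j s)
/-- Balloon place `i` of slot `j` has not been deflated. -/
def plUnd (j i : ℕ) : ℕ := Nat.pair 4 (Nat.pair j i)
/-- Balloon place `i` of slot `j` has been deflated. -/
def plDon (j i : ℕ) : ℕ := Nat.pair 5 (Nat.pair j i)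
/-- Contents of balloon place `i` of slot `j`. -/
def plLoad (j i : ℕ) : ℕ := Nat.pair 6 (Nat.pair j i)

/-- State `q` of the VASSB. -/
def stQ (q : ℕ) : ℕ := Nat.pair 0 q
/-- Inflating slot `j` with periods `vs`. -/
def stI (j : ℕ) (vs : List PairList) (q : ℕ) : ℕ :=
  Nat.pair 1 (Nat.pair j (Nat.pair (Encodable.encode vs) q))
/-- Deflating balloon place `i` of slot `j` to place `p`. -/
def stD (j i p q : ℕ) : ℕ := Nat.pair 2 (Nat.pair j (Nat.pair i (Nat.pair p q)))
/-- Discarding the contents of balloon place `i` of slot `j`. -/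
def stT (j i : ℕ) : ℕ := Nat.pair 3 (Nat.pair j i)

/-- A vector on the places of the VASSB. -/
def onP (l : PairList) : PairList := l.map fun x => (plP x.1, x.2)

/-- The tokens loading slot `j` with the vector `v`. -/
def loadOf (I : List ℕ) (j : ℕ) (v : PairList) : PairList :=
  I.map fun i => (plLoad j i, amount v i)

/-- The tokens marking the places of slot `j` as not deflated. -/
def undOf (I : List ℕ) (j : ℕ) : PairList := I.map fun i => (plUnd j i, 1)

/-- The transitions of the Petri net simulating a list of edges `E`, with final state `qf`, for
balloon places `I`, balloon contents `B` and `K` slots. -/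
inductive Gadget (E : List LEdge) (I : List ℕ) (B : List PairList) (K qf : ℕ) :
    PetriEdge → Prop
  | delta {q neg pos q'} : (q, LOp.delta neg pos, q') ∈ E →
      Gadget E I B K qf (stQ q, onP neg, onP pos, stQ q')
  | inflateBase {q s L q' b} : (q, LOp.inflate s L, q') ∈ E → b ∈ L →
      Gadget E I B K qf (stQ q, [], [(plBase s b.1, 1)], stQ q')
  | inflateStart {q s L q' b j} : (q, LOp.inflate s L, q') ∈ E → b ∈ L → j < K →
      Gadget E I B K qf (stQ q, [(plAv j, 1)],
        (plSpec j s, 1) :: (undOf I j ++ loadOf I j b.1), stI j b.2 q')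
  | inflateLoop {q s L q' b j v} : (q, LOp.inflate s L, q') ∈ E → b ∈ L → j < K → v ∈ b.2 →
      Gadget E I B K qf (stI j b.2 q', [], loadOf I j v, stI j b.2 q')
  | inflateEnd {q s L q' b j} : (q, LOp.inflate s L, q') ∈ E → b ∈ L → j < K →
      Gadget E I B K qf (stI j b.2 q', [], [], stQ q')
  | deflateBase {q s s' i p q' k} : (q, LOp.deflate s s' i p, q') ∈ E → k ∈ B →
      Gadget E I B K qf (stQ q, [(plBase s k, 1)],
        [(plBase s' (k.filter fun x => x.1 ≠ i), 1), (plP p, amount k i)], stQ q')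
  | deflateStart {q s s' i p q' j} : (q, LOp.deflate s s' i p, q') ∈ E → j < K →
      Gadget E I B K qf (stQ q, [(plSpec j s, 1), (plUnd j i, 1)],
        [(plSpec j s', 1), (plDon j i, 1)], stD j i p q')
  | deflateLoop {q s s' i p q' j} : (q, LOp.deflate s s' i p, q') ∈ E → j < K →
      Gadget E I B K qf (stD j i p q', [(plLoad j i, 1)], [(plP p, 1)], stD j i p q')
  | deflateEnd {q s s' i p q' j} : (q, LOp.deflate s s' i p, q') ∈ E → j < K →
      Gadget E I B K qf (stD j i p q', [], [], stQ q')
  | deflateNull {q s s' i p q' j} : (q, LOp.deflate s s' i p, q') ∈ E → j < K →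
      Gadget E I B K qf (stQ q, [(plSpec j s, 1), (plDon j i, 1)],
        [(plSpec j s', 1), (plDon j i, 1)], stQ q')
  | burstBase {q s q' k} : (q, LOp.burst s, q') ∈ E → k ∈ B →
      Gadget E I B K qf (stQ q, [(plBase s k, 1)], [], stQ q')
  | burstSpec {q s q' j} : (q, LOp.burst s, q') ∈ E → j < K →
      Gadget E I B K qf (stQ q, [(plSpec j s, 1)], [], stQ q')
  | clearAv {j} : j < K → Gadget E I B K qf (stQ qf, [(plAv j, 1)], [], stQ qf)
  | clearUnd {j i} : j < K → i ∈ I →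
      Gadget E I B K qf (stQ qf, [(plUnd j i, 1)], [], stT j i)
  | clearLoad {j i} : j < K → i ∈ I →
      Gadget E I B K qf (stT j i, [(plLoad j i, 1)], [], stT j i)
  | clearEnd {j i} : j < K → i ∈ I → Gadget E I B K qf (stT j i, [], [], stQ qf)
  | clearDon {j i} : j < K → i ∈ I →
      Gadget E I B K qf (stQ qf, [(plDon j i, 1)], [], stQ qf)

/-- The transitions simulating `delta neg pos`. -/
def deltaEdges (q : ℕ) (neg pos : PairList) (r : ℕ) : List PetriEdge :=
  [(stQ q, onP neg, onP pos, stQ r)]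

/-- The transitions simulating `inflate s L`. -/
def inflateEdges (I : List ℕ) (K q s : ℕ) (L : List (PairList × List PairList)) (r : ℕ) :
    List PetriEdge :=
  L.flatMap fun b => (stQ q, [], [(plBase s b.1, 1)], stQ r) ::
    (List.range K).flatMap fun j =>
      (stQ q, [(plAv j, 1)], (plSpec j s, 1) :: (undOf I j ++ loadOf I j b.1), stI j b.2 r) ::
      (stI j b.2 r, [], [], stQ r) ::
      b.2.map fun v => (stI j b.2 r, [], loadOf I j v, stI j b.2 r)

/-- The transitions simulating `deflate s s' i p`. -/
def deflateEdges (B : List PairList) (K q s s' i p r : ℕ) : List PetriEdge :=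
  (B.map fun k => (stQ q, [(plBase s k, 1)],
    [(plBase s' (k.filter fun x => x.1 ≠ i), 1), (plP p, amount k i)], stQ r)) ++
  (List.range K).flatMap fun j =>
    [(stQ q, [(plSpec j s, 1), (plUnd j i, 1)], [(plSpec j s', 1), (plDon j i, 1)], stD j i p r),
      (stD j i p r, [(plLoad j i, 1)], [(plP p, 1)], stD j i p r),
      (stD j i p r, [], [], stQ r),
      (stQ q, [(plSpec j s, 1), (plDon j i, 1)], [(plSpec j s', 1), (plDon j i, 1)], stQ r)]

/-- The transitions simulating `burst s`. -/
def burstEdges (B : List PairList) (K q s r : ℕ) : List PetriEdge :=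
  (B.map fun k => (stQ q, [(plBase s k, 1)], [], stQ r)) ++
  (List.range K).map fun j => (stQ q, [(plSpec j s, 1)], [], stQ r)

/-- The transitions emptying the auxiliary places at the end of the run. -/
def clearEdges (I : List ℕ) (K qf : ℕ) : List PetriEdge :=
  (List.range K).flatMap fun j => (stQ qf, [(plAv j, 1)], [], stQ qf) ::
    I.flatMap fun i =>
      [(stQ qf, [(plUnd j i, 1)], [], stT j i), (stT j i, [(plLoad j i, 1)], [], stT j i),
        (stT j i, [], [], stQ qf), (stQ qf, [(plDon j i, 1)], [], stQ qf)]

/-- The transitions simulating a presented edge. -/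
def gadget (I : List ℕ) (B : List PairList) (K : ℕ) : LEdge → List PetriEdge
  | (q, .delta neg pos, r) => deltaEdges q neg pos r
  | (q, .inflate s L, r) => inflateEdges I K q s L r
  | (q, .deflate s s' i p, r) => deflateEdges B K q s s' i p r
  | (q, .burst s, r) => burstEdges B K q s r

/-- The Petri net simulating a list of presented edges. -/
def net (E : List LEdge) (I : List ℕ) (B : List PairList) (K qf : ℕ) : List PetriEdge :=
  clearEdges I K qf ++ E.flatMap (gadget I B K)

theorem gadget_of_mem_net {E : List LEdge} {I : List ℕ} {B : List PairList} {K qf : ℕ}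
    {e : PetriEdge} (h : e ∈ net E I B K qf) : Gadget E I B K qf e := by
  rcases List.mem_append.1 h with h | h
  · simp only [clearEdges, List.mem_flatMap, List.mem_cons, List.mem_range, List.not_mem_nil,
      or_false] at h
    obtain ⟨j, hj, rfl | ⟨i, hi, rfl | rfl | rfl | rfl⟩⟩ := h
    exacts [.clearAv hj, .clearUnd hj hi, .clearLoad hj hi, .clearEnd hj hi, .clearDon hj hi]
  · obtain ⟨⟨q, op, q'⟩, hE, h⟩ := List.mem_flatMap.1 h
    cases op with
    | delta neg pos =>
      obtain rfl := List.mem_singleton.1 h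
      exact .delta hE
    | inflate s L =>
      simp only [gadget, inflateEdges, List.mem_flatMap, List.mem_cons, List.mem_range,
        List.mem_map] at h
      obtain ⟨b, hb, rfl | ⟨j, hj, rfl | rfl | ⟨v, hv, rfl⟩⟩⟩ := h
      exacts [.inflateBase hE hb, .inflateStart hE hb hj, .inflateEnd hE hb hj,
        .inflateLoop hE hb hj hv]
    | deflate s s' i p =>
      simp only [gadget, deflateEdges, List.mem_append, List.mem_flatMap, List.mem_cons,
        List.mem_range, List.mem_map, List.not_mem_nil, or_false] at h
      obtain ⟨k, hk, rfl⟩ | ⟨j, hj, rfl | rfl | rfl | rfl⟩ := h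
      exacts [.deflateBase hE hk, .deflateStart hE hj, .deflateLoop hE hj, .deflateEnd hE hj,
        .deflateNull hE hj]
    | burst s =>
      simp only [gadget, burstEdges, List.mem_append, List.mem_range, List.mem_map] at h
      obtain ⟨k, hk, rfl⟩ | ⟨j, hj, rfl⟩ := h
      exacts [.burstBase hE hk, .burstSpec hE hj]

theorem Gadget.mem_net {E : List LEdge} {I : List ℕ} {B : List PairList} {K qf : ℕ}
    {e : PetriEdge} (h : Gadget E I B K qf e) : e ∈ net E I B K qf := by
  have key : ∀ {l : LEdge}, l ∈ E → ∀ {e}, e ∈ gadget I B K l → e ∈ net E I B K qf :=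
    fun hl _ he => List.mem_append_right _ (List.mem_flatMap.2 ⟨_, hl, he⟩)
  have key' : ∀ {e}, e ∈ clearEdges I K qf → e ∈ net E I B K qf :=
    fun he => List.mem_append_left _ he
  induction h with
  | delta h => exact key h (by simp [gadget, deltaEdges])
  | inflateBase h hb =>
    exact key h (List.mem_flatMap.2 ⟨_, hb, List.mem_cons_self⟩)
  | inflateStart h hb hj =>
    exact key h (List.mem_flatMap.2 ⟨_, hb, List.mem_cons_of_mem _
      (List.mem_flatMap.2 ⟨_, List.mem_range.2 hj, by simp⟩)⟩)
  | inflateLoop h hb hj hv =>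
    exact key h (List.mem_flatMap.2 ⟨_, hb, List.mem_cons_of_mem _
      (List.mem_flatMap.2 ⟨_, List.mem_range.2 hj, List.mem_cons_of_mem _
        (List.mem_cons_of_mem _ (List.mem_map.2 ⟨_, hv, rfl⟩))⟩)⟩)
  | inflateEnd h hb hj =>
    exact key h (List.mem_flatMap.2 ⟨_, hb, List.mem_cons_of_mem _
      (List.mem_flatMap.2 ⟨_, List.mem_range.2 hj, by simp⟩)⟩)
  | deflateBase h hk =>
    exact key h (List.mem_append_left _ (List.mem_map.2 ⟨_, hk, rfl⟩))
  | deflateStart h hj | deflateLoop h hj | deflateEnd h hj | deflateNull h hj =>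
    exact key h (List.mem_append_right _
      (List.mem_flatMap.2 ⟨_, List.mem_range.2 hj, by simp⟩))
  | burstBase h hk => exact key h (List.mem_append_left _ (List.mem_map.2 ⟨_, hk, rfl⟩))
  | burstSpec h hj =>
    exact key h (List.mem_append_right _ (List.mem_map.2 ⟨_, List.mem_range.2 hj, rfl⟩))
  | clearAv hj =>
    exact key' (List.mem_flatMap.2 ⟨_, List.mem_range.2 hj, List.mem_cons_self⟩)
  | clearUnd hj hi | clearLoad hj hi | clearEnd hj hi | clearDon hj hi =>
    exact key' (List.mem_flatMap.2 ⟨_, List.mem_range.2 hj, List.mem_cons_of_mem _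
      (List.mem_flatMap.2 ⟨_, hi, by simp⟩)⟩)

/-- The initial tokens: the given vector, with every slot unused. -/
def startTokens (K : ℕ) (m : PairList) : PairList :=
  onP m ++ (List.range K).map fun j => (plAv j, 1)

/-! ### Linear sets -/

theorem mem_closure_iff_zipWith (vs : List Vec) (x : Vec) :
    x ∈ AddSubmonoid.closure {v | v ∈ vs} ↔ ∃ cs : List ℕ, cs.length = vs.length ∧
      x = (List.zipWith (fun (c : ℕ) (v : Vec) => c • v) cs vs).sum := by
  induction vs generalizing x with
  | nil => simp
  | cons a vs ih =>
    have : {v | v ∈ a :: vs} = {a} ∪ {v | v ∈ vs} := by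
      ext v; simp
    rw [this, AddSubmonoid.closure_union, AddSubmonoid.mem_sup]
    constructor
    · rintro ⟨y, hy, z, hz, rfl⟩
      obtain ⟨n, rfl⟩ := AddSubmonoid.mem_closure_singleton.1 hy
      obtain ⟨cs, hcs, rfl⟩ := (ih z).1 hz
      exact ⟨n :: cs, by simp [hcs], by simp⟩
    · rintro ⟨cs, hcs, rfl⟩
      cases cs with
      | nil => simp at hcs
      | cons n cs =>
        exact ⟨n • a, AddSubmonoid.mem_closure_singleton.2 ⟨n, rfl⟩, _,
          (ih _).2 ⟨cs, by simpa using hcs, rfl⟩, by simp⟩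

/-- The periods of a presented linear set generate this submonoid. -/
def periodSpan (vs : List PairList) : AddSubmonoid Vec :=
  AddSubmonoid.closure {v | v ∈ vs.map toVec}

theorem memSL_map_iff (k : Vec) (L : List (PairList × List PairList)) :
    memSL k (L.map fun bp => (toVec bp.1, bp.2.map toVec)) ↔
      ∃ b ∈ L, ∃ x ∈ periodSpan b.2, k = toVec b.1 + x := by
  constructor
  · rintro ⟨bp, hbp, cs, hcs, rfl⟩
    obtain ⟨b, hb, rfl⟩ := List.mem_map.1 hbp
    exact ⟨b, hb, _, (mem_closure_iff_zipWith _ _).2 ⟨cs, hcs, rfl⟩, rfl⟩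
  · rintro ⟨b, hb, x, hx, rfl⟩
    obtain ⟨cs, hcs, rfl⟩ := (mem_closure_iff_zipWith _ _).1 hx
    exact ⟨_, List.mem_map_of_mem hb, cs, hcs, rfl⟩

/-- The edge of the VASSB presented by `l`. -/
def LEdge.toV (l : LEdge) : VEdge := (l.1, l.2.1.toV, l.2.2)

/-! ### Soundness of the Petri net -/

theorem pair_injective (t : ℕ) : Function.Injective (Nat.pair t) := fun a b h => by
  simpa using h

/-- The restriction of a vector to the places with tag `t`. -/
def part (t : ℕ) : Vec →+ Vec := Finsupp.comapDomain.addMonoidHom (pair_injective t)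

@[simp] theorem part_apply (t : ℕ) (w : Vec) (x : ℕ) : part t w x = w (Nat.pair t x) := rfl

theorem part_single (t t' x n : ℕ) :
    part t (Finsupp.single (Nat.pair t' x) n) = if t' = t then Finsupp.single x n else 0 := by
  ext y
  rw [part_apply, Finsupp.single_apply]
  by_cases h : t' = t <;> simp [h, Finsupp.single_apply]

/-- The tokens loading slot `j` with the vector `v`. -/
def loadVec (I : List ℕ) (j : ℕ) : Vec →+ Vec where
  toFun v := (I.map fun i => Finsupp.single (plLoad j i) (v i)).sum
  map_zero' := by simp
  map_add' v w := by simp [← List.sum_map_add]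

theorem toVec_loadOf (I : List ℕ) (j : ℕ) (v : PairList) :
    toVec (loadOf I j v) = loadVec I j (toVec v) := by
  simp [toVec, loadOf, loadVec, amount_eq, Function.comp_def]

theorem part_loadVec (t : ℕ) (I : List ℕ) (j : ℕ) (v : Vec) : part t (loadVec I j v) =
    if t = 6 then (I.map fun i => Finsupp.single (Nat.pair j i) (v i)).sum else 0 := by
  simp only [loadVec, AddMonoidHom.coe_mk, ZeroHom.coe_mk, map_list_sum, List.map_map,
    Function.comp_def, plLoad, part_single]
  by_cases h : t = 6
  · simp [h]
  · simp [h, Ne.symm h]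

theorem part_undOf (t : ℕ) (I : List ℕ) (j : ℕ) : part t (toVec (undOf I j)) =
    if t = 4 then (I.map fun i => Finsupp.single (Nat.pair j i) 1).sum else 0 := by
  simp only [toVec, undOf, map_list_sum, List.map_map, Function.comp_def, plUnd, part_single]
  by_cases h : t = 4
  · simp [h]
  · simp [h, Ne.symm h]

theorem part_onP (t : ℕ) (l : PairList) :
    part t (toVec (onP l)) = if t = 0 then toVec l else 0 := by
  simp only [toVec, onP, map_list_sum, List.map_map, Function.comp_def, plP, part_single]
  by_cases h : t = 0
  · simp [h]
  · simp [h, Ne.symm h]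

theorem sum_single_pair_apply {I : List ℕ} (hI : I.Nodup) (j : ℕ) (f : ℕ → ℕ) (a i : ℕ) :
    (I.map fun i => Finsupp.single (Nat.pair j i) (f i)).sum (Nat.pair a i) =
      if a = j ∧ i ∈ I then f i else 0 := by
  induction I with
  | nil => simp
  | cons x I ih =>
    obtain ⟨hx, hI⟩ := List.nodup_cons.1 hI
    rw [List.map_cons, List.sum_cons, Finsupp.add_apply, ih hI, Finsupp.single_apply]
    simp only [Nat.pair_eq_pair, List.mem_cons]
    by_cases h : x = i
    · subst h
      by_cases h' : j = a
      · simp [h', hx]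
      · simp [h', Ne.symm h']
    · simp [h, Ne.symm h]

/-- The tokens in `w` that are sent to the places designated by `dst`. -/
def settled (dst : ℕ → Option ℕ) : Vec →+ Vec :=
  Finsupp.liftAddHom fun x => (dst x).elim 0 Finsupp.singleAddHom

theorem settled_single (dst : ℕ → Option ℕ) (x n : ℕ) :
    settled dst (Finsupp.single x n) = (dst x).elim 0 fun p => Finsupp.single p n := by
  simp only [settled, Finsupp.liftAddHom_apply_single]
  cases dst x <;> simp

theorem settled_update {dst : ℕ → Option ℕ} {x p : ℕ} (h : dst x = none) (w : Vec) :
    settled (Function.update dst x (some p)) w = settled dst w + Finsupp.single p (w x) := by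
  induction w using Finsupp.induction_linear with
  | zero => simp
  | add v w hv hw =>
    simp only [map_add, hv, hw, Finsupp.add_apply, Finsupp.single_add]
    abel
  | single y n =>
    rw [settled_single, settled_single]
    by_cases hy : y = x
    · subst hy; simp [h]
    · simp [hy]

/-- The balloons recorded by their contents. -/
def baseBalls (w : Vec) : Multiset Balloon :=
  (Finsupp.toMultiset w).map fun x =>
    (x.unpair.1, toVec ((Encodable.decode (α := PairList) x.unpair.2).getD []))

theorem baseBalls_add (v w : Vec) : baseBalls (v + w) = baseBalls v + baseBalls w := by
  simp [baseBalls]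

theorem baseBalls_single (s : ℕ) (k : PairList) :
    baseBalls (Finsupp.single (Nat.pair s (Encodable.encode k)) 1) = {(s, toVec k)} := by
  simp [baseBalls]

/-- The balloons held in slots, where slot `j` contains `κ j`. -/
def slotBalls (κ : ℕ → Vec) (w : Vec) : Multiset Balloon :=
  (Finsupp.toMultiset w).map fun x => (x.unpair.2, κ x.unpair.1)

theorem slotBalls_add (κ : ℕ → Vec) (v w : Vec) :
    slotBalls κ (v + w) = slotBalls κ v + slotBalls κ w := by
  simp [slotBalls]

theorem slotBalls_single (κ : ℕ → Vec) (j s : ℕ) :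
    slotBalls κ (Finsupp.single (Nat.pair j s) 1) = {(s, κ j)} := by
  simp [slotBalls]

/-- The slots in use according to `w`. -/
def usedSlots (w : Vec) : Multiset ℕ := (Finsupp.toMultiset w).map fun x => x.unpair.1

theorem usedSlots_add (v w : Vec) : usedSlots (v + w) = usedSlots v + usedSlots w := by
  simp [usedSlots]

theorem usedSlots_single (j s : ℕ) :
    usedSlots (Finsupp.single (Nat.pair j s) 1) = {j} := by
  simp [usedSlots]

theorem slotBalls_congr {κ κ' : ℕ → Vec} {w : Vec} (h : ∀ j ∈ usedSlots w, κ j = κ' j) :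
    slotBalls κ w = slotBalls κ' w :=
  Multiset.map_congr rfl fun x hx => by rw [h _ (Multiset.mem_map_of_mem _ hx)]

theorem mem_usedSlots {w : Vec} {j s : ℕ} (h : w (Nat.pair j s) ≠ 0) : j ∈ usedSlots w :=
  Multiset.mem_map.2 ⟨_, by simpa using h, by simp⟩

/-- A configuration `c` is represented by tokens `P` on the places of the VASSB, unused slots `A`,
balloons `B` recorded by contents, balloons `S` held in slots, balloon places `U` and `D` marked as
not deflated and as deflated, and contents `L`, where slot `j` contains `κ j` and the remaining
contents of a deflated balloon place are sent to `dst`. -/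
structure Rep (c : VConfig) (P A B S U D L : Vec) (κ : ℕ → Vec) (dst : ℕ → Option ℕ) :
    Prop where
  m : c.m = P + settled dst L
  bag : c.bag = baseBalls B + slotBalls κ S
  nodup : (Finsupp.toMultiset A + usedSlots S).Nodup
  und_le : ∀ x, U x ≤ 1
  und_dst : ∀ x, U x ≠ 0 → dst x = none
  und_load : ∀ j ∈ usedSlots S, ∀ i, U (Nat.pair j i) ≠ 0 → κ j i = L (Nat.pair j i)
  don : ∀ j ∈ usedSlots S, ∀ i, D (Nat.pair j i) ≠ 0 → κ j i = 0
  fresh : ∀ j, A j ≠ 0 → ∀ i, U (Nat.pair j i) = 0 ∧ D (Nat.pair j i) = 0 ∧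
    L (Nat.pair j i) = 0 ∧ dst (Nat.pair j i) = none

namespace Rep

variable {c : VConfig} {P A B S U D L : Vec} {κ : ℕ → Vec} {dst : ℕ → Option ℕ}

theorem removeP {v : Vec} (h : Rep c (P + v) A B S U D L κ dst) (q : ℕ) :
    ∃ m, c.m = m + v ∧ Rep ⟨q, m, c.bag⟩ P A B S U D L κ dst :=
  ⟨P + settled dst L, by rw [h.m]; abel, { h with m := rfl }⟩

theorem addP (h : Rep c P A B S U D L κ dst) (v : Vec) (q : ℕ) :
    Rep ⟨q, c.m + v, c.bag⟩ (P + v) A B S U D L κ dst :=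
  { h with m := by simp only [h.m]; abel }

theorem removeB {s : ℕ} {k : PairList}
    (h : Rep c P A (B + Finsupp.single (Nat.pair s (Encodable.encode k)) 1) S U D L κ dst)
    (q : ℕ) : ∃ n, c.bag = n + {(s, toVec k)} ∧ Rep ⟨q, c.m, n⟩ P A B S U D L κ dst :=
  ⟨baseBalls B + slotBalls κ S, by
    rw [h.bag, baseBalls_add, baseBalls_single, add_right_comm], { h with bag := rfl }⟩

theorem addB (h : Rep c P A B S U D L κ dst) (s : ℕ) (k : PairList) (q : ℕ) :
    Rep ⟨q, c.m, c.bag + {(s, toVec k)}⟩ P A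
      (B + Finsupp.single (Nat.pair s (Encodable.encode k)) 1) S U D L κ dst :=
  { h with bag := by simp only [h.bag, baseBalls_add, baseBalls_single, add_right_comm] }

theorem removeS {j s : ℕ}
    (h : Rep c P A B (S + Finsupp.single (Nat.pair j s) 1) U D L κ dst) (q : ℕ) :
    ∃ n, c.bag = n + {(s, κ j)} ∧ Rep ⟨q, c.m, n⟩ P A B S U D L κ dst := by
  have hS : usedSlots (S + Finsupp.single (Nat.pair j s) 1) = usedSlots S + {j} := by
    rw [usedSlots_add, usedSlots_single]
  have hn := h.nodup
  rw [hS, ← add_assoc] at hn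
  have hu := h.und_load
  have hd := h.don
  rw [hS] at hu hd
  refine ⟨baseBalls B + slotBalls κ S, ?_, { h with bag := rfl, nodup := ?_, und_load := ?_, don := ?_ }⟩
  · rw [h.bag, slotBalls_add, slotBalls_single, add_assoc]
  · exact Multiset.nodup_of_le (Multiset.le_add_right _ _) hn
  · exact fun j hj => hu j (Multiset.mem_add.2 (Or.inl hj))
  · exact fun j hj => hd j (Multiset.mem_add.2 (Or.inl hj))

/-- The slot `j` of a balloon is not used by other balloons. -/
theorem slot_notMem {j s : ℕ}
    (h : Rep c P A B (S + Finsupp.single (Nat.pair j s) 1) U D L κ dst) :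
    A j = 0 ∧ j ∉ usedSlots S := by
  have hn := h.nodup
  rw [usedSlots_add, usedSlots_single, ← add_assoc, Multiset.add_comm, Multiset.singleton_add,
    Multiset.nodup_cons, Multiset.mem_add] at hn
  push Not at hn
  exact ⟨by simpa using hn.1.1, hn.1.2⟩

/-- Add a balloon in a slot. -/
theorem addS {j s : ℕ} (h : Rep c P A B S U D L κ dst) (hA : A j = 0) (hS : j ∉ usedSlots S)
    (hu : ∀ i, U (Nat.pair j i) ≠ 0 → κ j i = L (Nat.pair j i))
    (hd : ∀ i, D (Nat.pair j i) ≠ 0 → κ j i = 0) (q : ℕ) :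
    Rep ⟨q, c.m, c.bag + {(s, κ j)}⟩ P A B (S + Finsupp.single (Nat.pair j s) 1) U D L κ dst := by
  have hS' : usedSlots (S + Finsupp.single (Nat.pair j s) 1) = usedSlots S + {j} := by
    rw [usedSlots_add, usedSlots_single]
  refine { h with bag := ?_, nodup := ?_, und_load := ?_, don := ?_ }
  · simp only [h.bag, slotBalls_add, slotBalls_single, add_assoc]
  · rw [hS', ← add_assoc, Multiset.add_comm, Multiset.singleton_add, Multiset.nodup_cons,
      Multiset.mem_add]
    refine ⟨?_, h.nodup⟩
    push Not
    exact ⟨by simpa using hA, hS⟩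
  · rw [hS']
    intro j' hj'
    rcases Multiset.mem_add.1 hj' with hj' | hj'
    · exact h.und_load j' hj'
    · rw [Multiset.mem_singleton.1 hj']; exact hu
  · rw [hS']
    intro j' hj'
    rcases Multiset.mem_add.1 hj' with hj' | hj'
    · exact h.don j' hj'
    · rw [Multiset.mem_singleton.1 hj']; exact hd

theorem changeS {j s : ℕ} (s' : ℕ)
    (h : Rep c P A B (S + Finsupp.single (Nat.pair j s) 1) U D L κ dst) (q : ℕ) :
    ∃ n, c.bag = n + {(s, κ j)} ∧ Rep ⟨q, c.m, n + {(s', κ j)}⟩ P A B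
      (S + Finsupp.single (Nat.pair j s') 1) U D L κ dst := by
  have hj : j ∈ usedSlots (S + Finsupp.single (Nat.pair j s) 1) := mem_usedSlots (s := s) (by simp)
  obtain ⟨n, hn, h'⟩ := h.removeS q
  exact ⟨n, hn, h'.addS h.slot_notMem.1 h.slot_notMem.2 (h.und_load j hj) (h.don j hj) q⟩

/-- Changing the contents of a slot that is not in use. -/
theorem congr_contents {κ' : ℕ → Vec} (h : Rep c P A B S U D L κ dst)
    (hκ : ∀ j ∈ usedSlots S, κ j = κ' j) : Rep c P A B S U D L κ' dst :=
  { h with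
    bag := by rw [h.bag, slotBalls_congr hκ]
    und_load := fun j hj => hκ j hj ▸ h.und_load j hj
    don := fun j hj => hκ j hj ▸ h.don j hj }

theorem removeA {x : Vec} (h : Rep c P (A + x) B S U D L κ dst) :
    Rep c P A B S U D L κ dst :=
  { h with
    nodup := Multiset.nodup_of_le (by simp) h.nodup
    fresh := fun j hj => h.fresh j (by rw [Finsupp.add_apply]; omega) }

theorem removeU {x : Vec} (h : Rep c P A B S (U + x) D L κ dst) :
    Rep c P A B S U D L κ dst := by
  have hU : ∀ y, U y ≤ (U + x) y := fun y => by simp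
  have hU' : ∀ y, U y ≠ 0 → (U + x) y ≠ 0 := fun y hy => by have := hU y; omega
  exact { h with
    und_le := fun y => (hU y).trans (h.und_le y)
    und_dst := fun y hy => h.und_dst y (hU' y hy)
    und_load := fun j hj i hi => h.und_load j hj i (hU' _ hi)
    fresh := fun j hj i => by
      obtain ⟨h1, h2⟩ := h.fresh j hj i
      exact ⟨Nat.le_zero.1 (h1 ▸ hU _), h2⟩ }

theorem removeD {x : Vec} (h : Rep c P A B S U (D + x) L κ dst) :
    Rep c P A B S U D L κ dst := by
  have hD : ∀ y, D y ≤ (D + x) y := fun y => by simp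
  exact { h with
    don := fun j hj i hi => h.don j hj i (by have := hD (Nat.pair j i); omega)
    fresh := fun j hj i => by
      obtain ⟨h1, h2, h3⟩ := h.fresh j hj i
      exact ⟨h1, Nat.le_zero.1 (h2 ▸ hD _), h3⟩ }

/-- Mark a balloon place of a slot in use as deflated. -/
theorem addD {j i : ℕ} (h : Rep c P A B S U D L κ dst) (hA : A j = 0) (hS : j ∉ usedSlots S) :
    Rep c P A B S U (D + Finsupp.single (Nat.pair j i) 1) L κ dst := by
  have hD : ∀ j', j' ≠ j → ∀ i', (D + Finsupp.single (Nat.pair j i) 1 : Vec) (Nat.pair j' i') =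
      D (Nat.pair j' i') := fun j' hj i' => by
    simp [Nat.pair_eq_pair, hj]
  refine { h with don := fun j' hj' i' hi' => ?_, fresh := fun j' hj' i' => ?_ }
  · rw [hD j' (fun h => hS (h ▸ hj'))] at hi'
    exact h.don j' hj' i' hi'
  · rw [hD j' (fun h => hj' (h ▸ hA))]
    exact h.fresh _ hj' _

/-- Contents without destination may be discarded. -/
theorem removeL {x : ℕ} (h : Rep c P A B S U D (L + Finsupp.single x 1) κ dst)
    (hU : U x = 0) (hd : dst x = none) : Rep c P A B S U D L κ dst := by
  have hL : ∀ y, y ≠ x → (L + Finsupp.single x 1 : Vec) y = L y := fun y hy => by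
    simp [hy]
  refine { h with m := ?_, und_load := fun j hj i hi => ?_, fresh := fun j hj i => ?_ }
  · rw [h.m, map_add, settled_single, hd]; simp
  · rw [h.und_load j hj i hi, hL _ fun e => hi (by rw [e, hU])]
  · obtain ⟨h1, h2, h3, h4⟩ := h.fresh j hj i
    exact ⟨h1, h2, by rw [Finsupp.add_apply] at h3; omega, h4⟩

/-- Contents with a destination may be moved there. -/
theorem moveL {x p : ℕ} (h : Rep c P A B S U D (L + Finsupp.single x 1) κ dst)
    (hd : dst x = some p) : Rep c (P + Finsupp.single p 1) A B S U D L κ dst := by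
  have hL : ∀ y, y ≠ x → (L + Finsupp.single x 1 : Vec) y = L y := fun y hy => by
    simp [hy]
  have hU : U x = 0 := by
    by_contra hU
    simp [h.und_dst x hU] at hd
  refine { h with m := ?_, und_load := fun j hj i hi => ?_, fresh := fun j hj i => ?_ }
  · rw [h.m, map_add, settled_single, hd]
    simp only [Option.elim_some]
    abel
  · rw [h.und_load j hj i hi, hL _ fun e => hi (by rw [e, hU])]
  · obtain ⟨h1, h2, h3, h4⟩ := h.fresh j hj i
    exact ⟨h1, h2, by rw [Finsupp.add_apply] at h3; omega, h4⟩

/-- Deflating a balloon place gives its contents a destination. -/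
theorem settle {x p : ℕ} (h : Rep c P A B S U D L κ dst) (hU : U x = 0) (hd : dst x = none)
    (hA : ∀ j i, A j ≠ 0 → Nat.pair j i ≠ x) (q : ℕ) :
    Rep ⟨q, c.m + Finsupp.single p (L x), c.bag⟩ P A B S U D L κ
      (Function.update dst x (some p)) := by
  refine { h with m := ?_, und_dst := fun y hy => ?_, fresh := fun j hj i => ?_ }
  · rw [settled_update hd, ← add_assoc, ← h.m]
  · rw [Function.update_of_ne (fun e => hy (by rw [e, hU]))]
    exact h.und_dst y hy
  · rw [Function.update_of_ne (hA j i hj)]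
    exact h.fresh j hj i

/-- Initialise the balloon places of a fresh slot. -/
theorem initSlot {j : ℕ} {I : List ℕ} (hI : I.Nodup) {v : Vec}
    (h : Rep c P (A + Finsupp.single j 1) B S U D L κ dst) :
    Rep c P A B S (U + (I.map fun i => Finsupp.single (Nat.pair j i) 1).sum) D
      (L + (I.map fun i => Finsupp.single (Nat.pair j i) (v i)).sum)
      (Function.update κ j v) dst ∧ A j = 0 ∧ j ∉ usedSlots S ∧
      (∀ i, (U + (I.map fun i => Finsupp.single (Nat.pair j i) 1).sum : Vec) (Nat.pair j i) ≠ 0 →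
        v i = (L + (I.map fun i => Finsupp.single (Nat.pair j i) (v i)).sum : Vec) (Nat.pair j i)) ∧
      ∀ i, D (Nat.pair j i) = 0 := by
  have hn := h.nodup
  rw [map_add, add_right_comm, Multiset.add_comm, Finsupp.toMultiset_single, one_nsmul,
    Multiset.singleton_add, Multiset.nodup_cons, Multiset.mem_add] at hn
  push Not at hn
  have hA : A j = 0 := by simpa using hn.1.1
  have hf := h.fresh j (by simp)
  have key := fun f a i => sum_single_pair_apply hI j f a i
  have hset : settled dst (I.map fun i => Finsupp.single (Nat.pair j i) (v i)).sum = 0 := by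
    rw [map_list_sum]
    refine List.sum_eq_zero fun x hx => ?_
    simp only [List.map_map, List.mem_map, Function.comp] at hx
    obtain ⟨i, -, rfl⟩ := hx
    rw [settled_single, (hf i).2.2.2]
    rfl
  have hne : ∀ j' ∈ usedSlots S, j' ≠ j := fun j' hj' e => hn.1.2 (e ▸ hj')
  have h' := h.removeA
  refine ⟨{ h' with
      m := ?_, bag := ?_, und_le := fun x => ?_, und_dst := fun x hx => ?_,
      und_load := fun j' hj' i hi => ?_, don := fun j' hj' i hi => ?_,
      fresh := fun j' hj' i => ?_ }, hA, hn.1.2, fun i hi => ?_, fun i => (hf i).2.1⟩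
  · rw [h.m, map_add, hset, add_zero]
  · rw [h.bag, slotBalls_congr fun j' hj' => ?_]
    rw [Function.update_of_ne (hne j' hj')]
  · rw [Finsupp.add_apply, ← Nat.pair_unpair x, key]
    split_ifs with hx
    · rw [hx.1, (hf _).1]
    · exact h.und_le _
  · rw [← Nat.pair_unpair x] at hx ⊢
    rw [Finsupp.add_apply, key] at hx
    by_cases hj : x.unpair.1 = j
    · rw [hj]; exact (hf _).2.2.2
    · exact h.und_dst _ (by simpa [hj] using hx)
  · rw [Finsupp.add_apply, key] at hi ⊢
    simp only [hne j' hj', false_and, if_false, add_zero, ne_eq, not_false_eq_true,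
      Function.update_of_ne] at hi ⊢
    exact h.und_load j' hj' i hi
  · rw [Function.update_of_ne (hne j' hj')]
    exact h.don j' hj' i hi
  · have : j' ≠ j := fun e => hj' (e ▸ hA)
    simp only [Finsupp.add_apply, key, this, false_and, if_false, add_zero]
    exact h'.fresh j' hj' i
  · rw [Finsupp.add_apply, key, (hf i).1] at hi
    rw [Finsupp.add_apply, key, (hf i).2.2.1]
    split_ifs at hi ⊢ with hi'
    · simp
    · simp at hi

end Rep

/-- The tokens `w` of the Petri net represent the configuration `c`. -/
def Represents (c : VConfig) (w : Vec) (κ : ℕ → Vec) (dst : ℕ → Option ℕ) : Prop :=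
  Rep c (part 0 w) (part 1 w) (part 2 w) (part 3 w) (part 4 w) (part 5 w) (part 6 w) κ dst

/-- The tokens of the Petri net in a given state correspond to a configuration satisfying `R`. -/
inductive Sound (E : List LEdge) (I : List ℕ) (qf : ℕ) (R : VConfig → Prop) : ℕ × Vec → Prop
  | atQ {c w κ dst} : R c → Represents c w κ dst → Sound E I qf R (stQ c.q, w)
  | atI {c r κ dst s L q' b x j} : R c → Represents c (r + Finsupp.single (plAv j) 1) κ dst →
      (c.q, LOp.inflate s L, q') ∈ E → b ∈ L → x ∈ periodSpan b.2 →
      Sound E I qf R (stI j b.2 q', r + Finsupp.single (plSpec j s) 1 + toVec (undOf I j) +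
        loadVec I j (toVec b.1 + x))
  | atD {c w κ dst j i p} : R c → Represents c w κ dst → dst (Nat.pair j i) = some p →
      Sound E I qf R (stD j i p c.q, w)
  | atT {c w κ dst j i} : R c → Represents c w κ dst → c.q = qf → dst (Nat.pair j i) = none →
      w (plUnd j i) = 0 → Sound E I qf R (stT j i, w)

theorem Sound.inv {E : List LEdge} {I : List ℕ} {qf : ℕ} {R : VConfig → Prop} {x : ℕ} {w : Vec}
    (h : Sound E I qf R (x, w)) :
    (∀ q, x = stQ q → ∃ c κ dst, R c ∧ c.q = q ∧ Represents c w κ dst) ∧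
    (∀ j vs q', x = stI j vs q' → ∃ c r κ dst s L b v, R c ∧
      Represents c (r + Finsupp.single (plAv j) 1) κ dst ∧ (c.q, LOp.inflate s L, q') ∈ E ∧
      b ∈ L ∧ b.2 = vs ∧ v ∈ periodSpan vs ∧ w = r + Finsupp.single (plSpec j s) 1 +
        toVec (undOf I j) + loadVec I j (toVec b.1 + v)) ∧
    (∀ j i p q', x = stD j i p q' → ∃ c κ dst, R c ∧ c.q = q' ∧ Represents c w κ dst ∧
      dst (Nat.pair j i) = some p) ∧
    (∀ j i, x = stT j i → ∃ c κ dst, R c ∧ c.q = qf ∧ Represents c w κ dst ∧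
      dst (Nat.pair j i) = none ∧ w (plUnd j i) = 0) := by
  cases h with
  | atQ h1 h2 =>
    refine ⟨fun q hq => ⟨_, _, _, h1, ?_, h2⟩, ?_, ?_, ?_⟩ <;>
      simp_all [stQ, stI, stD, stT, Nat.pair_eq_pair]
  | atI h1 h2 h3 h4 h5 =>
    refine ⟨?_, fun j vs q' hq => ?_, ?_, ?_⟩
    · simp [stQ, stI, Nat.pair_eq_pair]
    · simp only [stI, Nat.pair_eq_pair, Encodable.encode_inj, true_and] at hq
      obtain ⟨rfl, rfl, rfl⟩ := hq
      exact ⟨_, _, _, _, _, _, _, _, h1, h2, h3, h4, rfl, h5, rfl⟩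
    · simp [stD, stI, Nat.pair_eq_pair]
    · simp [stT, stI, Nat.pair_eq_pair]
  | atD h1 h2 h3 =>
    refine ⟨?_, ?_, fun j i p q' hq => ?_, ?_⟩
    · simp [stQ, stD, Nat.pair_eq_pair]
    · simp [stI, stD, Nat.pair_eq_pair]
    · simp only [stD, Nat.pair_eq_pair, true_and] at hq
      obtain ⟨rfl, rfl, rfl, hq⟩ := hq
      exact ⟨_, _, _, h1, hq, h2, h3⟩
    · simp [stT, stD, Nat.pair_eq_pair]
  | atT h1 h2 h3 h4 h5 =>
    refine ⟨?_, ?_, ?_, fun j i hq => ?_⟩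
    · simp [stQ, stT, Nat.pair_eq_pair]
    · simp [stI, stT, Nat.pair_eq_pair]
    · simp [stD, stT, Nat.pair_eq_pair]
    · simp only [stT, Nat.pair_eq_pair, true_and] at hq
      obtain ⟨rfl, rfl⟩ := hq
      exact ⟨_, _, _, h1, h3, h2, h4, h5⟩

theorem sound_step {E : List LEdge} {I : List ℕ} {B : List PairList} {K qf : ℕ}
    {R : VConfig → Prop} (hI : I.Nodup)
    (hR : ∀ l ∈ E, ∀ c c', R c → EdgeRel l.toV c c' → R c') {e : PetriEdge}
    (he : Gadget E I B K qf e) {r : Vec} (h : Sound E I qf R (e.1, r + toVec e.2.1)) :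
    Sound E I qf R (e.2.2.2, r + toVec e.2.2.1) := by
  cases he with
  | @delta q neg pos q' hE =>
    obtain ⟨c, κ, dst, hc, rfl, h⟩ := h.inv.1 _ rfl
    simp [Represents, part_onP] at h
    obtain ⟨m, hm, h⟩ := h.removeP q'
    refine Sound.atQ (c := ⟨q', m + toVec pos, c.bag⟩)
      (hR _ hE _ _ hc ⟨rfl, rfl, fun p => ?_, rfl⟩) (κ := κ) (dst := dst) ?_
    · simp [hm]
    · simpa [Represents, part_onP] using h.addP (toVec pos) q'
  | @inflateBase q s L q' b hE hb =>
    obtain ⟨c, κ, dst, hc, rfl, h⟩ := h.inv.1 _ rfl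
    refine Sound.atQ (c := ⟨q', c.m, c.bag + {(s, toVec b.1)}⟩)
      (hR _ hE _ _ hc ⟨rfl, rfl, rfl, _, (memSL_map_iff _ _).2 ⟨b, hb, 0, zero_mem _, ?_⟩, rfl⟩)
      (κ := κ) (dst := dst) ?_
    · simp
    · simp [Represents, part_single, plBase] at h ⊢
      exact h.addB s b.1 q'
  | @inflateStart q s L q' b j hE hb hj =>
    obtain ⟨c, κ, dst, hc, rfl, h⟩ := h.inv.1 _ rfl
    simp only [toVec_cons, toVec_nil, add_zero] at h
    have := Sound.atI (qf := qf) (I := I) hc h hE hb (zero_mem _)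
    simpa [toVec_loadOf, add_assoc] using this
  | @inflateLoop q s L q' b j v hE hb hj hv =>
    obtain ⟨c, r', κ, dst, s', L', b', x, hc, h, hE', hb', hbb, hx, hr⟩ := h.inv.2.1 _ _ _ rfl
    simp only [toVec_nil, add_zero] at hr
    have hx' : x + toVec v ∈ periodSpan b'.2 :=
      add_mem (hbb ▸ hx) (AddSubmonoid.subset_closure (List.mem_map_of_mem (hbb ▸ hv)))
    have := Sound.atI (qf := qf) (I := I) hc h hE' hb' hx'
    rw [hbb] at this
    simpa [hr, toVec_loadOf, add_assoc] using this
  | @inflateEnd q s L q' b j hE hb hj =>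
    obtain ⟨c, r', κ, dst, s', L', b', x, hc, h, hE', hb', hbb, hx, hr⟩ := h.inv.2.1 _ _ _ rfl
    simp only [toVec_nil, add_zero] at hr ⊢
    simp [Represents, part_single, plAv] at h
    obtain ⟨h, hA, hS, hu, hd⟩ := h.initSlot hI (v := toVec b'.1 + x)
    have h' := h.addS (s := s') hA hS (by simpa using hu) (fun i hi => (hi (hd i)).elim) q'
    simp only [Function.update_self] at h'
    refine Sound.atQ (c := ⟨q', c.m, c.bag + {(s', toVec b'.1 + x)}⟩)
      (hR _ hE' _ _ hc ⟨rfl, rfl, rfl, _, (memSL_map_iff _ _).2 ⟨b', hb', x, hbb ▸ hx, rfl⟩, rfl⟩)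
      (κ := Function.update κ j (toVec b'.1 + x)) (dst := dst) ?_
    rw [hr]
    simpa [Represents, part_single, plSpec, part_undOf, part_loadVec, -map_add,
      map_add (part _)] using h'
  | @deflateBase q s s' i p q' k hE hk =>
    obtain ⟨c, κ, dst, hc, rfl, h⟩ := h.inv.1 _ rfl
    simp [Represents, part_single, plBase] at h
    obtain ⟨n, hn, h⟩ := h.removeB q'
    refine Sound.atQ (c := ⟨q', c.m + Finsupp.single p (toVec k i),
        n + {(s', (toVec k).erase i)}⟩)
      (hR _ hE _ _ hc ⟨rfl, rfl, _, n, hn, rfl, rfl⟩) (κ := κ) (dst := dst) ?_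
    rw [← toVec_filter_ne]
    have h' := (h.addP (Finsupp.single p (toVec k i)) q').addB s'
      (k.filter fun x => x.1 ≠ i) q'
    simpa [Represents, part_single, plBase, plP, amount_eq] using h'
  | @deflateStart q s s' i p q' j hE hj =>
    obtain ⟨c, κ, dst, hc, rfl, h⟩ := h.inv.1 _ rfl
    simp [Represents, part_single, plSpec, plUnd] at h
    have hU : part 4 r (Nat.pair j i) = 0 := by
      have := h.und_le (Nat.pair j i)
      simp at this ⊢; omega
    have hd : dst (Nat.pair j i) = none := h.und_dst _ (by simp)
    have hκ := h.und_load j (mem_usedSlots (s := s) (by simp)) i (by simp)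
    obtain ⟨hA, hS⟩ := h.slot_notMem
    obtain ⟨n, hn, h'⟩ := h.removeS q'
    have h' := ((h'.removeU.settle (p := p) hU hd (fun j' i' hj' e => ?_) q').addD
      (j := j) (i := i) hA hS).congr_contents
      (κ' := Function.update κ j ((κ j).erase i))
      (fun j' hj' => by rw [Function.update_of_ne]; rintro rfl; exact hS hj')
    · have h' := h'.addS (s := s') hA hS (fun i' hi' => ?_) (fun i' hi' => ?_) q'
      · refine Sound.atD (c := ⟨q', c.m + Finsupp.single p (κ j i), n + {(s', (κ j).erase i)}⟩)
          (hR _ hE _ _ hc ⟨rfl, rfl, _, n, hn, rfl, rfl⟩)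
          (κ := Function.update κ j ((κ j).erase i))
          (dst := Function.update dst (Nat.pair j i) (some p)) ?_ (by simp)
        rw [hκ]
        simpa [Represents, part_single, plSpec, plDon] using h'
      · have hi : i' ≠ i := by rintro rfl; exact hi' hU
        rw [Function.update_self, Finsupp.erase_ne hi]
        refine h.und_load j (mem_usedSlots (s := s) (by simp)) i' ?_
        rw [Finsupp.add_apply]; omega
      · rw [Function.update_self]
        by_cases hi : i' = i
        · rw [hi, Finsupp.erase_same]
        · rw [Finsupp.erase_ne hi]
          exact h.don j (mem_usedSlots (s := s) (by simp)) i' (by simpa [hi, Ne.symm hi] using hi')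
    · rw [Nat.pair_eq_pair] at e
      exact hj' (e.1 ▸ hA)
  | @deflateLoop q s s' i p q' j hE hj =>
    obtain ⟨c, κ, dst, hc, rfl, h, hd⟩ := h.inv.2.2.1 _ _ _ _ rfl
    refine Sound.atD hc (κ := κ) (dst := dst) ?_ hd
    simp [Represents, part_single, plLoad] at h
    simpa [Represents, part_single, plP] using h.moveL hd
  | @deflateEnd q s s' i p q' j hE hj =>
    obtain ⟨c, κ, dst, hc, rfl, h, hd⟩ := h.inv.2.2.1 _ _ _ _ rfl
    exact Sound.atQ hc h
  | @deflateNull q s s' i p q' j hE hj =>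
    obtain ⟨c, κ, dst, hc, rfl, h⟩ := h.inv.1 _ rfl
    simp [Represents, part_single, plSpec, plDon] at h
    have hκ := h.don j (mem_usedSlots (s := s) (by simp)) i (by simp)
    have hκ' : (κ j).erase i = κ j := Finsupp.erase_of_notMem_support (by simpa using hκ)
    obtain ⟨n, hn, h⟩ := h.changeS s' q'
    refine Sound.atQ (c := ⟨q', c.m, n + {(s', κ j)}⟩) (κ := κ) (dst := dst)
      (hR _ hE _ _ hc ⟨rfl, rfl, _, n, hn, ?_, ?_⟩) ?_
    · simp [hκ]
    · rw [hκ']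
    · simpa [Represents, part_single, plSpec, plDon] using h
  | @burstBase q s q' k hE hk =>
    obtain ⟨c, κ, dst, hc, rfl, h⟩ := h.inv.1 _ rfl
    simp [Represents, part_single, plBase] at h
    obtain ⟨n, hn, h⟩ := h.removeB q'
    refine Sound.atQ (c := ⟨q', c.m, n⟩) (κ := κ) (dst := dst)
      (hR _ hE _ _ hc ⟨rfl, rfl, rfl, _, n, hn, rfl⟩) ?_
    simpa [Represents] using h
  | @burstSpec q s q' j hE hj =>
    obtain ⟨c, κ, dst, hc, rfl, h⟩ := h.inv.1 _ rfl
    simp [Represents, part_single, plSpec] at h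
    obtain ⟨n, hn, h⟩ := h.removeS q'
    refine Sound.atQ (c := ⟨q', c.m, n⟩) (κ := κ) (dst := dst)
      (hR _ hE _ _ hc ⟨rfl, rfl, rfl, _, n, hn, rfl⟩) ?_
    simpa [Represents] using h
  | @clearAv j hj =>
    obtain ⟨c, κ, dst, hc, hq, h⟩ := h.inv.1 _ rfl
    simp [Represents, part_single, plAv] at h
    rw [← hq]
    exact Sound.atQ hc (κ := κ) (dst := dst) (by simpa [Represents] using h.removeA)
  | @clearUnd j i hj hi =>
    obtain ⟨c, κ, dst, hc, hq, h⟩ := h.inv.1 _ rfl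
    simp [Represents, part_single, plUnd] at h
    refine Sound.atT hc (κ := κ) (dst := dst) (by simpa [Represents] using h.removeU) hq
      (h.und_dst _ (by simp)) ?_
    have := h.und_le (Nat.pair j i)
    simp [plUnd] at this ⊢; omega
  | @clearLoad j i hj hi =>
    obtain ⟨c, κ, dst, hc, hq, h, hd, hu⟩ := h.inv.2.2.2 _ _ rfl
    have hu' : part 4 r (Nat.pair j i) = 0 := by
      simp [plUnd] at hu ⊢; omega
    simp [Represents, part_single, plLoad] at h
    exact Sound.atT hc (κ := κ) (dst := dst) (by simpa [Represents] using h.removeL hu' hd) hq hd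
      (by simpa [plUnd] using hu')
  | @clearEnd j i hj hi =>
    obtain ⟨c, κ, dst, hc, hq, h, hd, hu⟩ := h.inv.2.2.2 _ _ rfl
    rw [← hq]
    exact Sound.atQ hc h
  | @clearDon j i hj hi =>
    obtain ⟨c, κ, dst, hc, hq, h⟩ := h.inv.1 _ rfl
    simp [Represents, part_single, plDon] at h
    rw [← hq]
    exact Sound.atQ hc (κ := κ) (dst := dst) (by simpa [Represents] using h.removeD)

theorem toMultiset_sum_single_range (K : ℕ) :
    Finsupp.toMultiset ((List.range K).map fun j => Finsupp.single j 1).sum =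
      Multiset.range K := by
  induction K with
  | zero => simp
  | succ K ih =>
    rw [List.range_succ, List.map_append, List.sum_append, map_add, ih, Multiset.range_succ,
      ← Multiset.singleton_add, Multiset.add_comm]
    simp

/-- Runs of the Petri net yield runs of the VASSB. -/
theorem vreach_of_petriReach {V : VASSB} {E : List LEdge} (hE : ∀ l ∈ E, l.toV ∈ V.edges)
    {I : List ℕ} (hI : I.Nodup) {B : List PairList} {K : ℕ} {q₁ q₂ : ℕ} {m₁ m₂ : PairList}
    (h : PetriReach (net E I B K q₂) (stQ q₁, toVec (startTokens K m₁))
      (stQ q₂, toVec (onP m₂))) :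
    VReach V ⟨q₁, toVec m₁, 0⟩ ⟨q₂, toVec m₂, 0⟩ := by
  have key : ∀ x, PetriReach (net E I B K q₂) (stQ q₁, toVec (startTokens K m₁)) x →
      Sound E I q₂ (VReach V ⟨q₁, toVec m₁, 0⟩) x := by
    intro x hx
    induction hx with
    | refl =>
      refine Sound.atQ (c := ⟨q₁, toVec m₁, 0⟩) (κ := 0) (dst := fun _ => none)
        Relation.ReflTransGen.refl ?_
      have : ∀ t, part t (toVec ((List.range K).map fun j => (plAv j, 1))) =
          if t = 1 then ((List.range K).map fun j => Finsupp.single j 1).sum else 0 := by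
        intro t
        simp only [toVec, map_list_sum, List.map_map, Function.comp_def, plAv, part_single]
        by_cases ht : t = 1
        · simp [ht]
        · simp [ht, Ne.symm ht]
      simp only [Represents, startTokens, toVec_append, map_add, part_onP, this]
      norm_num
      constructor
      · simp
      · simp [baseBalls, slotBalls]
      · rw [toMultiset_sum_single_range]; simpa [usedSlots] using Multiset.nodup_range K
      all_goals simp [usedSlots]
    | tail _ hst ih =>
      obtain ⟨e, he, r, rfl, rfl⟩ := hst
      exact sound_step hI (fun l hl c c' hc hcc => hc.tail ⟨_, hE l hl, hcc⟩)
        (gadget_of_mem_net he) ih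
  obtain ⟨c, κ, dst, hc, rfl, hw⟩ := (key _ h).inv.1 _ rfl
  simp only [Represents, part_onP] at hw
  have hm := hw.m
  have hb := hw.bag
  simp [baseBalls, slotBalls] at hm hb
  obtain ⟨q, m, n⟩ := c
  subst hm hb
  exact hc

/-! ### Runs with individual balloons -/

/-- The history of a balloon: `none` before it is inflated, `some (some s)` while it has state
`s`, `some none` after it is burst; together with the list of the balloon places deflated so far
and the places they were deflated to. -/
abbrev History : Type := Option (Option ℕ) × List (ℕ × ℕ)

/-- Record a deflation; only the first one of each balloon place matters. -/
def recordDeflate (D : List (ℕ × ℕ)) (i p : ℕ) : List (ℕ × ℕ) :=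
  if i ∈ D.map Prod.fst then D else D ++ [(i, p)]

/-- The effect of an edge on the balloon it acts on. -/
inductive HistStep : LOp → History → History → Prop
  | delta {neg pos x} : HistStep (.delta neg pos) x x
  | inflate {s L} : HistStep (.inflate s L) (none, []) (some (some s), [])
  | deflate {s s' i p D} :
      HistStep (.deflate s s' i p) (some (some s), D) (some (some s'), recordDeflate D i p)
  | burst {s D} : HistStep (.burst s) (some (some s), D) (some none, D)

/-- The tokens obtained from contents `k` by the deflations in `D`. -/
def moved (D : List (ℕ × ℕ)) : Vec →+ Vec where
  toFun k := (D.map fun x => Finsupp.single x.2 (k x.1)).sum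
  map_zero' := by simp
  map_add' v w := by simp [← List.sum_map_add]

theorem moved_append (D D' : List (ℕ × ℕ)) (k : Vec) :
    moved (D ++ D') k = moved D k + moved D' k := by
  simp [moved]

@[simp] theorem moved_nil (k : Vec) : moved [] k = 0 := rfl

@[simp] theorem moved_singleton (x : ℕ × ℕ) (k : Vec) :
    moved [x] k = Finsupp.single x.2 (k x.1) := by
  simp [moved]

/-- What is left of contents `k` after the deflations in `D`. -/
def leftover (D : List (ℕ × ℕ)) (k : Vec) : Vec := k.filter fun i => i ∉ D.map Prod.fst

theorem leftover_apply (D : List (ℕ × ℕ)) (k : Vec) (j : ℕ) :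
    leftover D k j = if j ∈ D.map Prod.fst then 0 else k j := by
  rw [leftover, Finsupp.filter_apply]
  split_ifs <;> rfl

theorem leftover_nil (k : Vec) : leftover [] k = k := by
  ext j
  rw [leftover_apply, if_neg (by simp)]

theorem mem_recordDeflate {D : List (ℕ × ℕ)} {i p j : ℕ} :
    j ∈ (recordDeflate D i p).map Prod.fst ↔ j ∈ D.map Prod.fst ∨ j = i := by
  unfold recordDeflate
  split_ifs with h
  · exact ⟨Or.inl, fun h' => h'.elim id fun e => e ▸ h⟩
  · simp

theorem leftover_recordDeflate (D : List (ℕ × ℕ)) (i p : ℕ) (k : Vec) :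
    leftover (recordDeflate D i p) k = (leftover D k).erase i := by
  ext j
  simp only [Finsupp.erase_apply, leftover_apply, mem_recordDeflate]
  by_cases hj : j = i
  · simp [hj]
  · simp only [hj, or_false, if_false]

theorem moved_recordDeflate (D : List (ℕ × ℕ)) (i p : ℕ) (k : Vec) :
    moved (recordDeflate D i p) k = moved D k + Finsupp.single p (leftover D k i) := by
  unfold recordDeflate
  rw [leftover_apply]
  split_ifs with h
  · simp
  · rw [moved_append]; simp

/-- The balloon with a given history, inflated with contents `k`. -/
def ballOf (k : Vec) : History → Multiset Balloon
  | (some (some s), D) => {(s, leftover D k)}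
  | _ => 0

theorem mem_ballOf {k : Vec} {x : History} {b : Balloon} (h : b ∈ ballOf k x) :
    ∃ D, x = (some (some b.1), D) ∧ b.2 = leftover D k := by
  obtain ⟨_ | _ | s, D⟩ := x
  · simp [ballOf] at h
  · simp [ballOf] at h
  · obtain rfl := Multiset.mem_singleton.1 h
    exact ⟨D, rfl, rfl⟩

/-- The token change due to an edge label. -/
def LOp.effect : LOp → ZVec
  | .delta neg pos => toZ (toVec pos) - toZ (toVec neg)
  | _ => 0

/-- Runs of individual balloons `z < N`, inflated to contents in the linear set `set z` with
`extra z` added to the base vector, from given tokens and histories to a configuration without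
balloons. -/
inductive Path (E : List LEdge) (N : ℕ) (set : ℕ → PairList × List PairList) (extra : ℕ → Vec)
    (q₂ : ℕ) (m₂ : Vec) : ℕ → Vec → (ℕ → History) → Prop
  | nil {ℓ} : (∀ z, N ≤ z → ℓ z = (none, [])) → (∀ z s, (ℓ z).1 ≠ some (some s)) →
      Path E N set extra q₂ m₂ q₂ m₂ ℓ
  | cons {q m ℓ op q' m' ℓ' a} : (q, op, q') ∈ E → HistStep op (ℓ a) (ℓ' a) →
      (∀ z, z ≠ a → ℓ' z = ℓ z) → (∀ z, N ≤ z → ℓ z = (none, [])) →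
      (∀ s L, op = .inflate s L → set a ∈ L) →
      toZ m' + toZ (moved (ℓ a).2 (toVec (set a).1 + extra a)) =
        toZ m + op.effect + toZ (moved (ℓ' a).2 (toVec (set a).1 + extra a)) →
      Path E N set extra q₂ m₂ q' m' ℓ' → Path E N set extra q₂ m₂ q m ℓ

theorem sum_ballOf_update {N z : ℕ} (hz : z < N) (κ : ℕ → Vec) (ℓ : ℕ → History) (x : History) :
    ∑ y ∈ Finset.range N, ballOf (κ y) (Function.update ℓ z x y) =
      ∑ y ∈ (Finset.range N).erase z, ballOf (κ y) (ℓ y) + ballOf (κ z) x := by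
  rw [← Finset.sum_erase_add _ _ (Finset.mem_range.2 hz), Function.update_self]
  congr 1
  refine Finset.sum_congr rfl fun y hy => ?_
  rw [Function.update_of_ne (Finset.ne_of_mem_erase hy)]

theorem exists_of_bag_eq {N : ℕ} {κ : ℕ → Vec} {ℓ : ℕ → History} {n : Multiset Balloon}
    {b : Balloon} (h : ∑ y ∈ Finset.range N, ballOf (κ y) (ℓ y) = n + {b}) :
    ∃ z < N, ∃ D, ℓ z = (some (some b.1), D) ∧ b.2 = leftover D (κ z) ∧
      n = ∑ y ∈ (Finset.range N).erase z, ballOf (κ y) (ℓ y) := by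
  have hb : b ∈ ∑ y ∈ Finset.range N, ballOf (κ y) (ℓ y) := by simp [h]
  obtain ⟨z, hz, hb⟩ := Multiset.mem_sum.1 hb
  obtain ⟨D, hD, hbD⟩ := mem_ballOf hb
  refine ⟨z, Finset.mem_range.1 hz, D, hD, hbD, ?_⟩
  rw [← Finset.sum_erase_add _ _ hz, hD] at h
  have : ballOf (κ z) (some (some b.1), D) = {b} := by
    rw [ballOf, ← hbD]
  rw [this] at h
  exact (add_right_cancel h).symm

theorem exists_path {V : VASSB} {E : List LEdge} (hE : ∀ e ∈ V.edges, ∃ l ∈ E, e = l.toV)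
    {c c₂ : VConfig} (hc₂ : c₂.bag = 0) (h : VReach V c c₂) :
    ∀ (N : ℕ) (set : ℕ → PairList × List PairList) (extra : ℕ → Vec) (ℓ : ℕ → History),
      (∀ z, N ≤ z → ℓ z = (none, [])) →
      (∀ z < N, set z ∈ linearSets E ∧ extra z ∈ periodSpan (set z).2) →
      c.bag = ∑ z ∈ Finset.range N, ballOf (toVec (set z).1 + extra z) (ℓ z) →
      ∃ N' set' extra', (∀ z < N', set' z ∈ linearSets E ∧ extra' z ∈ periodSpan (set' z).2) ∧
        N ≤ N' ∧ (∀ z < N, set' z = set z ∧ extra' z = extra z) ∧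
        Path E N' set' extra' c₂.q c₂.m c.q c.m ℓ := by
  induction h using Relation.ReflTransGen.head_induction_on with
  | refl =>
    intro N set extra ℓ hN hset hbag
    refine ⟨N, set, extra, hset, le_rfl, fun _ _ => ⟨rfl, rfl⟩, .nil hN fun z s hz => ?_⟩
    have hzN : z < N := by
      by_contra hzN
      rw [hN z (not_lt.1 hzN)] at hz
      simp at hz
    rw [hc₂, eq_comm, Finset.sum_eq_zero_iff] at hbag
    have := hbag z (Finset.mem_range.2 hzN)
    rcases h : ℓ z with ⟨x, D⟩
    rw [h] at hz this
    dsimp only at hz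
    rw [hz] at this
    simp [ballOf] at this
  | @head c c' hcc' _ ih =>
    intro N set extra ℓ hN hset hbag
    obtain ⟨e, he, h1, h2, h3⟩ := hcc'
    obtain ⟨⟨q, op, q'⟩, hl, rfl⟩ := hE e he
    obtain ⟨cq, m, n⟩ := c
    obtain ⟨cq', m', n'⟩ := c'
    dsimp only [LEdge.toV] at h1 h2 h3 ih hbag ⊢
    subst h1 h2
    cases op with
    | delta neg pos =>
      obtain ⟨h3, rfl⟩ := h3
      obtain ⟨N', set', extra', hset', hNN, hag, hp⟩ := ih N set extra ℓ hN hset hbag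
      refine ⟨N', set', extra', hset', hNN, hag, .cons hl (a := 0) .delta (fun _ _ => rfl)
        (fun z hz => hN z (hNN.trans hz)) (by simp) ?_ hp⟩
      congr 1
      ext p
      simpa [LOp.effect] using h3 p
    | inflate s L =>
      obtain ⟨rfl, k, hk, rfl⟩ := h3
      obtain ⟨b, hb, x, hx, rfl⟩ := (memSL_map_iff _ _).1 hk
      have hbE : b ∈ linearSets E := List.mem_flatMap.2 ⟨_, hl, hb⟩
      obtain ⟨N', set', extra', hset', hNN, hag, hp⟩ := ih (N + 1) (Function.update set N b)
        (Function.update extra N x) (Function.update ℓ N (some (some s), []))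
        (fun z hz => by
          rw [Function.update_of_ne (by omega)]; exact hN z (by omega))
        (fun z hz => by
          by_cases hzN : z = N
          · subst hzN; simp [hbE, hx]
          · simp only [Function.update_of_ne hzN]
            exact hset z (by omega))
        (by
          rw [Finset.sum_range_succ, hbag]
          congr 1
          · refine Finset.sum_congr rfl fun z hz => ?_
            have hzN : z ≠ N := (Finset.mem_range.1 hz).ne
            simp [hzN]
          · simp [ballOf, leftover_nil])
      have hN' := hag N (Nat.lt_succ_self N)
      simp only [Function.update_self] at hN'
      refine ⟨N', set', extra', hset', by omega, fun z hz => ?_, .cons hl (a := N) ?_ ?_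
        (fun z hz => hN z (by omega)) ?_ ?_ hp⟩
      · have := hag z (by omega)
        simpa [Function.update_of_ne hz.ne] using this
      · rw [hN N le_rfl, Function.update_self]
        exact .inflate
      · intro z hz
        rw [Function.update_of_ne hz]
      · rintro _ _ ⟨⟩
        rw [hN'.1]; exact hb
      · simp [hN N le_rfl, LOp.effect]
    | deflate s s' i p =>
      obtain ⟨k, n0, rfl, rfl, rfl⟩ := h3
      obtain ⟨z, hz, D, hD, hk, rfl⟩ := exists_of_bag_eq hbag.symm
      dsimp only at hk hD
      obtain ⟨N', set', extra', hset', hNN, hag, hp⟩ := ih N set extra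
        (Function.update ℓ z (some (some s'), recordDeflate D i p))
        (fun y hy => by rw [Function.update_of_ne (by omega)]; exact hN y hy) hset
        (by rw [sum_ballOf_update hz, ballOf, leftover_recordDeflate, hk])
      refine ⟨N', set', extra', hset', hNN, hag, .cons hl (a := z) ?_ ?_
        (fun y hy => hN y (hNN.trans hy)) (by simp) ?_ hp⟩
      · rw [hD, Function.update_self]
        exact .deflate
      · intro y hy
        rw [Function.update_of_ne hy]
      · rw [hD, Function.update_self, moved_recordDeflate, (hag z hz).1, (hag z hz).2, ← hk]
        simp only [LOp.effect, map_add]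
        abel
    | burst s =>
      obtain ⟨rfl, k, n0, rfl, rfl⟩ := h3
      obtain ⟨z, hz, D, hD, hk, rfl⟩ := exists_of_bag_eq hbag.symm
      dsimp only at hk hD
      obtain ⟨N', set', extra', hset', hNN, hag, hp⟩ := ih N set extra
        (Function.update ℓ z (some none, D))
        (fun y hy => by rw [Function.update_of_ne (by omega)]; exact hN y hy) hset
        (by rw [sum_ballOf_update hz]; simp [ballOf])
      refine ⟨N', set', extra', hset', hNN, hag, .cons hl (a := z) ?_ ?_
        (fun y hy => hN y (hNN.trans hy)) (by simp) ?_ hp⟩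
      · rw [hD, Function.update_self]
        exact .burst
      · intro y hy
        rw [Function.update_of_ne hy]
      · rw [hD, Function.update_self]
        simp [LOp.effect]

/-- A run given by the histories `st t z` of the balloons `z < N` at the times `t`; the run has
`n` steps and stutters afterwards. The balloon `z` is inflated to contents in `set z`. -/
structure Thread (E : List LEdge) (N : ℕ) (set : ℕ → PairList × List PairList) where
  n : ℕ
  q : ℕ → ℕ
  op : ℕ → LOp
  actor : ℕ → ℕ
  st : ℕ → ℕ → History
  edge : ∀ t < n, (q t, op t, q (t + 1)) ∈ E
  idle : ∀ t, n ≤ t → op t = .delta [] []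
  step : ∀ t, HistStep (op t) (st t (actor t)) (st (t + 1) (actor t))
  frame : ∀ t z, z ≠ actor t → st (t + 1) z = st t z
  bound : ∀ t z, N ≤ z → st t z = (none, [])
  done : ∀ z s, (st n z).1 ≠ some (some s)
  set_mem : ∀ t s L, op t = .inflate s L → set (actor t) ∈ L

/-- The tokens moved from the balloons to the places before time `t`. -/
def Thread.movedAt {E N set} (T : Thread E N set) (extra : ℕ → Vec) (t : ℕ) : Vec :=
  ∑ z ∈ Finset.range N, moved (T.st t z).2 (toVec (set z).1 + extra z)

/-- The token vectors of a run, given the first one and the contents of the balloons. -/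
def Thread.Realizes {E N set} (T : Thread E N set) (extra : ℕ → Vec) (m : Vec) (M : ℕ → Vec) :
    Prop :=
  ∀ t, toZ (M t) = toZ m + ∑ s ∈ Finset.range t, (T.op s).effect + toZ (T.movedAt extra t)

theorem Thread.movedAt_succ {E N set} (T : Thread E N set) (extra : ℕ → Vec) (t : ℕ) :
    T.movedAt extra (t + 1) +
        moved (T.st t (T.actor t)).2 (toVec (set (T.actor t)).1 + extra (T.actor t)) =
      T.movedAt extra t +
        moved (T.st (t + 1) (T.actor t)).2 (toVec (set (T.actor t)).1 + extra (T.actor t)) := by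
  by_cases h : T.actor t < N
  · have h' := Finset.mem_range.2 h
    rw [movedAt, movedAt, ← Finset.sum_erase_add _ _ h', ← Finset.sum_erase_add _ _ h',
      Finset.sum_congr rfl fun z hz => by rw [T.frame t z (Finset.ne_of_mem_erase hz)]]
    abel
  · rw [T.bound _ _ (not_lt.1 h), T.bound _ _ (not_lt.1 h), movedAt, movedAt]
    congr 1
    refine Finset.sum_congr rfl fun z hz => ?_
    rw [T.frame t z fun h' => h (h' ▸ Finset.mem_range.1 hz)]

theorem Path.exists_thread {E N set extra q₂ m₂ q m ℓ} (h : Path E N set extra q₂ m₂ q m ℓ) :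
    ∃ (T : Thread E N set) (M : ℕ → Vec), T.q 0 = q ∧ T.q T.n = q₂ ∧ T.st 0 = ℓ ∧ M 0 = m ∧
      M T.n = m₂ ∧ ∀ t,
      toZ (M (t + 1)) + toZ (T.movedAt extra t) =
        toZ (M t) + (T.op t).effect + toZ (T.movedAt extra (t + 1)) := by
  induction h with
  | @nil ℓ hN hd =>
    refine ⟨⟨0, fun _ => q₂, fun _ => .delta [] [], fun _ => 0, fun _ => ℓ, by simp, by simp,
      fun _ => .delta, fun _ _ _ => rfl, fun _ => hN, hd, by simp⟩, fun _ => m₂, rfl, rfl, rfl,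
      rfl, rfl, fun t => ?_⟩
    simp [LOp.effect, Thread.movedAt]
  | @cons q m ℓ op q' m' ℓ' a he hs hf hb hset hm _ ih =>
    obtain ⟨T, M, rfl, rfl, rfl, rfl, rfl, hM⟩ := ih
    let T' : Thread E N set :=
      { n := T.n + 1
        q := fun t => t.casesOn q T.q
        op := fun t => t.casesOn op T.op
        actor := fun t => t.casesOn a T.actor
        st := fun t => t.casesOn ℓ T.st
        edge := by
          rintro (_ | t) ht
          · exact he
          · exact T.edge t (by omega)
        idle := by
          rintro (_ | t) ht
          · omega
          · exact T.idle t (by omega)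
        step := by
          rintro (_ | t)
          · exact hs
          · exact T.step t
        frame := by
          rintro (_ | t)
          · exact hf
          · exact T.frame t
        bound := by
          rintro (_ | t)
          · exact hb
          · exact T.bound t
        done := T.done
        set_mem := by
          rintro (_ | t)
          · exact hset
          · exact T.set_mem t }
    refine ⟨T', fun t => t.casesOn m M, rfl, rfl, rfl, rfl, rfl, ?_⟩
    rintro (_ | t)
    · have h1 := congrArg toZ (T'.movedAt_succ extra 0)
      rw [map_add toZ, map_add toZ] at h1
      change _ + toZ (moved (ℓ a).2 (toVec (set a).1 + extra a)) =
        _ + toZ (moved (T.st 0 a).2 (toVec (set a).1 + extra a)) at h1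
      change toZ (M 0) + _ = toZ m + op.effect + _
      rw [← add_left_inj (toZ (moved (ℓ a).2 (toVec (set a).1 + extra a))),
        add_assoc (toZ m + op.effect), h1, add_right_comm, hm]
      abel
    · exact hM t

theorem Path.exists_realizes {E N set extra q₂ m₂ q m}
    (h : Path E N set extra q₂ m₂ q m fun _ => (none, [])) :
    ∃ (T : Thread E N set) (M : ℕ → Vec), T.q 0 = q ∧ T.q T.n = q₂ ∧
      (∀ z, T.st 0 z = (none, [])) ∧ M T.n = m₂ ∧ T.Realizes extra m M := by
  obtain ⟨T, M, h1, h2, h3, rfl, h5, h6⟩ := h.exists_thread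
  refine ⟨T, M, h1, h2, fun z => by rw [h3], h5, fun t => ?_⟩
  induction t with
  | zero => simp [Thread.movedAt, h3]
  | succ t ih =>
    have := h6 t
    rw [ih] at this
    rw [Finset.sum_range_succ, ← add_left_inj (toZ (T.movedAt extra t)), this]
    abel

namespace Thread

variable {E : List LEdge} {N : ℕ} {set : ℕ → PairList × List PairList}

theorem prefix_succ (T : Thread E N set) (t z : ℕ) : (T.st t z).2 <+: (T.st (t + 1) z).2 := by
  by_cases hz : z = T.actor t
  · subst hz
    have := T.step t
    generalize T.op t = o, T.st t (T.actor t) = a, T.st (t + 1) (T.actor t) = b at this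
    cases this with
    | delta => exact List.prefix_refl _
    | inflate => exact List.prefix_refl _
    | burst => exact List.prefix_refl _
    | deflate =>
      dsimp only [recordDeflate]
      split_ifs
      exacts [List.prefix_refl _, List.prefix_append _ _]
  · rw [T.frame t z hz]

theorem prefix_of_le (T : Thread E N set) {t t' : ℕ} (h : t ≤ t') (z : ℕ) :
    (T.st t z).2 <+: (T.st t' z).2 := by
  induction t', h using Nat.le_induction with
  | base => exact List.prefix_refl _
  | succ t' _ ih => exact ih.trans (T.prefix_succ t' z)

theorem st_of_le (T : Thread E N set) {t : ℕ} (h : T.n ≤ t) (z : ℕ) : T.st t z = T.st T.n z := by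
  induction t, h using Nat.le_induction with
  | base => rfl
  | succ t ht ih =>
    rw [← ih]
    by_cases hz : z = T.actor t
    · have := T.step t
      rw [T.idle t ht, ← hz] at this
      generalize T.st t z = a, T.st (t + 1) z = b at this
      cases this
      rfl
    · exact T.frame t z hz

theorem prefix_last (T : Thread E N set) (t z : ℕ) : (T.st t z).2 <+: (T.st T.n z).2 := by
  rcases le_total t T.n with h | h
  · exact T.prefix_of_le h z
  · rw [T.st_of_le h]

/-- The number of balloon places that `z` has been deflated on before time `t`. -/
def phase (T : Thread E N set) (z t : ℕ) : ℕ := (T.st t z).2.length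

theorem phase_mono (T : Thread E N set) (z : ℕ) : Monotone (T.phase z) :=
  fun _ _ h => (T.prefix_of_le h z).length_le

/-- Whenever the balloons `x` and `y` change order, they meet in between. -/
def Meets (T : Thread E N set) (x y : ℕ) : Prop :=
  ∀ s t, T.phase y s < T.phase x s → T.phase x t < T.phase y t →
    ∃ w, (s ≤ w ∧ w ≤ t ∨ t ≤ w ∧ w ≤ s) ∧ T.st w x = T.st w y

/-- The balloon `y` is ahead of `x` at some time that can be reached from `s` without meeting. -/
def Behind (T : Thread E N set) (x y s : ℕ) : Prop :=
  ∃ r, T.phase x r < T.phase y r ∧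
    ∀ w, (s < w ∧ w ≤ r ∨ r ≤ w ∧ w ≤ s) → T.st w x ≠ T.st w y

theorem st_eq_of_behind_ne {T : Thread E N set} {x y s : ℕ}
    (h : ¬ (T.Behind x y s ↔ T.Behind x y (s + 1))) : T.st (s + 1) x = T.st (s + 1) y := by
  by_contra hne
  refine h ⟨fun ⟨r, hr, hw⟩ => ⟨r, hr, fun w h' => ?_⟩, fun ⟨r, hr, hw⟩ => ⟨r, hr, fun w h' => ?_⟩⟩
  · by_cases hws : w = s + 1
    · rwa [hws]
    · exact hw w (by omega)
  · by_cases hws : w = s + 1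
    · rwa [hws]
    · exact hw w (by omega)

open Classical in
/-- The permutation of balloons keeping `x` ahead of `y`. -/
def swapAt (T : Thread E N set) (x y t : ℕ) : Equiv.Perm ℕ :=
  if T.Behind x y t then Equiv.swap x y else 1

theorem st_swap_of_eq {T : Thread E N set} {x y t : ℕ} (h : T.st t x = T.st t y) (z : ℕ) :
    T.st t (Equiv.swap x y z) = T.st t z := by
  rcases eq_or_ne z x with rfl | hx
  · rw [Equiv.swap_apply_left, h]
  rcases eq_or_ne z y with rfl | hy
  · rw [Equiv.swap_apply_right, h]
  rw [Equiv.swap_apply_of_ne_of_ne hx hy]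

theorem st_swapAt_succ (T : Thread E N set) (x y t z : ℕ) :
    T.st (t + 1) (T.swapAt x y (t + 1) z) = T.st (t + 1) (T.swapAt x y t z) := by
  unfold swapAt
  by_cases h : T.Behind x y t ↔ T.Behind x y (t + 1)
  · split_ifs <;> first | rfl | (exfalso; tauto)
  · have := st_eq_of_behind_ne h
    split_ifs <;> simp [st_swap_of_eq this]

theorem swapAt_swapAt (T : Thread E N set) (x y t z : ℕ) :
    T.swapAt x y t (T.swapAt x y t z) = z := by
  unfold swapAt
  split_ifs <;> simp

theorem swapAt_cases (T : Thread E N set) (x y t : ℕ) :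
    (T.Behind x y t ∧ T.swapAt x y t = Equiv.swap x y) ∨
      (¬ T.Behind x y t ∧ T.swapAt x y t = 1) := by
  unfold swapAt
  split_ifs with h
  exacts [Or.inl ⟨h, rfl⟩, Or.inr ⟨h, rfl⟩]

theorem swapAt_of_ne (T : Thread E N set) {x y z : ℕ} (hx : z ≠ x) (hy : z ≠ y) (t : ℕ) :
    T.swapAt x y t z = z := by
  rcases T.swapAt_cases x y t with ⟨_, h⟩ | ⟨_, h⟩ <;> rw [h]
  · exact Equiv.swap_apply_of_ne_of_ne hx hy
  · rfl

theorem set_swapAt (T : Thread E N set) {x y : ℕ} (h : set x = set y) (t z : ℕ) :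
    set (T.swapAt x y t z) = set z := by
  rcases T.swapAt_cases x y t with ⟨_, h'⟩ | ⟨_, h'⟩ <;> rw [h']
  · rcases eq_or_ne z x with rfl | hx
    · rw [Equiv.swap_apply_left, h]
    rcases eq_or_ne z y with rfl | hy
    · rw [Equiv.swap_apply_right, h]
    rw [Equiv.swap_apply_of_ne_of_ne hx hy]
  · rfl

/-- Exchange the balloons `x` and `y` so that `x` is always ahead. -/
def exchange (T : Thread E N set) {x y : ℕ} (hx : x < N) (hy : y < N) (hset : set x = set y) :
    Thread E N set where
  n := T.n
  q := T.q
  op := T.op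
  actor t := T.swapAt x y t (T.actor t)
  st t z := T.st t (T.swapAt x y t z)
  edge := T.edge
  idle := T.idle
  step t := by
    rw [st_swapAt_succ, swapAt_swapAt]
    exact T.step t
  frame t z hz := by
    rw [st_swapAt_succ]
    refine T.frame t _ fun h => hz ?_
    rw [← h, swapAt_swapAt]
  bound t z hz := by
    rw [T.swapAt_of_ne (by omega) (by omega)]
    exact T.bound t z hz
  done z := T.done _
  set_mem t s L h := by
    rw [set_swapAt T hset]
    exact T.set_mem t s L h

theorem exchange_ahead {T : Thread E N set} {x y : ℕ} (hx : x < N) (hy : y < N)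
    (hset : set x = set y) (h : T.Meets x y) (t : ℕ) :
    (T.exchange hx hy hset).phase y t ≤ (T.exchange hx hy hset).phase x t := by
  change T.phase (T.swapAt x y t y) t ≤ T.phase (T.swapAt x y t x) t
  rcases T.swapAt_cases x y t with ⟨hb, h'⟩ | ⟨hb, h'⟩ <;> rw [h']
  · rw [Equiv.swap_apply_left, Equiv.swap_apply_right]
    by_contra! hlt
    obtain ⟨r, hr, hw⟩ := hb
    obtain ⟨w, hw', he⟩ := h t r hlt hr
    refine hw w ?_ he
    by_cases hwt : w = t
    · subst hwt
      unfold phase at hlt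
      rw [he] at hlt
      exact absurd hlt (lt_irrefl _)
    · omega
  · change T.phase y t ≤ T.phase x t
    by_contra! hlt
    refine hb ⟨t, hlt, fun w hw he => ?_⟩
    obtain rfl : w = t := by omega
    unfold phase at hlt
    rw [he] at hlt
    exact absurd hlt (lt_irrefl _)

theorem exists_add_of_isInitial {D D' : List (ℕ × ℕ)} (h : D <+: D') (k : Vec) :
    ∃ w, moved D' k = moved D k + w := by
  obtain ⟨R, rfl⟩ := h
  exact ⟨moved R k, moved_append _ _ _⟩

theorem movedAt_eq (T : Thread E N set) (extra : ℕ → Vec) (t : ℕ) :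
    T.movedAt extra t = ∑ z ∈ Finset.range N, moved (T.st t z).2 (toVec (set z).1) +
      ∑ z ∈ Finset.range N, moved (T.st t z).2 (extra z) := by
  simp only [movedAt, map_add, Finset.sum_add_distrib]

theorem sum_range_pair {x y : ℕ} (hx : x < N) (hy : y < N) (hxy : x ≠ y) (f : ℕ → Vec) :
    ∑ z ∈ Finset.range N, f z =
      ∑ z ∈ ((Finset.range N).erase x).erase y, f z + (f x + f y) := by
  rw [← Finset.sum_erase_add _ _ (Finset.mem_range.2 hx), ← Finset.sum_erase_add _ _
    (Finset.mem_erase.2 ⟨hxy.symm, Finset.mem_range.2 hy⟩)]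
  abel

/-- Move the extra contents of `y` to `x`. -/
def mergeExtra (extra : ℕ → Vec) (x y : ℕ) : ℕ → Vec :=
  Function.update (Function.update extra x (extra x + extra y)) y 0

theorem exists_movedAt_exchange {T : Thread E N set} {x y : ℕ} (hx : x < N) (hy : y < N)
    (hxy : x ≠ y) (hset : set x = set y) (h : T.Meets x y) (hD : (T.st T.n x).2 = (T.st T.n y).2)
    (extra : ℕ → Vec) (t : ℕ) :
    ∃ w, (T.exchange hx hy hset).movedAt (mergeExtra extra x y) t = T.movedAt extra t + w ∧
      (t = T.n → w = 0) := by
  have hbase : ∑ z ∈ Finset.range N, moved ((T.exchange hx hy hset).st t z).2 (toVec (set z).1) =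
      ∑ z ∈ Finset.range N, moved (T.st t z).2 (toVec (set z).1) := by
    rw [sum_range_pair hx hy hxy, sum_range_pair hx hy hxy]
    congr 1
    · refine Finset.sum_congr rfl fun z hz => ?_
      simp only [Finset.mem_erase] at hz
      change moved (T.st t (T.swapAt x y t z)).2 _ = _
      rw [T.swapAt_of_ne hz.2.1 hz.1]
    · change moved (T.st t (T.swapAt x y t x)).2 _ + moved (T.st t (T.swapAt x y t y)).2 _ = _
      rcases T.swapAt_cases x y t with ⟨_, h'⟩ | ⟨_, h'⟩ <;> rw [h', hset]
      · rw [Equiv.swap_apply_left, Equiv.swap_apply_right, add_comm]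
      · rfl
  have hex : ∑ z ∈ Finset.range N, moved ((T.exchange hx hy hset).st t z).2
        (mergeExtra extra x y z) =
      ∑ z ∈ ((Finset.range N).erase x).erase y, moved (T.st t z).2 (extra z) +
        moved ((T.exchange hx hy hset).st t x).2 (extra x + extra y) := by
    rw [sum_range_pair hx hy hxy]
    congr 1
    · refine Finset.sum_congr rfl fun z hz => ?_
      simp only [Finset.mem_erase] at hz
      change moved (T.st t (T.swapAt x y t z)).2 _ = _
      rw [T.swapAt_of_ne hz.2.1 hz.1, mergeExtra, Function.update_of_ne hz.1,
        Function.update_of_ne hz.2.1]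
    · rw [mergeExtra, Function.update_self, map_zero, add_zero, Function.update_of_ne hxy,
        Function.update_self]
  have hahead := exchange_ahead hx hy hset h t
  have hpx : (T.st t x).2 <+: ((T.exchange hx hy hset).st t x).2 ∧
      (T.st t y).2 <+: ((T.exchange hx hy hset).st t x).2 := by
    have hx' := T.prefix_last t x
    have hy' := T.prefix_last t y
    rw [← hD] at hy'
    change T.phase (T.swapAt x y t y) t ≤ T.phase (T.swapAt x y t x) t at hahead
    change _ <+: (T.st t (T.swapAt x y t x)).2 ∧ _ <+: (T.st t (T.swapAt x y t x)).2
    rcases T.swapAt_cases x y t with ⟨_, h'⟩ | ⟨_, h'⟩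
    · rw [h', Equiv.swap_apply_left, Equiv.swap_apply_right] at hahead
      rw [h', Equiv.swap_apply_left]
      exact ⟨List.prefix_of_prefix_length_le hx' hy' hahead, List.prefix_refl _⟩
    · rw [h'] at hahead ⊢
      exact ⟨List.prefix_refl _, List.prefix_of_prefix_length_le hy' hx' hahead⟩
  rw [movedAt_eq, movedAt_eq, hbase, hex, sum_range_pair hx hy hxy (fun z => moved (T.st t z).2 _)]
  by_cases ht : t = T.n
  · refine ⟨0, ?_, fun _ => rfl⟩
    have : ((T.exchange hx hy hset).st t x).2 = (T.st t x).2 := by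
      change (T.st t (T.swapAt x y t x)).2 = _
      rcases T.swapAt_cases x y t with ⟨_, h'⟩ | ⟨_, h'⟩ <;> rw [h']
      · rw [Equiv.swap_apply_left, ht, hD]
      · rfl
    rw [this, map_add, ht, hD, sum_range_pair hx hy hxy (fun z => moved (T.st T.n z).2 (extra z)),
      hD]
    abel
  · obtain ⟨w, hw⟩ := exists_add_of_isInitial hpx.1 (extra x)
    obtain ⟨w', hw'⟩ := exists_add_of_isInitial hpx.2 (extra y)
    refine ⟨w + w', ?_, fun h => absurd h ht⟩
    rw [map_add, hw, hw', sum_range_pair hx hy hxy (fun z => moved (T.st t z).2 (extra z))]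
    abel

/-- The balloons with extra contents. -/
def loaded (N : ℕ) (extra : ℕ → Vec) : Finset ℕ := (Finset.range N).filter (extra · ≠ 0)

theorem card_loaded_mergeExtra {x y : ℕ} (hx : x ∈ loaded N extra) (hy : y ∈ loaded N extra) :
    (loaded N (mergeExtra extra x y)).card < (loaded N extra).card := by
  refine Finset.card_lt_card ((Finset.ssubset_iff_of_subset fun z hz => ?_).2 ⟨y, hy, ?_⟩)
  · by_cases hzx : z = x
    · rwa [hzx]
    by_cases hzy : z = y
    · rwa [hzy]
    rw [loaded, Finset.mem_filter, mergeExtra, Function.update_of_ne hzy,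
      Function.update_of_ne hzx] at hz
    exact Finset.mem_filter.2 hz
  · rw [loaded, Finset.mem_filter, mergeExtra, Function.update_self]
    exact fun h => h.2 rfl

end Thread

/-! ### Bounding the number of balloons with extra contents -/

/-- Ramsey's theorem for symmetric colourings of pairs with several colours. -/
theorem exists_monochromatic {α ι : Type} [DecidableEq α] [Fintype ι] [DecidableEq ι]
    (hι : 2 ≤ Fintype.card ι) (R : ι → α → α → Prop) (hR : ∀ a x y, R a x y → R a y x) :
    ∀ (n : ℕ) (f : ι → ℕ), ∑ a, f a = n → ∀ S : Finset α,
      (∀ x ∈ S, ∀ y ∈ S, x ≠ y → ∃ a, R a x y) → Fintype.card ι ^ n ≤ S.card →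
      ∃ a, ∃ T ⊆ S, T.card = f a ∧ ∀ x ∈ T, ∀ y ∈ T, x ≠ y → R a x y := by
  classical
  intro n
  induction n with
  | zero =>
    intro f hf S _ _
    obtain ⟨a⟩ := Fintype.card_pos_iff.1 (zero_lt_two.trans_le hι)
    refine ⟨a, ∅, Finset.empty_subset _, ?_, by simp⟩
    simpa using ((Finset.sum_eq_zero_iff.1 hf) a (Finset.mem_univ _)).symm
  | succ n ih =>
    intro f hf S hS hcard
    by_cases h0 : ∃ a, f a = 0
    · obtain ⟨a, ha⟩ := h0
      exact ⟨a, ∅, Finset.empty_subset _, by simp [ha], by simp⟩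
    push Not at h0
    have hpos : 0 < S.card := lt_of_lt_of_le (pow_pos (by omega) _) hcard
    obtain ⟨x, hx⟩ := Finset.card_pos.1 hpos
    obtain ⟨a, ha⟩ : ∃ a, Fintype.card ι ^ n ≤ ((S.erase x).filter (R a x)).card := by
      by_contra! hlt
      have hcover : S.erase x ⊆ Finset.univ.biUnion fun a => (S.erase x).filter (R a x) := by
        intro y hy
        obtain ⟨a, ha⟩ := hS x hx y (Finset.mem_of_mem_erase hy) (Finset.ne_of_mem_erase hy).symm
        exact Finset.mem_biUnion.2 ⟨a, Finset.mem_univ _, Finset.mem_filter.2 ⟨hy, ha⟩⟩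
      have h1 := (Finset.card_le_card hcover).trans Finset.card_biUnion_le
      have h2 := Finset.sum_le_sum (s := Finset.univ) fun a _ => Nat.le_sub_one_of_lt (hlt a)
      rw [Finset.sum_const, Finset.card_univ, smul_eq_mul, Nat.mul_sub_one, mul_comm,
        ← pow_succ] at h2
      rw [Finset.card_erase_of_mem hx] at h1
      have h3 : Fintype.card ι ≤ Fintype.card ι ^ (n + 1) := Nat.le_self_pow (by simp) _
      omega
    have hsum : ∑ b, Function.update f a (f a - 1) b = n := by
      rw [← Finset.sum_erase_add _ _ (Finset.mem_univ a)] at hf ⊢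
      rw [Function.update_self, Finset.sum_congr rfl fun b hb => Function.update_of_ne
        (Finset.ne_of_mem_erase hb) _ _]
      have := Nat.pos_of_ne_zero (h0 a)
      omega
    obtain ⟨b, T, hTS, hT, hmono⟩ := ih _ hsum ((S.erase x).filter (R a x))
      (fun y hy z hz => hS y (Finset.mem_of_mem_erase (Finset.mem_filter.1 hy).1) z
        (Finset.mem_of_mem_erase (Finset.mem_filter.1 hz).1)) ha
    have hTS' : T ⊆ S := fun y hy => Finset.mem_of_mem_erase (Finset.mem_filter.1 (hTS hy)).1
    by_cases hba : b = a
    · subst hba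
      have hxT : x ∉ T := fun h => Finset.ne_of_mem_erase (Finset.mem_filter.1 (hTS h)).1 rfl
      refine ⟨b, insert x T, Finset.insert_subset hx hTS', ?_, ?_⟩
      · rw [Finset.card_insert_of_notMem hxT, hT, Function.update_self]
        have := Nat.pos_of_ne_zero (h0 b)
        omega
      · intro y hy z hz hyz
        rcases Finset.mem_insert.1 hy with rfl | hy' <;>
          rcases Finset.mem_insert.1 hz with rfl | hz'
        · exact absurd rfl hyz
        · exact (Finset.mem_filter.1 (hTS hz')).2
        · exact hR _ _ _ (Finset.mem_filter.1 (hTS hy')).2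
        · exact hmono y hy' z hz' hyz
    · exact ⟨b, T, hTS', by rw [hT, Function.update_of_ne hba], hmono⟩

/-- The balloon states produced by an edge. -/
def LOp.targets : LOp → List ℕ
  | .inflate s _ => [s]
  | .deflate _ s' _ _ => [s']
  | _ => []

/-- The pairs of a balloon place and a place of deflate edges. -/
def LOp.moves : LOp → List (ℕ × ℕ)
  | .deflate _ _ i p => [(i, p)]
  | _ => []

theorem length_flatMap_le {α β : Type} (f : α → List β) (hf : ∀ a, (f a).length ≤ 1)
    (l : List α) : (l.flatMap f).length ≤ l.length := by
  induction l with
  | nil => simp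
  | cons a l ih =>
    have := hf a
    rw [List.flatMap_cons, List.length_append, List.length_cons]
    omega

/-- The balloon states produced by a list of edges. -/
def targets (E : List LEdge) : List ℕ := E.flatMap fun e => e.2.1.targets

/-- The pairs of a balloon place and a place of the deflate edges in a list. -/
def moves (E : List LEdge) : List (ℕ × ℕ) := E.flatMap fun e => e.2.1.moves

theorem length_targets_le (E : List LEdge) : (targets E).length ≤ E.length :=
  length_flatMap_le _ (by rintro ⟨_, _ | _ | _ | _, _⟩ <;> simp [LOp.targets]) E

theorem length_moves_le (E : List LEdge) : (moves E).length ≤ E.length :=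
  length_flatMap_le _ (by rintro ⟨_, _ | _ | _ | _, _⟩ <;> simp [LOp.moves]) E

namespace Thread

variable {E : List LEdge} {N : ℕ} {set : ℕ → PairList × List PairList}

/-- The thread `T`, with extra contents `extra`, is a run between the given configurations. -/
def IsRun (T : Thread E N set) (extra : ℕ → Vec) (q : ℕ) (m : Vec) (q₂ : ℕ) (m₂ : Vec) : Prop :=
  T.q 0 = q ∧ T.q T.n = q₂ ∧ (∀ z, T.st 0 z = (none, [])) ∧
    (∀ z < N, set z ∈ linearSets E ∧ extra z ∈ periodSpan (set z).2) ∧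
    ∃ M, M T.n = m₂ ∧ T.Realizes extra m M

theorem IsRun.exchange {T : Thread E N set} {extra : ℕ → Vec} {q q₂ : ℕ} {m m₂ : Vec}
    (h : T.IsRun extra q m q₂ m₂) {x y : ℕ} (hx : x < N) (hy : y < N) (hxy : x ≠ y)
    (hset : set x = set y) (hm : T.Meets x y) (hD : (T.st T.n x).2 = (T.st T.n y).2) :
    (T.exchange hx hy hset).IsRun (mergeExtra extra x y) q m q₂ m₂ := by
  obtain ⟨h1, h2, h3, h4, M, rfl, hM⟩ := h
  choose w hw hw' using exists_movedAt_exchange hx hy hxy hset hm hD extra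
  refine ⟨h1, h2, fun z => h3 _, fun z hz => ⟨(h4 z hz).1, ?_⟩, fun t => M t + w t, ?_, fun t => ?_⟩
  · unfold mergeExtra
    by_cases hzy : z = y
    · rw [hzy, Function.update_self]
      exact zero_mem _
    by_cases hzx : z = x
    · rw [hzx, Function.update_of_ne hxy, Function.update_self]
      refine add_mem (h4 x hx).2 ?_
      rw [hset]
      exact (h4 y hy).2
    · rw [Function.update_of_ne hzy, Function.update_of_ne hzx]
      exact (h4 z hz).2
  · change M T.n + w T.n = _
    rw [hw' _ rfl, add_zero]
  · rw [hw, map_add, map_add, hM, add_assoc]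
    rfl

theorem exists_isRun_not_meets {T : Thread E N set} {extra : ℕ → Vec} {q q₂ : ℕ} {m m₂ : Vec}
    (h : T.IsRun extra q m q₂ m₂) :
    ∃ (T : Thread E N set) (extra : ℕ → Vec), T.IsRun extra q m q₂ m₂ ∧
      ∀ x ∈ loaded N extra, ∀ y ∈ loaded N extra, x ≠ y → set x = set y →
        (T.st T.n x).2 = (T.st T.n y).2 → ¬ T.Meets x y := by
  induction hk : (loaded N extra).card using Nat.strong_induction_on generalizing T extra with
  | _ k ih =>
    by_cases hm : ∃ x ∈ loaded N extra, ∃ y ∈ loaded N extra, x ≠ y ∧ set x = set y ∧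
        (T.st T.n x).2 = (T.st T.n y).2 ∧ T.Meets x y
    · obtain ⟨x, hx, y, hy, hxy, hset, hD, hm⟩ := hm
      have hxN := Finset.mem_range.1 (Finset.mem_filter.1 hx).1
      have hyN := Finset.mem_range.1 (Finset.mem_filter.1 hy).1
      exact ih _ (hk ▸ card_loaded_mergeExtra hx hy) (h.exchange hxN hyN hxy hset hm hD) rfl
    · push Not at hm
      exact ⟨T, extra, h, hm⟩

theorem history_bounds (T : Thread E N set) (h0 : ∀ z, T.st 0 z = (none, [])) (t z : ℕ) :
    ((T.st t z).2.map Prod.fst).Nodup ∧ (∀ d ∈ (T.st t z).2, d ∈ moves E) ∧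
      ∀ s, (T.st t z).1 = some (some s) → s ∈ targets E := by
  induction t with
  | zero => simp [h0]
  | succ t ih =>
    by_cases hz : z = T.actor t
    · subst hz
      have hs := T.step t
      have he : T.op t = .delta [] [] ∨ (T.q t, T.op t, T.q (t + 1)) ∈ E :=
        (le_or_gt T.n t).imp (T.idle t) (T.edge t)
      generalize T.op t = o, T.st t (T.actor t) = a, T.st (t + 1) (T.actor t) = b,
        T.q t = q, T.q (t + 1) = q' at hs he ih
      cases hs with
      | delta => exact ih
      | inflate =>
        have he := he.resolve_left (by simp)
        refine ⟨by simp, by simp, ?_⟩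
        rintro s ⟨⟩
        exact List.mem_flatMap.2 ⟨_, he, by simp [LOp.targets]⟩
      | burst => exact ⟨ih.1, ih.2.1, by simp⟩
      | deflate =>
        have he := he.resolve_left (by simp)
        refine ⟨?_, ?_, ?_⟩
        · dsimp only [recordDeflate]
          split_ifs with hi
          · exact ih.1
          · rw [List.map_append, List.nodup_append]
            refine ⟨ih.1, by simp, ?_⟩
            rintro a ha b hb rfl
            simp only [List.map_cons, List.map_nil, List.mem_singleton] at hb
            exact hi (hb ▸ ha)
        · dsimp only [recordDeflate]
          split_ifs with hi
          · exact ih.2.1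
          · intro d hd
            rcases List.mem_append.1 hd with hd | hd
            · exact ih.2.1 d hd
            · exact List.mem_flatMap.2 ⟨_, he, hd⟩
        · rintro s ⟨⟩
          exact List.mem_flatMap.2 ⟨_, he, by simp [LOp.targets]⟩
    · rwa [T.frame t z hz]

theorem phase_le (T : Thread E N set) (h0 : ∀ z, T.st 0 z = (none, [])) (z t : ℕ) :
    T.phase z t ≤ E.length := by
  obtain ⟨h1, h2, -⟩ := T.history_bounds h0 t z
  exact ((List.Nodup.of_map _ h1).subperm h2).length_le.trans (length_moves_le E)

theorem phase_succ_le (T : Thread E N set) (z t : ℕ) : T.phase z (t + 1) ≤ T.phase z t + 1 := by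
  unfold phase
  by_cases hz : z = T.actor t
  · subst hz
    have := T.step t
    generalize T.op t = o, T.st t (T.actor t) = a, T.st (t + 1) (T.actor t) = b at this
    cases this with
    | delta | inflate | burst => exact Nat.le_succ _
    | deflate =>
      dsimp only [recordDeflate]
      split_ifs <;> simp
  · rw [T.frame t z hz]
    exact Nat.le_succ _

/-- The balloons `x` and `y` have a common time with phase `i`, but never meet in this phase. -/
def Avoids (T : Thread E N set) (i x y : ℕ) : Prop :=
  (∃ t, T.phase x t = i ∧ T.phase y t = i) ∧
    ∀ t, T.phase x t = i → T.phase y t = i → (T.st t x).1 ≠ (T.st t y).1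

theorem Avoids.symm {T : Thread E N set} {i x y : ℕ} (h : T.Avoids i x y) : T.Avoids i y x :=
  ⟨h.1.imp fun _ h => h.symm, fun t hy hx => (h.2 t hx hy).symm⟩

theorem st_eq_of_phase_eq {T : Thread E N set} {x y t : ℕ}
    (hD : (T.st T.n x).2 = (T.st T.n y).2) (hp : T.phase x t = T.phase y t)
    (hs : (T.st t x).1 = (T.st t y).1) : T.st t x = T.st t y := by
  have hx := T.prefix_last t x
  have hy := T.prefix_last t y
  rw [← hD] at hy
  exact Prod.ext hs ((List.prefix_of_prefix_length_le hx hy hp.le).eq_of_length hp)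

theorem avoids_of_lt {T : Thread E N set} {x y s t : ℕ}
    (hD : (T.st T.n x).2 = (T.st T.n y).2) (hst : s ≤ t) (hs : T.phase y s < T.phase x s)
    (ht : T.phase x t < T.phase y t) (hw : ∀ w, s ≤ w → w ≤ t → T.st w x ≠ T.st w y) :
    ∃ r, T.Avoids (T.phase x r) x y := by
  have hex : ∃ r, s ≤ r ∧ T.phase x r < T.phase y r := ⟨t, hst, ht⟩
  classical
  obtain ⟨hsr, hr⟩ := Nat.find_spec hex
  have hrt : Nat.find hex ≤ t := Nat.find_min' hex ⟨hst, ht⟩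
  have hmin := fun u hu => Nat.find_min hex (m := u) hu
  generalize Nat.find hex = r at hsr hr hrt hmin
  have hne : s ≠ r := by
    rintro rfl
    exact absurd hs (not_lt.2 hr.le)
  obtain ⟨r, rfl⟩ : ∃ r', r = r' + 1 := ⟨r - 1, by omega⟩
  have hle : T.phase y r ≤ T.phase x r :=
    not_lt.1 fun h => hmin r (Nat.lt_succ_self r) ⟨by omega, h⟩
  have hmx := T.phase_mono x (Nat.le_succ r)
  have hmy := T.phase_succ_le y r
  dsimp only [Nat.succ_eq_add_one] at hmx
  have heq : T.phase x r = T.phase y r := by omega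
  refine ⟨r, ⟨r, rfl, heq.symm⟩, fun u hux huy he => ?_⟩
  refine hw u ?_ ?_ (st_eq_of_phase_eq hD (hux.trans huy.symm) he)
  · by_contra! hus
    have h1 := T.phase_mono x (show s ≤ r by omega)
    have h2 := T.phase_mono y hus.le
    omega
  · by_contra! hut
    have h1 := T.phase_mono y (show r + 1 ≤ u by omega)
    omega

theorem exists_avoids {T : Thread E N set} {x y : ℕ}
    (hD : (T.st T.n x).2 = (T.st T.n y).2) (h : ¬ T.Meets x y) :
    ∃ i t, T.phase x t = i ∧ T.Avoids i x y := by
  unfold Meets at h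
  push Not at h
  obtain ⟨s, t, hs, ht, hw⟩ := h
  rcases le_total s t with hst | hst
  · obtain ⟨r, hr⟩ := avoids_of_lt hD hst hs ht fun w h1 h2 => hw w (Or.inl ⟨h1, h2⟩)
    exact ⟨_, r, rfl, hr⟩
  · obtain ⟨r, hr⟩ := avoids_of_lt hD.symm hst ht hs
      fun w h1 h2 he => hw w (Or.inr ⟨h1, h2⟩) he.symm
    obtain ⟨u, hu, -⟩ := hr.symm.1
    exact ⟨_, u, hu, hr.symm⟩

theorem card_avoids_le (T : Thread E N set) (h0 : ∀ z, T.st 0 z = (none, [])) (i : ℕ)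
    (S : Finset ℕ) (hS : ∀ x ∈ S, ∀ y ∈ S, x ≠ y → T.Avoids i x y) :
    S.card ≤ E.length + 2 := by
  rcases le_or_gt S.card 1 with h1 | h1
  · omega
  classical
  have hex : ∀ x ∈ S, ∃ t, T.phase x t = i := by
    intro x hx
    obtain ⟨y, hy, hxy⟩ := Finset.exists_mem_ne h1 x
    obtain ⟨t, ht, -⟩ := (hS x hx y hy hxy.symm).1
    exact ⟨t, ht⟩
  let first : ℕ → ℕ := fun x => if h : ∃ t, T.phase x t = i then Nat.find h else 0
  have hfirst : ∀ x ∈ S, T.phase x (first x) = i ∧ ∀ t, T.phase x t = i → first x ≤ t := by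
    intro x hx
    simp only [first, dif_pos (hex x hx)]
    exact ⟨Nat.find_spec (hex x hx), fun t ht => Nat.find_min' _ ht⟩
  obtain ⟨z, hz, hmax⟩ := S.exists_max_image first (Finset.card_pos.1 (by omega))
  have hall : ∀ x ∈ S, T.phase x (first z) = i := by
    intro x hx
    by_cases hxz : x = z
    · rw [hxz]; exact (hfirst z hz).1
    · obtain ⟨t, htx, htz⟩ := (hS x hx z hz hxz).1
      have h2 := T.phase_mono x (hmax x hx)
      have h3 := T.phase_mono x ((hfirst z hz).2 t htz)
      have h4 := (hfirst x hx).1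
      omega
  have hinj : Set.InjOn (fun x => (T.st (first z) x).1) S := by
    intro x hx y hy he
    by_contra hxy
    exact (hS x hx y hy hxy).2 _ (hall x hx) (hall y hy) he
  have hsub : S.image (fun x => (T.st (first z) x).1) ⊆
      (none :: some none :: (targets E).map fun s => some (some s)).toFinset := by
    intro o ho
    obtain ⟨x, -, rfl⟩ := Finset.mem_image.1 ho
    rw [List.mem_toFinset]
    have := (T.history_bounds h0 (first z) x).2.2
    generalize (T.st (first z) x).1 = o at this
    rcases o with _ | _ | s
    · simp
    · simp
    · simpa using this s rfl
  rw [← Finset.card_image_of_injOn hinj]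
  refine (Finset.card_le_card hsub).trans ((List.toFinset_card_le _).trans ?_)
  have := length_targets_le E
  simp only [List.length_cons, List.length_map]
  omega

theorem card_distinct_le (T : Thread E N set) (h0 : ∀ z, T.st 0 z = (none, [])) (i : ℕ)
    (S : Finset ℕ) (hset : ∀ x ∈ S, set x ∈ linearSets E)
    (hS : ∀ x ∈ S, ∀ y ∈ S, x ≠ y →
      (set x, (T.st T.n x).2[i]?) ≠ (set y, (T.st T.n y).2[i]?)) :
    S.card ≤ (linearSets E).length * (E.length + 1) := by
  classical
  have hinj : Set.InjOn (fun x => (set x, (T.st T.n x).2[i]?)) S := by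
    intro x hx y hy he
    by_contra hxy
    exact hS x hx y hy hxy he
  have hsub : S.image (fun x => (set x, (T.st T.n x).2[i]?)) ⊆
      (linearSets E).toFinset ×ˢ (none :: (moves E).map some).toFinset := by
    intro o ho
    obtain ⟨x, hx, rfl⟩ := Finset.mem_image.1 ho
    refine Finset.mem_product.2 ⟨List.mem_toFinset.2 (hset x hx), List.mem_toFinset.2 ?_⟩
    dsimp only
    cases h : (T.st T.n x).2[i]? with
    | none => simp
    | some d => simpa using (T.history_bounds h0 T.n x).2.1 d (List.mem_of_getElem? h)
  rw [← Finset.card_image_of_injOn hinj]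
  refine (Finset.card_le_card hsub).trans ?_
  rw [Finset.card_product]
  refine Nat.mul_le_mul (List.toFinset_card_le _) ((List.toFinset_card_le _).trans ?_)
  have := length_moves_le E
  simpa using this

theorem card_loaded_lt (T : Thread E N set) (extra : ℕ → Vec) (h0 : ∀ z, T.st 0 z = (none, []))
    (hset : ∀ z < N, set z ∈ linearSets E)
    (hm : ∀ x ∈ loaded N extra, ∀ y ∈ loaded N extra, x ≠ y → set x = set y →
        (T.st T.n x).2 = (T.st T.n y).2 → ¬ T.Meets x y) :
    (loaded N extra).card < slotBound E := by
  by_contra! hlt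
  let R : Bool × Fin (E.length + 1) → ℕ → ℕ → Prop := fun a x y =>
    if a.1 then T.Avoids a.2 x y
    else (set x, (T.st T.n x).2[(a.2 : ℕ)]?) ≠ (set y, (T.st T.n y).2[(a.2 : ℕ)]?)
  have hcard : Fintype.card (Bool × Fin (E.length + 1)) = 2 * (E.length + 1) := by simp
  have hR : ∀ a x y, R a x y → R a y x := by
    rintro ⟨_ | _, i⟩ x y h
    · simp only [R, Bool.false_eq_true, if_false] at h ⊢
      exact h.symm
    · simp only [R, if_true] at h ⊢
      exact h.symm
  have hcol : ∀ x ∈ loaded N extra, ∀ y ∈ loaded N extra, x ≠ y → ∃ a, R a x y := by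
    intro x hx y hy hxy
    by_cases hsxy : set x = set y
    · by_cases hD : (T.st T.n x).2 = (T.st T.n y).2
      · obtain ⟨i, t, ht, hi⟩ := exists_avoids hD (hm x hx y hy hxy hsxy hD)
        have hle := T.phase_le h0 x t
        refine ⟨(true, ⟨i, by omega⟩), ?_⟩
        simpa only [R, if_true] using hi
      · obtain ⟨i, hi⟩ : ∃ i, (T.st T.n x).2[i]? ≠ (T.st T.n y).2[i]? := by
          by_contra! h
          exact hD (List.ext_getElem? h)
        have hx' := T.phase_le h0 x T.n
        have hy' := T.phase_le h0 y T.n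
        have hiE : i < E.length + 1 := by
          by_contra! hiE
          rw [List.getElem?_eq_none (by unfold phase at hx'; omega),
            List.getElem?_eq_none (by unfold phase at hy'; omega)] at hi
          exact hi rfl
        refine ⟨(false, ⟨i, hiE⟩), ?_⟩
        simp only [R, Bool.false_eq_true, if_false]
        exact fun h => hi (congrArg Prod.snd h)
    · refine ⟨(false, 0), ?_⟩
      simp only [R, Bool.false_eq_true, if_false]
      exact fun h => hsxy (congrArg Prod.fst h)
  obtain ⟨⟨b, i⟩, S, hS, hSc, hmono⟩ := exists_monochromatic (by rw [hcard]; omega) R hR _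
    (fun _ => ((linearSets E).length + 1) * (E.length + 3) + 1) rfl (loaded N extra) hcol
    (by rw [hcard, Finset.sum_const, Finset.card_univ, hcard, smul_eq_mul]; exact hlt)
  have hSN : ∀ x ∈ S, set x ∈ linearSets E := fun x hx =>
    hset x (Finset.mem_range.1 (Finset.mem_filter.1 (hS hx)).1)
  cases b with
  | true =>
    have := T.card_avoids_le h0 i S (by simpa [R] using hmono)
    nlinarith
  | false =>
    have := T.card_distinct_le h0 i S hSN fun x hx y hy hxy => by
      have := hmono x hx y hy hxy
      simpa only [R, Bool.false_eq_true, if_false] using this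
    nlinarith

end Thread

/-- A run between semiconfigurations can be performed with few balloons that are inflated to
contents other than a base vector. -/
theorem exists_isRun {V : VASSB} {E : List LEdge} (hE : ∀ e ∈ V.edges, ∃ l ∈ E, e = l.toV)
    {q q₂ : ℕ} {m m₂ : Vec} (h : VReach V ⟨q, m, 0⟩ ⟨q₂, m₂, 0⟩) :
    ∃ (N : ℕ) (set : ℕ → PairList × List PairList) (T : Thread E N set) (extra : ℕ → Vec),
      T.IsRun extra q m q₂ m₂ ∧ (Thread.loaded N extra).card < slotBound E := by
  obtain ⟨N, set, extra, hmem, -, -, hp⟩ := exists_path hE rfl h 0 (fun _ => ([], []))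
    (fun _ => 0) (fun _ => (none, [])) (fun _ _ => rfl) (by simp) (by simp)
  obtain ⟨T, M, h1, h2, h3, h4, h5⟩ := hp.exists_realizes
  obtain ⟨T', extra', hT', hm⟩ := Thread.exists_isRun_not_meets
    (T := T) (extra := extra) ⟨h1, h2, h3, hmem, M, h4, h5⟩
  exact ⟨N, set, T', extra', hT', T'.card_loaded_lt extra' hT'.2.2.1
    (fun z hz => (hT'.2.2.2.1 z hz).1) hm⟩

/-! ### Completeness of the Petri net -/

namespace PetriReach

variable {N : List PetriEdge}

theorem add_left {q q' : ℕ} {w w' : Vec} (h : PetriReach N (q, w) (q', w')) (r : Vec) :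
    PetriReach N (q, r + w) (q', r + w') := by
  refine Relation.ReflTransGen.lift (fun c : ℕ × Vec => (c.1, r + c.2)) ?_ _ _ h
  rintro _ _ ⟨e, he, s, rfl, rfl⟩
  exact ⟨e, he, r + s, by simp only [add_assoc], by simp only [add_assoc]⟩

protected theorem trans {c c' c'' : ℕ × Vec} (h : PetriReach N c c') (h' : PetriReach N c' c'') :
    PetriReach N c c'' :=
  Relation.ReflTransGen.trans h h'

theorem fire {q q' : ℕ} {u v : PairList} (h : (q, u, v, q') ∈ N) (r : Vec) :
    PetriReach N (q, r + toVec u) (q', r + toVec v) :=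
  .single ⟨_, h, r, rfl, rfl⟩

theorem clear_add {q : ℕ} {v w : Vec} (hv : PetriReach N (q, v) (q, 0))
    (hw : PetriReach N (q, w) (q, 0)) : PetriReach N (q, v + w) (q, 0) := by
  have := hw.add_left v
  rw [add_zero] at this
  exact this.trans hv

end PetriReach

theorem toVec_onP (l : PairList) : toVec (onP l) = (toVec l).mapDomain plP := by
  induction l with
  | nil => simp [onP]
  | cons x l ih =>
    rw [toVec_cons, Finsupp.mapDomain_add, ← ih, Finsupp.mapDomain_single]
    rfl

theorem leftover_add (D : List (ℕ × ℕ)) (v w : Vec) :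
    leftover D (v + w) = leftover D v + leftover D w := by
  ext j
  simp only [leftover_apply, Finsupp.add_apply]
  split_ifs <;> simp

theorem toVec_filter_leftover (D : List (ℕ × ℕ)) (l : PairList) :
    toVec (l.filter fun x => x.1 ∉ D.map Prod.fst) = leftover D (toVec l) := by
  induction l with
  | nil => ext j; simp [leftover_apply]
  | cons x l ih =>
    rw [toVec_cons, leftover_add, ← ih]
    have hx : leftover D (Finsupp.single x.1 x.2) =
        if x.1 ∈ D.map Prod.fst then 0 else Finsupp.single x.1 x.2 := by
      ext j
      rw [leftover_apply]
      by_cases hj : x.1 = j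
      · subst hj; split_ifs <;> simp
      · split_ifs <;> simp [hj]
    rw [hx]
    by_cases h : x.1 ∈ D.map Prod.fst
    · rw [List.filter_cons_of_neg (by simpa using h), if_pos h, zero_add]
    · rw [List.filter_cons_of_pos (by simpa using h), if_neg h, toVec_cons]

/-- The tokens of balloon place `i` of slot `j`, holding `k`, after the deflations in `D`. -/
def cell (j : ℕ) (k : Vec) (D : List (ℕ × ℕ)) (i : ℕ) : Vec :=
  if i ∈ D.map Prod.fst then Finsupp.single (plDon j i) 1
  else Finsupp.single (plUnd j i) 1 + Finsupp.single (plLoad j i) (k i)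

theorem sum_cell_nil (I : List ℕ) (j : ℕ) (b : PairList) (x : Vec) :
    (I.map (cell j (toVec b + x) [])).sum =
      toVec (undOf I j) + toVec (loadOf I j b) + loadVec I j x := by
  rw [toVec_loadOf, add_assoc, ← map_add]
  generalize toVec b + x = k
  induction I with
  | nil => simp [undOf, loadVec]
  | cons i I ih =>
    rw [List.map_cons, List.sum_cons, ih]
    simp only [cell, List.map_nil, List.not_mem_nil, if_false, undOf, loadVec, List.map_cons,
      toVec_cons, AddMonoidHom.coe_mk, ZeroHom.coe_mk, List.sum_cons]
    abel

/-- The tokens representing a balloon in slot `j` with contents `k`. -/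
def slotBody (I : List ℕ) (j : ℕ) (k : Vec) : History → Vec
  | (none, _) => Finsupp.single (plAv j) 1
  | (some o, D) => o.elim 0 (fun s => Finsupp.single (plSpec j s) 1) + (I.map (cell j k D)).sum

/-- The tokens representing a balloon inflated to the base vector `b`. -/
def baseBody (b : PairList) : History → Vec
  | (some (some s), D) => Finsupp.single (plBase s (b.filter fun x => x.1 ∉ D.map Prod.fst)) 1
  | _ => 0

section

variable {E : List LEdge} {K qf : ℕ}

local notation "NET" => net E (deflPlaces E) (baseContents E) K qf

theorem sim_delta {q q' : ℕ} {neg pos : PairList} (he : (q, LOp.delta neg pos, q') ∈ E)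
    (hd : ∀ p, toVec neg p = 0 ∨ toVec pos p = 0) {m m' : Vec}
    (hm : toZ m' = toZ m + (LOp.delta neg pos).effect) :
    PetriReach NET (stQ q, m.mapDomain plP) (stQ q', m'.mapDomain plP) := by
  have h := fun p => DFunLike.congr_fun hm p
  simp only [LOp.effect, toZ_apply, Finsupp.add_apply, Finsupp.sub_apply] at h
  have h1 : m = (m - toVec neg) + toVec neg := by
    ext p
    have := h p
    have := hd p
    simp only [Finsupp.add_apply, Finsupp.tsub_apply]
    omega
  have h2 : m' = (m - toVec neg) + toVec pos := by
    ext p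
    have := h p
    have := hd p
    simp only [Finsupp.add_apply, Finsupp.tsub_apply]
    omega
  generalize m - toVec neg = r at h1 h2
  subst h1 h2
  rw [Finsupp.mapDomain_add, Finsupp.mapDomain_add, ← toVec_onP, ← toVec_onP]
  exact PetriReach.fire (Gadget.mem_net (.delta he)) _

theorem sim_inflate_slot {q q' s j : ℕ} {L : List (PairList × List PairList)}
    {b : PairList × List PairList} (he : (q, LOp.inflate s L, q') ∈ E) (hb : b ∈ L) (hj : j < K)
    {x : Vec} (hx : x ∈ periodSpan b.2) :
    PetriReach NET (stQ q, slotBody (deflPlaces E) j (toVec b.1 + x) (none, []))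
      (stQ q', slotBody (deflPlaces E) j (toVec b.1 + x) (some (some s), [])) := by
  have hloop : ∀ w, PetriReach NET (stI j b.2 q', w)
      (stI j b.2 q', w + loadVec (deflPlaces E) j x) := by
    unfold periodSpan at hx
    induction hx using AddSubmonoid.closure_induction with
    | mem x hx =>
      intro w
      obtain ⟨v, hv, rfl⟩ := List.mem_map.1 hx
      have := PetriReach.fire (Gadget.mem_net (K := K) (qf := qf) (I := deflPlaces E)
        (B := baseContents E) (.inflateLoop he hb hj hv)) w
      rwa [toVec_nil, add_zero, toVec_loadOf] at this
    | zero => intro w; rw [map_zero, add_zero]; exact .refl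
    | add x y _ _ ihx ihy =>
      intro w
      rw [map_add, ← add_assoc]
      exact (ihx w).trans (ihy _)
  have h1 := PetriReach.fire (Gadget.mem_net (K := K) (qf := qf) (I := deflPlaces E)
    (B := baseContents E) (.inflateStart he hb hj)) 0
  have h2 := PetriReach.fire (Gadget.mem_net (K := K) (qf := qf) (I := deflPlaces E)
    (B := baseContents E) (.inflateEnd he hb hj))
    (slotBody (deflPlaces E) j (toVec b.1 + x) (some (some s), []))
  rw [toVec_nil, add_zero] at h2
  have h3 := (h1.trans (hloop _)).trans (by
    convert h2 using 2
    simp only [slotBody, sum_cell_nil, toVec_cons, toVec_append, Option.elim_some]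
    abel)
  simpa [slotBody] using h3

theorem sim_deflate_slot {q q' s s' i p j : ℕ} (he : (q, LOp.deflate s s' i p, q') ∈ E)
    (hj : j < K) (k : Vec) (D : List (ℕ × ℕ)) (m : Vec) :
    PetriReach NET (stQ q, m.mapDomain plP + slotBody (deflPlaces E) j k (some (some s), D))
      (stQ q', (m + Finsupp.single p (leftover D k i)).mapDomain plP +
        slotBody (deflPlaces E) j k (some (some s'), recordDeflate D i p)) := by
  have hi : i ∈ deflPlaces E :=
    mem_sortDedup.2 (List.mem_flatMap.2 ⟨_, he, by simp [LOp.deflated]⟩)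
  have hrest : ((deflPlaces E).erase i).map (cell j k (recordDeflate D i p)) =
      ((deflPlaces E).erase i).map (cell j k D) := by
    refine List.map_congr_left fun i' hi' => ?_
    have : i' ≠ i := fun h => (nodup_sortDedup _).not_mem_erase (h ▸ hi')
    simp only [cell, mem_recordDeflate, this, or_false]
  simp only [slotBody, Option.elim_some, ← List.sum_map_erase _ hi, hrest]
  generalize (((deflPlaces E).erase i).map (cell j k D)).sum = R
  rw [leftover_apply]
  by_cases hD : i ∈ D.map Prod.fst
  · rw [if_pos hD]
    have h := PetriReach.fire (Gadget.mem_net (K := K) (qf := qf) (I := deflPlaces E)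
      (B := baseContents E) (.deflateNull he hj)) (m.mapDomain plP + R)
    simp only [toVec_cons, toVec_nil, add_zero] at h
    rw [cell, if_pos hD, cell, if_pos (mem_recordDeflate.2 (Or.inl hD)), Finsupp.single_zero,
      add_zero]
    convert h using 2 <;> abel
  · rw [if_neg hD, cell, if_neg hD, cell, if_pos (mem_recordDeflate.2 (Or.inr rfl)),
      Finsupp.mapDomain_add, Finsupp.mapDomain_single]
    have hloop : ∀ n, PetriReach NET (stD j i p q', Finsupp.single (plLoad j i) n)
        (stD j i p q', Finsupp.single (plP p) n) := by
      intro n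
      induction n with
      | zero => simp only [Finsupp.single_zero]; exact .refl
      | succ n ih =>
        have h := PetriReach.fire (Gadget.mem_net (K := K) (qf := qf) (I := deflPlaces E)
          (B := baseContents E) (.deflateLoop he hj)) (Finsupp.single (plLoad j i) n)
        simp only [toVec_cons, toVec_nil, add_zero] at h
        have h' := ih.add_left (Finsupp.single (plP p) 1)
        rw [add_comm _ (Finsupp.single (plLoad j i) n), ← Finsupp.single_add, add_comm 1] at h'
        rw [Finsupp.single_add, Finsupp.single_add]
        rw [Finsupp.single_add, add_comm _ (Finsupp.single (plP p) 1)] at h'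
        refine h.trans ?_
        have h'' := ih.add_left (Finsupp.single (plP p) 1)
        rwa [add_comm, add_comm _ (Finsupp.single (plP p) n)] at h''
    have h1 := PetriReach.fire (Gadget.mem_net (K := K) (qf := qf) (I := deflPlaces E)
      (B := baseContents E) (.deflateStart he hj))
      (m.mapDomain plP + R + Finsupp.single (plLoad j i) (k i))
    have h2 := (hloop (k i)).add_left (m.mapDomain plP + R +
      (Finsupp.single (plSpec j s') 1 + Finsupp.single (plDon j i) 1))
    have h3 := PetriReach.fire (Gadget.mem_net (K := K) (qf := qf) (I := deflPlaces E)
      (B := baseContents E) (.deflateEnd he hj))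
      (m.mapDomain plP + R + (Finsupp.single (plSpec j s') 1 + Finsupp.single (plDon j i) 1) +
        Finsupp.single (plP p) (k i))
    simp only [toVec_cons, toVec_nil, add_zero] at h1 h3
    rw [add_right_comm _ _ (Finsupp.single (plLoad j i) (k i))] at h2
    convert (h1.trans h2).trans h3 using 2 <;> abel

theorem sim_slot {q q' j : ℕ} {op : LOp} {x x' : History} {b : PairList × List PairList} {y : Vec}
    (he : (q, op, q') ∈ E) (hs : HistStep op x x')
    (hdelta : ∀ neg pos, op ≠ .delta neg pos) (hj : j < K) (hb : ∀ s L, op = .inflate s L → b ∈ L)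
    (hy : y ∈ periodSpan b.2) {m m' : Vec}
    (hm : m' + moved x.2 (toVec b.1 + y) = m + moved x'.2 (toVec b.1 + y)) :
    PetriReach NET (stQ q, m.mapDomain plP + slotBody (deflPlaces E) j (toVec b.1 + y) x)
      (stQ q', m'.mapDomain plP + slotBody (deflPlaces E) j (toVec b.1 + y) x') := by
  cases hs with
  | delta => exact absurd rfl (hdelta _ _)
  | inflate =>
    obtain rfl := add_right_cancel hm
    exact (sim_inflate_slot he (hb _ _ rfl) hj hy).add_left _
  | deflate =>
    rw [moved_recordDeflate, add_left_comm, add_comm] at hm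
    obtain rfl := add_left_cancel hm
    exact sim_deflate_slot he hj _ _ _
  | burst =>
    obtain rfl := add_right_cancel hm
    have h := PetriReach.fire (Gadget.mem_net (K := K) (qf := qf) (I := deflPlaces E)
      (B := baseContents E) (.burstSpec he hj))
    simp only [toVec_cons, toVec_nil, add_zero] at h
    simp only [slotBody, Option.elim_some, Option.elim_none, zero_add]
    rw [add_comm (Finsupp.single _ _), ← add_assoc]
    exact h _

theorem sim_base {q q' : ℕ} {op : LOp} {x x' : History} {b : PairList × List PairList}
    (he : (q, op, q') ∈ E) (hs : HistStep op x x')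
    (hdelta : ∀ neg pos, op ≠ .delta neg pos) (hb : ∀ s L, op = .inflate s L → b ∈ L)
    (hbE : b ∈ linearSets E) {m m' : Vec}
    (hm : m' + moved x.2 (toVec b.1) = m + moved x'.2 (toVec b.1)) :
    PetriReach NET (stQ q, m.mapDomain plP + baseBody b.1 x)
      (stQ q', m'.mapDomain plP + baseBody b.1 x') := by
  have hB : ∀ D : List (ℕ × ℕ), (b.1.filter fun x => x.1 ∉ D.map Prod.fst) ∈ baseContents E :=
    fun D => List.mem_flatMap.2 ⟨b, hbE, filter_mem_subl _ _⟩
  cases hs with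
  | delta => exact absurd rfl (hdelta _ _)
  | @inflate s L =>
    obtain rfl := add_right_cancel hm
    have h := PetriReach.fire (Gadget.mem_net (K := K) (qf := qf) (I := deflPlaces E)
      (B := baseContents E) (.inflateBase he (hb _ _ rfl))) (m'.mapDomain plP)
    have hf : (b.1.filter fun x => x.1 ∉ ([] : List (ℕ × ℕ)).map Prod.fst) = b.1 := by simp
    rw [baseBody, baseBody, hf]
    · simpa using h
    · simp
  | @deflate s s' i p D =>
    rw [moved_recordDeflate, add_left_comm, add_comm] at hm
    obtain rfl := add_left_cancel hm
    have h := PetriReach.fire (Gadget.mem_net (K := K) (qf := qf) (I := deflPlaces E)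
      (B := baseContents E) (.deflateBase he (hB D))) (m.mapDomain plP)
    have hf : ((b.1.filter fun x => x.1 ∉ D.map Prod.fst).filter fun x => x.1 ≠ i) =
        b.1.filter fun x => x.1 ∉ (recordDeflate D i p).map Prod.fst := by
      rw [List.filter_filter]
      refine List.filter_congr fun x _ => ?_
      simp only [mem_recordDeflate, not_or, ne_eq, Bool.decide_and, decide_not]
      exact Bool.and_comm _ _
    rw [hf, amount_eq, toVec_filter_leftover] at h
    simp only [toVec_cons, toVec_nil, add_zero] at h
    rw [baseBody, baseBody, Finsupp.mapDomain_add, Finsupp.mapDomain_single, add_assoc,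
      add_comm (Finsupp.single (plP p) _)]
    exact h
  | @burst s D =>
    obtain rfl := add_right_cancel hm
    have h := PetriReach.fire (Gadget.mem_net (K := K) (qf := qf) (I := deflPlaces E)
      (B := baseContents E) (.burstBase he (hB D))) (m'.mapDomain plP)
    rw [baseBody, baseBody]
    · simpa only [toVec_cons, toVec_nil, add_zero] using h
    · simp

theorem clear_av {j : ℕ} (hj : j < K) :
    PetriReach NET (stQ qf, Finsupp.single (plAv j) 1) (stQ qf, 0) := by
  have h := PetriReach.fire (Gadget.mem_net (E := E) (K := K) (qf := qf) (I := deflPlaces E)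
    (B := baseContents E) (.clearAv hj)) 0
  simpa using h

theorem clear_cell {i j : ℕ} (hi : i ∈ deflPlaces E) (hj : j < K) (k : Vec) (D : List (ℕ × ℕ)) :
    PetriReach NET (stQ qf, cell j k D i) (stQ qf, 0) := by
  unfold cell
  split_ifs
  · have h := PetriReach.fire (Gadget.mem_net (E := E) (K := K) (qf := qf) (I := deflPlaces E)
      (B := baseContents E) (.clearDon hj hi)) 0
    simpa using h
  · have hloop : ∀ n, PetriReach NET (stT j i, Finsupp.single (plLoad j i) n) (stT j i, 0) := by
      intro n
      induction n with
      | zero => simp only [Finsupp.single_zero]; exact .refl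
      | succ n ih =>
        have h := PetriReach.fire (Gadget.mem_net (E := E) (K := K) (qf := qf) (I := deflPlaces E)
          (B := baseContents E) (.clearLoad hj hi)) 0
        rw [Finsupp.single_add]
        exact ih.clear_add (by simpa using h)
    have h1 := PetriReach.fire (Gadget.mem_net (E := E) (K := K) (qf := qf) (I := deflPlaces E)
      (B := baseContents E) (.clearUnd hj hi)) (Finsupp.single (plLoad j i) (k i))
    have h3 := PetriReach.fire (Gadget.mem_net (E := E) (K := K) (qf := qf) (I := deflPlaces E)
      (B := baseContents E) (.clearEnd hj hi)) 0
    simp only [toVec_cons, toVec_nil, add_zero] at h1 h3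
    rw [add_comm]
    exact (h1.trans (hloop _)).trans h3

theorem clear_slotBody {j : ℕ} (hj : j < K) (k : Vec) {x : History}
    (hx : ∀ s, x.1 ≠ some (some s)) :
    PetriReach NET (stQ qf, slotBody (deflPlaces E) j k x) (stQ qf, 0) := by
  obtain ⟨_ | _ | s, D⟩ := x
  · exact clear_av hj
  · rw [slotBody, Option.elim_none, zero_add]
    refine List.sum_induction (fun v => PetriReach NET (stQ qf, v) (stQ qf, 0))
      (fun _ _ => PetriReach.clear_add) .refl fun v hv => ?_
    obtain ⟨i, hi, rfl⟩ := List.mem_map.1 hv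
    exact clear_cell hi hj k D
  · exact absurd rfl (hx s)

theorem exists_slots (S : Finset ℕ) (h : S.card ≤ K) :
    ∃ slot : ℕ → ℕ, Set.InjOn slot S ∧ ∀ z ∈ S, slot z < K := by
  refine ⟨fun z => (S.filter (· < z)).card, fun x hx y hy he => ?_, fun z hz => ?_⟩
  · have key : ∀ {a b : ℕ}, a ∈ S → a < b →
        (S.filter (· < a)).card < (S.filter (· < b)).card := fun {a b} ha hab => by
      refine Finset.card_lt_card ((Finset.ssubset_iff_of_subset fun c hc => ?_).2 ⟨a, ?_, ?_⟩)
      · rw [Finset.mem_filter] at hc ⊢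
        exact ⟨hc.1, hc.2.trans hab⟩
      · exact Finset.mem_filter.2 ⟨ha, hab⟩
      · simp
    rcases lt_trichotomy x y with hxy | hxy | hxy
    · exact absurd he (key hx hxy).ne
    · exact hxy
    · exact absurd he (key hy hxy).ne'
  · refine lt_of_lt_of_le (Finset.card_lt_card ((Finset.ssubset_iff_of_subset
      (Finset.filter_subset _ _)).2 ⟨z, hz, by simp⟩)) h

/-- The tokens representing a balloon with base vector `b` and extra contents `y`. -/
def body (I : List ℕ) (j : ℕ) (b : PairList) (y : Vec) (x : History) : Vec :=
  if y = 0 then baseBody b x else slotBody I j (toVec b + y) x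

theorem petriReach_of_isRun {N : ℕ} {set : ℕ → PairList × List PairList} {T : Thread E N set}
    {extra : ℕ → Vec} {q : ℕ} {m m₂ : Vec} (h : T.IsRun extra q m qf m₂)
    (hd : ∀ l ∈ E, ∀ neg pos, l.2.1 = .delta neg pos → ∀ p, toVec neg p = 0 ∨ toVec pos p = 0)
    (hK : (Thread.loaded N extra).card ≤ K) :
    PetriReach NET
      (stQ q, m.mapDomain plP + ∑ j ∈ Finset.range K, Finsupp.single (plAv j) 1)
      (stQ qf, m₂.mapDomain plP) := by
  obtain ⟨rfl, hq₂, h0, hset, M, rfl, hM⟩ := h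
  obtain ⟨slot, hinj, hslot⟩ := exists_slots _ hK
  let W : ℕ → Vec := fun t => ∑ z ∈ Finset.range N,
    body (deflPlaces E) (slot z) (set z).1 (extra z) (T.st t z)
  let F : Vec := ∑ j ∈ Finset.range K \ (Thread.loaded N extra).image slot,
    Finsupp.single (plAv j) 1
  have hloaded : ∀ z < N, extra z ≠ 0 → slot z < K := fun z hz hz' =>
    hslot z (Finset.mem_filter.2 ⟨Finset.mem_range.2 hz, hz'⟩)
  have hstep : ∀ t < T.n, PetriReach NET (stQ (T.q t), (M t).mapDomain plP + W t)
      (stQ (T.q (t + 1)), (M (t + 1)).mapDomain plP + W (t + 1)) := by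
    intro t ht
    have he := T.edge t ht
    have hs := T.step t
    have hrel := T.movedAt_succ extra t
    by_cases hdelta : ∃ neg pos, T.op t = .delta neg pos
    · obtain ⟨neg, pos, hop⟩ := hdelta
      rw [hop] at he hs
      have hW : ∀ z, T.st (t + 1) z = T.st t z := by
        intro z
        by_cases hz : z = T.actor t
        · subst hz
          generalize T.st t (T.actor t) = a, T.st (t + 1) (T.actor t) = b at hs
          cases hs
          rfl
        · exact T.frame t z hz
      have hm : toZ (M (t + 1)) = toZ (M t) + (LOp.delta neg pos).effect := by
        rw [hM, hM, Finset.sum_range_succ, hop]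
        simp only [Thread.movedAt, hW]
        abel
      have := (sim_delta (K := K) (qf := qf) he (hd _ he neg pos rfl) hm).add_left (W t)
      have hW' : W (t + 1) = W t := by simp only [W, hW]
      rwa [hW', add_comm _ (W t), add_comm _ (W t)]
    · push Not at hdelta
      have heff : (T.op t).effect = 0 := by
        generalize T.op t = o at hdelta
        cases o with
        | delta neg pos => exact absurd rfl (hdelta neg pos)
        | _ => rfl
      have haN : T.actor t < N := by
        by_contra! haN
        rw [T.bound _ _ haN, T.bound _ _ haN] at hs
        generalize T.op t = o at hdelta hs
        cases hs
        exact hdelta _ _ rfl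
      have hm : M (t + 1) + T.movedAt extra t = M t + T.movedAt extra (t + 1) := by
        refine toZ_injective ?_
        rw [map_add, map_add, hM, hM, Finset.sum_range_succ, heff]
        abel
      have hm' : M (t + 1) + moved (T.st t (T.actor t)).2
            (toVec (set (T.actor t)).1 + extra (T.actor t)) =
          M t + moved (T.st (t + 1) (T.actor t)).2
            (toVec (set (T.actor t)).1 + extra (T.actor t)) := by
        rw [← add_left_inj (T.movedAt extra t), add_right_comm, hm, add_assoc, hrel]
        abel
      have hWt : ∀ u, (∀ z, z ≠ T.actor t → T.st u z = T.st t z) → W u =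
          ∑ z ∈ (Finset.range N).erase (T.actor t),
            body (deflPlaces E) (slot z) (set z).1 (extra z) (T.st t z) +
          body (deflPlaces E) (slot (T.actor t)) (set (T.actor t)).1 (extra (T.actor t))
            (T.st u (T.actor t)) := by
        intro u hu
        simp only [W]
        rw [← Finset.sum_erase_add _ _ (Finset.mem_range.2 haN)]
        congr 1
        exact Finset.sum_congr rfl fun z hz => by rw [hu z (Finset.ne_of_mem_erase hz)]
      rw [hWt t fun _ _ => rfl, hWt (t + 1) (T.frame t), add_left_comm, add_left_comm
        ((M (t + 1)).mapDomain plP)]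
      refine PetriReach.add_left ?_ _
      unfold body
      split_ifs with hex
      · rw [hex, add_zero] at hm'
        exact sim_base he hs hdelta (T.set_mem t) (hset _ haN).1 hm'
      · exact sim_slot he hs hdelta (hloaded _ haN hex) (T.set_mem t) (hset _ haN).2 hm'
  have hrun : ∀ t ≤ T.n, PetriReach NET (stQ (T.q 0), (M 0).mapDomain plP + W 0)
      (stQ (T.q t), (M t).mapDomain plP + W t) := by
    intro t
    induction t with
    | zero => exact fun _ => .refl
    | succ t ih => exact fun ht => (ih (by omega)).trans (hstep t (by omega))
  have hstart : ∑ j ∈ Finset.range K, Finsupp.single (plAv j) 1 = F + W 0 := by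
    rw [← Finset.sum_sdiff (s₁ := (Thread.loaded N extra).image slot) (s₂ := Finset.range K)]
    · refine congrArg (F + ·) ?_
      rw [Finset.sum_image hinj, Thread.loaded, Finset.sum_filter]
      refine Finset.sum_congr rfl fun z _ => ?_
      rw [h0, body]
      by_cases hz : extra z = 0 <;> simp [hz, baseBody, slotBody]
    · intro j hj
      obtain ⟨z, hz, rfl⟩ := Finset.mem_image.1 hj
      exact Finset.mem_range.2 (hslot z hz)
  have hM0 : M 0 = m := by
    refine toZ_injective ?_
    rw [hM]
    simp [Thread.movedAt, h0]
  have hF : PetriReach NET (stQ qf, F) (stQ qf, 0) :=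
    Finset.sum_induction _ (fun v => PetriReach NET (stQ qf, v) (stQ qf, 0))
      (fun _ _ => PetriReach.clear_add) .refl fun j hj =>
        clear_av (Finset.mem_range.1 (Finset.mem_sdiff.1 hj).1)
  have hW : PetriReach NET (stQ qf, W T.n) (stQ qf, 0) := by
    refine Finset.sum_induction _ (fun v => PetriReach NET (stQ qf, v) (stQ qf, 0))
      (fun _ _ => PetriReach.clear_add) .refl fun z hz => ?_
    unfold body
    split_ifs with hex
    · have := T.done z
      generalize T.st T.n z = x at this
      obtain ⟨_ | _ | s, D⟩ := x
      · exact .refl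
      · exact .refl
      · exact absurd rfl (this s)
    · exact clear_slotBody (hloaded z (Finset.mem_range.1 hz) hex) _ (T.done z)
  have hend := (hF.clear_add hW).add_left ((M T.n).mapDomain plP)
  have hmain := (hrun T.n le_rfl).add_left F
  rw [hM0] at hmain
  rw [add_zero] at hend
  rw [hstart, add_left_comm]
  rw [hq₂, add_left_comm F ((M T.n).mapDomain plP)] at hmain
  exact hmain.trans hend

end

/-- Completeness of the Petri net. -/
theorem petriReach_of_vreach {V : VASSB} {E : List LEdge}
    (hE : ∀ e ∈ V.edges, ∃ l ∈ E, e = l.toV)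
    (hd : ∀ l ∈ E, ∀ neg pos, l.2.1 = .delta neg pos → ∀ p, toVec neg p = 0 ∨ toVec pos p = 0)
    {q₁ q₂ : ℕ} {m₁ m₂ : PairList} (h : VReach V ⟨q₁, toVec m₁, 0⟩ ⟨q₂, toVec m₂, 0⟩) :
    PetriReach (net E (deflPlaces E) (baseContents E) (slotBound E) q₂)
      (stQ q₁, toVec (startTokens (slotBound E) m₁)) (stQ q₂, toVec (onP m₂)) := by
  obtain ⟨N, set, T, extra, hT, hcard⟩ := exists_isRun hE h
  have := petriReach_of_isRun hT hd hcard.le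
  rw [toVec_onP, startTokens, toVec_append, toVec_onP]
  convert this using 4
  rw [toVec, List.map_map, ← List.sum_toFinset _ List.nodup_range, List.toFinset_range]
  rfl

/-! ### Codes -/

open Encodable

theorem exists_list_code {α : Type*} [Encodable α] (s : Multiset α) :
    ∃ l : List α, (l : Multiset α) = s ∧ l.Pairwise (fun a b => encode a ≤ encode b) ∧
      encode s = encode l := by
  have : IsLinearOrder α (encode ⁻¹'o (· ≤ ·)) :=
    (RelEmbedding.preimage ⟨encode, encode_injective⟩ (· ≤ ·)).isLinearOrder
  let : DecidableRel (encode (α := α) ⁻¹'o (· ≤ ·)) := fun a b => Nat.decLe _ _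
  have hs := Multiset.pairwise_sort s (encode ⁻¹'o (· ≤ ·))
  exact ⟨s.sort (encode ⁻¹'o (· ≤ ·)), Multiset.sort_eq _ _, hs, rfl⟩

theorem encode_list_map {α β : Type*} [Encodable α] [Encodable β] {f : α → β}
    (hf : ∀ a, encode (f a) = encode a) (l : List α) : encode (l.map f) = encode l := by
  induction l with
  | nil => rfl
  | cons a l ih => rw [List.map_cons, encode_list_cons, encode_list_cons, ih, hf]

theorem pairwise_sortDedup (l : List ℕ) : (sortDedup l).Pairwise (· < ·) :=
  List.pairwise_lt_range.filter _

/-- The code of a duplicate-free multiset can be computed from the codes of its members. -/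
theorem encode_multiset_eq {α : Type*} [Encodable α] {s : Multiset α} (hs : s.Nodup) {l : List ℕ}
    (hl : ∀ n, n ∈ l ↔ ∃ a ∈ s, encode a = n) : encode s = encode (sortDedup l) := by
  obtain ⟨L, rfl, hL, hc⟩ := exists_list_code s
  rw [hc, ← encode_list_map (f := (encode : α → ℕ)) (fun _ => rfl)]
  congr 1
  have hnd : (L.map encode).Nodup := (Multiset.coe_nodup.1 hs).map encode_injective
  have hperm : (L.map encode).Perm (sortDedup l) := by
    rw [List.perm_ext_iff_of_nodup hnd (nodup_sortDedup l)]
    intro n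
    simp [mem_sortDedup, hl]
  exact hperm.eq_of_pairwise' (List.pairwise_map.2 hL)
    ((pairwise_sortDedup l).imp fun h => le_of_lt h)

theorem encode_ofNat (n : ℕ) : encode (n : ℤ) = 2 * n := rfl

theorem encode_negSucc (n : ℕ) : encode (Int.negSucc n) = 2 * n + 1 := rfl

theorem sum_map_graph {M : Type*} [Zero M] (v : ℕ →₀ M) {h : M → ℕ} (h0 : h 0 = 0) :
    (v.graph.val.map fun x => Finsupp.single x.1 (h x.2)).sum = v.mapRange h h0 := by
  rw [Finsupp.graph, Finset.map_val, Multiset.map_map]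
  rw [← Finsupp.sum_single (v.mapRange h h0), Finsupp.sum_mapRange_index (by simp)]
  rfl

/-- The code of the vector assigning `f n` to places with amount `n` in `l`. -/
def vecCode (f : ℕ → ℕ) (l : PairList) : ℕ :=
  encode (sortDedup ((l.filter fun x => amount l x.1 ≠ 0).map fun x =>
    Nat.pair x.1 (f (amount l x.1))))

theorem encode_graph {M : Type*} [Zero M] [Encodable M] {v : ℕ →₀ M} {f : ℕ → ℕ} {l : PairList}
    (h0 : ∀ p, v p = 0 ↔ amount l p = 0) (hf : ∀ p, amount l p ≠ 0 → encode (v p) = f (amount l p)) :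
    encode v.graph.val = vecCode f l := by
  refine encode_multiset_eq v.graph.nodup fun n => ?_
  simp only [List.mem_map, List.mem_filter, decide_eq_true_eq, Finset.mem_val]
  constructor
  · rintro ⟨⟨p, a⟩, ⟨_, hp⟩, rfl⟩
    refine ⟨(p, v p), Finsupp.mk_mem_graph_iff.2 ⟨rfl, mt (h0 p).1 hp⟩, ?_⟩
    rw [encode_prod_val, hf p hp]
    rfl
  · rintro ⟨⟨p, a⟩, hp, rfl⟩
    obtain ⟨rfl, ha⟩ := Finsupp.mk_mem_graph_iff.1 hp
    have hp : amount l p ≠ 0 := mt (h0 p).2 ha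
    obtain ⟨x, hx, rfl⟩ : ∃ x ∈ l, x.1 = p := by
      by_contra! hx
      refine hp ?_
      rw [amount, List.filter_eq_nil_iff.2 fun x h => by simpa using hx x h]
      rfl
    refine ⟨x, ⟨hx, hp⟩, ?_⟩
    rw [encode_prod_val, hf _ hp]
    rfl

theorem encodeVec_toVec (l : PairList) : encodeVec (toVec l) = vecCode id l :=
  encode_graph (fun p => by rw [amount_eq]) fun p _ => by rw [amount_eq]; rfl

theorem encodeZVec_toZ (l : PairList) : encodeZVec (toZ (toVec l)) = vecCode (fun n => 2 * n) l :=
  encode_graph (fun p => by rw [amount_eq, toZ_apply, Nat.cast_eq_zero]) fun p _ => by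
    rw [amount_eq, toZ_apply, encode_ofNat]

theorem encodeZVec_neg_toZ (l : PairList) :
    encodeZVec (-toZ (toVec l)) = vecCode (fun n => 2 * n - 1) l :=
  encode_graph (fun p => by rw [amount_eq, Finsupp.neg_apply, toZ_apply, neg_eq_zero,
      Nat.cast_eq_zero]) fun p hp => by
    rw [Finsupp.neg_apply, toZ_apply, ← amount_eq]
    obtain ⟨n, hn⟩ := Nat.exists_eq_succ_of_ne_zero hp
    rw [hn]
    exact (encode_negSucc n).trans (by omega)

theorem encodeZVec_injective : Function.Injective encodeZVec := fun _ _ h =>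
  Finsupp.graph_injective _ _ (Finset.val_injective (encode_injective h))

/-! ### Decoding -/

/-- Decoding with a default value. -/
def decodeD (α : Type) [Encodable α] [Inhabited α] (n : ℕ) : α := (decode n : Option α).getD default

@[simp] theorem decodeD_encode {α : Type} [Encodable α] [Inhabited α] (a : α) :
    decodeD α (encode a) = a := by
  rw [decodeD, encodek, Option.getD_some]

/-- Decoding a vector. -/
def decodeVec (n : ℕ) : PairList := decodeD PairList n

theorem toVec_decodeVec (v : Vec) : toVec (decodeVec (encodeVec v)) = v := by
  obtain ⟨l, hl, _, hc⟩ := exists_list_code v.graph.val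
  rw [encodeVec, hc, decodeVec, decodeD_encode, toVec, ← Multiset.sum_coe, ← Multiset.map_coe, hl]
  have := sum_map_graph v (h := id) rfl
  simpa using this

/-- The positive part of a coded integer. -/
def codePos (n : ℕ) : ℕ := if n % 2 = 0 then n / 2 else 0

/-- The negative part of a coded integer. -/
def codeNeg (n : ℕ) : ℕ := if n % 2 = 0 then 0 else n / 2 + 1

theorem codePos_encode (z : ℤ) : codePos (encode z) = z.toNat := by
  cases z with
  | ofNat n => rw [Int.ofNat_eq_natCast, encode_ofNat, codePos, Int.toNat_natCast]; simp
  | negSucc n => rw [encode_negSucc, codePos, if_neg (by omega)]; rfl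

theorem codeNeg_encode (z : ℤ) : codeNeg (encode z) = (-z).toNat := by
  cases z with
  | ofNat n => rw [Int.ofNat_eq_natCast, encode_ofNat, codeNeg]; simp
  | negSucc n => rw [encode_negSucc, codeNeg, if_neg (by omega), Int.neg_negSucc]; omega

/-- Decoding the part of an integer vector selected by `f`. -/
def decodePart (f : ℕ → ℕ) (n : ℕ) : PairList := (decodeVec n).map fun x => (x.1, f x.2)

theorem toVec_decodePart {f : ℕ → ℕ} {h : ℤ → ℕ} (hf : ∀ z : ℤ, f (encode z) = h z)
    (h0 : h 0 = 0) (d : ZVec) : toVec (decodePart f (encodeZVec d)) = d.mapRange h h0 := by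
  obtain ⟨l, hl, _, hc⟩ := exists_list_code d.graph.val
  have hl' : encode l = encode (l.map fun x => ((x.1, encode x.2) : ℕ × ℕ)) :=
    (encode_list_map (f := fun x : ℕ × ℤ => ((x.1, encode x.2) : ℕ × ℕ)) (fun _ => rfl) l).symm
  rw [encodeZVec, hc, hl', decodePart, decodeVec, decodeD_encode, ← sum_map_graph d h0, ← hl,
    toVec, Multiset.map_coe, Multiset.sum_coe, List.map_map, List.map_map]
  simp only [Function.comp_def, hf]

/-- Decoding a list of linear sets. -/
def decodeSL (n : ℕ) : List (PairList × List PairList) :=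
  (decodeD (List (ℕ × List ℕ)) n).map fun x => (decodeVec x.1, x.2.map decodeVec)

/-- Decoding an edge label. -/
def decodeOp (n : ℕ) : LOp :=
  if n.unpair.1 = 0 then .delta (decodePart codeNeg n.unpair.2) (decodePart codePos n.unpair.2)
  else if n.unpair.1 = 1 then .inflate n.unpair.2.unpair.1 (decodeSL n.unpair.2.unpair.2)
  else if n.unpair.1 = 2 then .deflate n.unpair.2.unpair.1 n.unpair.2.unpair.2.unpair.1
    n.unpair.2.unpair.2.unpair.2.unpair.1 n.unpair.2.unpair.2.unpair.2.unpair.2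
  else .burst n.unpair.2

theorem toV_decodeOp (op : VOp) : (decodeOp (encodeVOp op)).toV = op := by
  cases op with
  | delta d =>
    rw [encodeVOp, decodeOp, Nat.unpair_pair, if_pos rfl, LOp.toV,
      toVec_decodePart (h := fun z => (-z).toNat) codeNeg_encode rfl,
      toVec_decodePart codePos_encode rfl]
    congr 1
    ext p
    simp only [Finsupp.sub_apply, toZ_apply, Finsupp.mapRange_apply]
    omega
  | inflate s L =>
    rw [encodeVOp, decodeOp]
    simp only [Nat.unpair_pair, one_ne_zero, if_false, if_true, LOp.toV, decodeSL, encodeSL,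
      decodeD_encode, List.map_map, Function.comp_def, toVec_decodeVec, List.map_id']
  | deflate s s' pl p =>
    simp [encodeVOp, decodeOp, LOp.toV]
  | burst s => simp [encodeVOp, decodeOp, LOp.toV]

theorem decodeOp_disjoint (op : VOp) {neg pos : PairList}
    (h : decodeOp (encodeVOp op) = .delta neg pos) (p : ℕ) : toVec neg p = 0 ∨ toVec pos p = 0 := by
  cases op with
  | delta d =>
    rw [encodeVOp, decodeOp, Nat.unpair_pair, if_pos rfl] at h
    injection h with h1 h2
    rw [← h1, ← h2, toVec_decodePart (h := fun z => (-z).toNat) codeNeg_encode rfl,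
      toVec_decodePart codePos_encode rfl, Finsupp.mapRange_apply, Finsupp.mapRange_apply]
    omega
  | _ => simp [encodeVOp, decodeOp] at h

/-- Decoding an edge. -/
def decodeEdge (c : ℕ × ℕ × ℕ) : LEdge := (c.1, decodeOp c.2.1, c.2.2)

/-- The coded edges of a coded VASSB. -/
def codedEdges (n : ℕ) : List (ℕ × ℕ × ℕ) :=
  decodeD _ n.unpair.2.unpair.2.unpair.2.unpair.2

theorem coe_codedEdges (V : VASSB) : (codedEdges (encodeVASSB V) : Multiset (ℕ × ℕ × ℕ)) =
    V.edges.val.map fun e => (e.1, encodeVOp e.2.1, e.2.2) := by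
  obtain ⟨l, hl, _, hc⟩ := exists_list_code
    (V.edges.val.map fun e => (e.1, encodeVOp e.2.1, e.2.2))
  rw [← hl, codedEdges, encodeVASSB]
  simp only [encode_prod_val, Nat.unpair_pair, hc, decodeD_encode]

theorem mem_codedEdges {V : VASSB} {c : ℕ × ℕ × ℕ} :
    c ∈ codedEdges (encodeVASSB V) ↔ ∃ e ∈ V.edges, (e.1, encodeVOp e.2.1, e.2.2) = c := by
  rw [← Multiset.mem_coe, coe_codedEdges, Multiset.mem_map]
  rfl

/-- The code of the VASS simulating a Petri net. -/
def netCode (N : List PetriEdge) : ℕ :=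
  encode (sortDedup (N.flatMap fun e =>
    [encode (2 * e.1, vecCode (fun n => 2 * n - 1) e.2.1, 2 * encode e + 1),
      encode (2 * encode e + 1, vecCode (fun n => 2 * n) e.2.2.1, 2 * e.2.2.2)]))

theorem encodeVASS_petriVASS (N : List PetriEdge) :
    encodeVASS (petriVASS N) =
      Nat.pair (encode (0 : Multiset ℕ)) (Nat.pair (encode (0 : Multiset ℕ)) (netCode N)) := by
  rw [encodeVASS, encode_prod_val, encode_prod_val]
  refine congrArg (fun x => Nat.pair _ (Nat.pair _ x)) (encode_multiset_eq ?_ fun n => ?_)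
  · refine (petriVASS N).edges.nodup.map fun x y h => ?_
    obtain ⟨h1, h2, h3⟩ := by simpa only [Prod.mk.injEq] using h
    exact Prod.ext h1 (Prod.ext (encodeZVec_injective h2) h3)
  · simp only [Multiset.mem_map, Finset.mem_val, petriVASS, List.mem_toFinset, List.mem_flatMap,
      ← encodeZVec_toZ, ← encodeZVec_neg_toZ]
    constructor
    · rintro ⟨e, he, hn⟩
      rcases List.mem_pair.1 hn with rfl | rfl
      · exact ⟨_, ⟨_, ⟨e, he, List.mem_cons_self⟩, rfl⟩, rfl⟩
      · exact ⟨_, ⟨_, ⟨e, he, List.mem_cons_of_mem _ List.mem_cons_self⟩, rfl⟩, rfl⟩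
    · rintro ⟨_, ⟨x, ⟨e, he, hx⟩, rfl⟩, rfl⟩
      refine ⟨e, he, ?_⟩
      rcases List.mem_pair.1 hx with rfl | rfl
      · exact List.mem_cons_self
      · exact List.mem_cons_of_mem _ List.mem_cons_self

/-! ### Computability of the reduction -/

section

variable {α β σ : Type*} [Primcodable α] [Primcodable β] [Primcodable σ]

theorem primrec_sum {f : α → List ℕ} (hf : Primrec f) : Primrec fun a => (f a).sum :=
  (Primrec.list_foldr hf (Primrec.const 0)
    (Primrec.nat_add.comp (Primrec.fst.comp Primrec.snd) (Primrec.snd.comp Primrec.snd)).to₂).of_eq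
    fun _ => List.sum_eq_foldr.symm

theorem primrec_filter {f : α → List β} {p : α → β → Prop} [∀ a b, Decidable (p a b)]
    (hf : Primrec f) (hp : PrimrecRel p) : Primrec fun a => (f a).filter fun b => p a b := by
  refine (Primrec.listFilterMap hf (g := fun a b => if p a b then some b else none) ?_).of_eq
    fun a => ?_
  · exact Primrec.ite hp (Primrec.option_some.comp Primrec.snd) (Primrec.const none)
  · rw [← List.filterMap_eq_filter]
    refine List.filterMap_congr fun b _ => ?_
    by_cases h : p a b <;> simp [h, Option.guard]

theorem primrec_sortDedup : Primrec sortDedup := by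
  have h : PrimrecRel fun (l : List ℕ) (n : ℕ) => n ∈ l :=
    (PrimrecRel.exists_mem_list Primrec.eq).of_eq fun l n => by simp
  exact primrec_filter (Primrec.list_range.comp (Primrec.succ.comp (primrec_sum Primrec.id))) h

theorem primrec_pow : Primrec₂ ((· ^ ·) : ℕ → ℕ → ℕ) :=
  Primrec₂.unpaired'.1 Nat.Primrec.pow

theorem primrec_amount : Primrec₂ amount := by
  refine primrec_sum (Primrec.list_map (primrec_filter Primrec.fst ?_)
    (Primrec.snd.comp Primrec.snd).to₂)
  exact Primrec.eq.comp (Primrec.fst.comp Primrec.snd) (Primrec.snd.comp Primrec.fst)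

theorem primrec_subl : Primrec subl := by
  have h : Primrec fun x : PairList × (ℕ × ℕ) × List PairList => x.2.2 :=
    Primrec.snd.comp Primrec.snd
  have hc : Primrec₂ fun (x : PairList × (ℕ × ℕ) × List PairList) (l : PairList) => x.2.1 :: l :=
    Primrec.list_cons.comp (Primrec.fst.comp (Primrec.snd.comp Primrec.fst)) Primrec.snd
  exact Primrec.list_foldr Primrec.id (Primrec.const [[]])
    (Primrec.list_append.comp h (Primrec.list_map h hc)).to₂

theorem primrec_vecCode {f : ℕ → ℕ} (hf : Primrec f) : Primrec (vecCode f) := by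
  have ha : Primrec fun x : PairList × ℕ × ℕ => amount x.1 x.2.1 :=
    primrec_amount.comp Primrec.fst (Primrec.fst.comp Primrec.snd)
  refine Primrec.encode.comp (primrec_sortDedup.comp (Primrec.list_map
    (primrec_filter Primrec.id ?_) ?_))
  · exact (Primrec.eq.comp ha (Primrec.const 0)).not
  · exact Primrec₂.natPair.comp (Primrec.fst.comp Primrec.snd) (hf.comp ha)

theorem primrec_decodeD (α : Type) [Primcodable α] [Inhabited α] : Primrec (decodeD α) :=
  Primrec.option_getD_default.comp Primrec.decode

theorem primrec_decodeVec : Primrec decodeVec := primrec_decodeD PairList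

theorem primrec_decodePart {f : ℕ → ℕ} (hf : Primrec f) : Primrec (decodePart f) :=
  Primrec.list_map primrec_decodeVec ((Primrec.fst.comp Primrec.snd).pair
    (hf.comp (Primrec.snd.comp Primrec.snd))).to₂

theorem primrecPred_even : PrimrecPred fun n : ℕ => n % 2 = 0 :=
  Primrec.eq.comp (Primrec.nat_mod.comp Primrec.id (Primrec.const 2)) (Primrec.const 0)

theorem primrec_codePos : Primrec codePos :=
  Primrec.ite primrecPred_even (Primrec.nat_div.comp Primrec.id (Primrec.const 2))
    (Primrec.const 0)

theorem primrec_codeNeg : Primrec codeNeg :=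
  Primrec.ite primrecPred_even (Primrec.const 0)
    (Primrec.succ.comp (Primrec.nat_div.comp Primrec.id (Primrec.const 2)))

theorem primrec_decodeSL : Primrec decodeSL :=
  Primrec.list_map (primrec_decodeD _) ((primrec_decodeVec.comp (Primrec.fst.comp Primrec.snd)).pair
    (Primrec.list_map (Primrec.snd.comp Primrec.snd) (primrec_decodeVec.comp Primrec.snd).to₂)).to₂

theorem primrec_left : Primrec fun n : ℕ => n.unpair.1 := Primrec.fst.comp Primrec.unpair

theorem primrec_right : Primrec fun n : ℕ => n.unpair.2 := Primrec.snd.comp Primrec.unpair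

/-- A function defined by cases on a decoded edge label is primitive recursive if its cases are. -/
theorem primrec_decodeOp_cases {F : α → LOp → σ} {g : α → ℕ} (hg : Primrec g)
    (h0 : Primrec fun x : α × PairList × PairList => F x.1 (.delta x.2.1 x.2.2))
    (h1 : Primrec fun x : α × ℕ × List (PairList × List PairList) =>
      F x.1 (.inflate x.2.1 x.2.2))
    (h2 : Primrec fun x : α × ℕ × ℕ × ℕ × ℕ => F x.1 (.deflate x.2.1 x.2.2.1 x.2.2.2.1 x.2.2.2.2))
    (h3 : Primrec fun x : α × ℕ => F x.1 (.burst x.2)) :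
    Primrec fun a => F a (decodeOp (g a)) := by
  have hl := primrec_left.comp hg
  have hr := primrec_right.comp hg
  have hrr := primrec_right.comp hr
  have hrrr := primrec_right.comp hrr
  have hc : ∀ n : ℕ, PrimrecPred fun a => (g a).unpair.1 = n := fun n =>
    Primrec.eq.comp hl (Primrec.const n)
  refine (Primrec.ite (hc 0) (h0.comp (Primrec.id.pair
      (((primrec_decodePart primrec_codeNeg).comp hr).pair
        ((primrec_decodePart primrec_codePos).comp hr))))
    (Primrec.ite (hc 1) (h1.comp (Primrec.id.pair
      ((primrec_left.comp hr).pair (primrec_decodeSL.comp hrr))))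
    (Primrec.ite (hc 2) (h2.comp (Primrec.id.pair ((primrec_left.comp hr).pair
      ((primrec_left.comp hrr).pair ((primrec_left.comp hrrr).pair (primrec_right.comp hrrr))))))
    (h3.comp (Primrec.id.pair hr))))).of_eq fun a => ?_
  simp only [decodeOp]
  split_ifs <;> rfl

theorem primrec_decodeOp_linearSets : Primrec fun n => (decodeOp n).linearSets :=
  primrec_decodeOp_cases (F := fun _ => LOp.linearSets) Primrec.id (Primrec.const [])
    (Primrec.snd.comp Primrec.snd) (Primrec.const []) (Primrec.const [])

theorem primrec_decodeOp_deflated : Primrec fun n => (decodeOp n).deflated :=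
  primrec_decodeOp_cases (F := fun _ => LOp.deflated) Primrec.id (Primrec.const [])
    (Primrec.const []) (Primrec.list_cons.comp (Primrec.fst.comp (Primrec.snd.comp
      (Primrec.snd.comp Primrec.snd))) (Primrec.const [])) (Primrec.const [])

/-- The decoded edges. -/
def decodeEdges (C : List (ℕ × ℕ × ℕ)) : List LEdge := C.map decodeEdge

theorem primrec_linearSets : Primrec fun C => linearSets (decodeEdges C) :=
  (Primrec.list_flatMap Primrec.id (primrec_decodeOp_linearSets.comp
    (Primrec.fst.comp (Primrec.snd.comp Primrec.snd))).to₂).of_eq fun C =>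
      (List.flatMap_map decodeEdge (fun e : LEdge => e.2.1.linearSets) C).symm

theorem primrec_deflPlaces : Primrec fun C => deflPlaces (decodeEdges C) :=
  (primrec_sortDedup.comp (Primrec.list_flatMap Primrec.id (primrec_decodeOp_deflated.comp
    (Primrec.fst.comp (Primrec.snd.comp Primrec.snd))).to₂)).of_eq fun C =>
      congrArg sortDedup
        (List.flatMap_map decodeEdge (fun e : LEdge => e.2.1.deflated) C).symm

theorem primrec_baseContents : Primrec fun C => baseContents (decodeEdges C) :=
  Primrec.list_flatMap primrec_linearSets (primrec_subl.comp (Primrec.fst.comp Primrec.snd)).to₂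

theorem primrec_slotBound : Primrec fun C => slotBound (decodeEdges C) := by
  have hE : Primrec fun C => (decodeEdges C).length :=
    Primrec.list_length.of_eq fun C => (List.length_map _).symm
  have hS := Primrec.list_length.comp primrec_linearSets
  have h2 : Primrec fun C => 2 * ((decodeEdges C).length + 1) :=
    Primrec.nat_mul.comp (Primrec.const 2) (Primrec.succ.comp hE)
  exact primrec_pow.comp h2 (Primrec.nat_mul.comp h2 (Primrec.succ.comp (Primrec.nat_mul.comp
    (Primrec.succ.comp hS) (Primrec.nat_add.comp hE (Primrec.const 3)))))

end

section

variable {α β : Type*} [Primcodable α] [Primcodable β]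

theorem primrec_cons {f : α → β} {g : α → List β} (hf : Primrec f) (hg : Primrec g) :
    Primrec fun a => f a :: g a :=
  Primrec.list_cons.comp hf hg

theorem primrec_append {f g : α → List β} (hf : Primrec f) (hg : Primrec g) :
    Primrec fun a => f a ++ g a :=
  Primrec.list_append.comp hf hg

theorem primrec_singleton {f : α → β} (hf : Primrec f) : Primrec fun a => [f a] :=
  primrec_cons hf (Primrec.const [])

theorem primrec_natPair {f g : α → ℕ} (hf : Primrec f) (hg : Primrec g) :
    Primrec fun a => Nat.pair (f a) (g a) :=
  Primrec₂.natPair.comp hf hg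

theorem primrec_tag (n : ℕ) {f : α → ℕ} (hf : Primrec f) : Primrec fun a => Nat.pair n (f a) :=
  primrec_natPair (Primrec.const n) hf

theorem primrec_tokens {f g : α → ℕ} (hf : Primrec f) (hg : Primrec g) :
    Primrec fun a => [(f a, g a)] :=
  primrec_singleton (hf.pair hg)

theorem primrec_token {f : α → ℕ} (hf : Primrec f) : Primrec fun a => (f a, 1) :=
  hf.pair (Primrec.const 1)

theorem primrec_petriEdge {q q' : α → ℕ} {u v : α → PairList} (hq : Primrec q) (hu : Primrec u)
    (hv : Primrec v) (hq' : Primrec q') : Primrec fun a => ((q a, u a, v a, q' a) : PetriEdge) :=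
  hq.pair (hu.pair (hv.pair hq'))

theorem primrec_onP {f : α → PairList} (hf : Primrec f) : Primrec fun a => onP (f a) :=
  Primrec.list_map hf ((primrec_tag 0 (Primrec.fst.comp Primrec.snd)).pair
    (Primrec.snd.comp Primrec.snd)).to₂

theorem primrec_loadOf {I : α → List ℕ} {j : α → ℕ} {v : α → PairList} (hI : Primrec I)
    (hj : Primrec j) (hv : Primrec v) : Primrec fun a => loadOf (I a) (j a) (v a) :=
  Primrec.list_map hI ((primrec_tag 6 (primrec_natPair (hj.comp Primrec.fst) Primrec.snd)).pair
    (primrec_amount.comp (hv.comp Primrec.fst) Primrec.snd)).to₂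

theorem primrec_undOf {I : α → List ℕ} {j : α → ℕ} (hI : Primrec I) (hj : Primrec j) :
    Primrec fun a => undOf (I a) (j a) :=
  Primrec.list_map hI (primrec_token (primrec_tag 4
    (primrec_natPair (hj.comp Primrec.fst) Primrec.snd))).to₂

theorem primrec_flatMap_range {K : α → ℕ} {F : α → ℕ → List β} (hK : Primrec K)
    (hF : Primrec fun x : α × ℕ => F x.1 x.2) :
    Primrec fun a => (List.range (K a)).flatMap (F a) :=
  Primrec.list_flatMap (Primrec.list_range.comp hK) hF

theorem primrec_deltaEdges {q q' : α → ℕ} {neg pos : α → PairList} (hq : Primrec q)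
    (hneg : Primrec neg) (hpos : Primrec pos) (hq' : Primrec q') :
    Primrec fun a => deltaEdges (q a) (neg a) (pos a) (q' a) :=
  primrec_singleton (primrec_petriEdge (primrec_tag 0 hq) (primrec_onP hneg) (primrec_onP hpos)
    (primrec_tag 0 hq'))

theorem primrec_inflateEdges {I : α → List ℕ} {K q s q' : α → ℕ}
    {L : α → List (PairList × List PairList)} (hI : Primrec I) (hK : Primrec K) (hq : Primrec q)
    (hs : Primrec s) (hL : Primrec L) (hq' : Primrec q') :
    Primrec fun a => inflateEdges (I a) (K a) (q a) (s a) (L a) (q' a) := by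
  refine Primrec.list_flatMap hL ?_
  have hq := primrec_tag 0 (hq.comp (Primrec.fst (β := PairList × List PairList)))
  have hq' := hq'.comp (Primrec.fst (β := PairList × List PairList))
  have hs := hs.comp (Primrec.fst (β := PairList × List PairList))
  have hI := hI.comp (Primrec.fst (β := PairList × List PairList))
  have hb : Primrec fun x : α × PairList × List PairList => x.2.1 :=
    Primrec.fst.comp Primrec.snd
  have hvs : Primrec fun x : α × PairList × List PairList => x.2.2 :=
    Primrec.snd.comp Primrec.snd
  refine primrec_cons (primrec_petriEdge hq (Primrec.const []) (primrec_tokens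
    (primrec_tag 2 (primrec_natPair hs (Primrec.encode.comp hb))) (Primrec.const 1))
    (primrec_tag 0 hq')) (primrec_flatMap_range (hK.comp Primrec.fst) ?_)
  have hj : Primrec fun x : (α × PairList × List PairList) × ℕ => x.2 := Primrec.snd
  have hq := hq.comp (Primrec.fst (β := ℕ))
  have hq' := hq'.comp (Primrec.fst (β := ℕ))
  have hs := hs.comp (Primrec.fst (β := ℕ))
  have hI := hI.comp (Primrec.fst (β := ℕ))
  have hb := hb.comp (Primrec.fst (β := ℕ))
  have hvs := hvs.comp (Primrec.fst (β := ℕ))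
  have hst := primrec_tag 1 (primrec_natPair hj (primrec_natPair (Primrec.encode.comp hvs) hq'))
  refine primrec_cons (primrec_petriEdge hq (primrec_tokens (primrec_tag 1 hj) (Primrec.const 1))
    (primrec_cons (primrec_token (primrec_tag 3 (primrec_natPair hj hs)))
      (primrec_append (primrec_undOf hI hj) (primrec_loadOf hI hj hb))) hst)
    (primrec_cons (primrec_petriEdge hst (Primrec.const []) (Primrec.const []) (primrec_tag 0 hq'))
      (Primrec.list_map hvs ?_))
  exact primrec_petriEdge (hst.comp Primrec.fst) (Primrec.const [])
    (primrec_loadOf (hI.comp Primrec.fst) (hj.comp Primrec.fst) Primrec.snd)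
    (hst.comp Primrec.fst)

theorem primrec_deflateEdges {B : α → List PairList} {K q s s' i p q' : α → ℕ} (hB : Primrec B)
    (hK : Primrec K) (hq : Primrec q) (hs : Primrec s) (hs' : Primrec s') (hi : Primrec i)
    (hp : Primrec p) (hq' : Primrec q') :
    Primrec fun a => deflateEdges (B a) (K a) (q a) (s a) (s' a) (i a) (p a) (q' a) := by
  have hqT := primrec_tag 0 hq
  have hqT' := primrec_tag 0 hq'
  have hpT := primrec_tag 0 hp
  refine primrec_append (Primrec.list_map hB ?_) (primrec_flatMap_range hK ?_)
  · refine primrec_petriEdge (hqT.comp Primrec.fst) (primrec_tokens (primrec_tag 2 (primrec_natPair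
      (hs.comp Primrec.fst) (Primrec.encode.comp Primrec.snd))) (Primrec.const 1))
      (primrec_cons (primrec_token (primrec_tag 2 (primrec_natPair (hs'.comp Primrec.fst)
        (Primrec.encode.comp (primrec_filter Primrec.snd ?_))))) (primrec_tokens
          (hpT.comp Primrec.fst) (primrec_amount.comp Primrec.snd (hi.comp Primrec.fst))))
      (hqT'.comp Primrec.fst)
    exact (Primrec.eq.comp (Primrec.fst.comp Primrec.snd)
      (hi.comp (Primrec.fst.comp Primrec.fst))).not
  · have hj : Primrec fun x : α × ℕ => x.2 := Primrec.snd
    have hi := hi.comp (Primrec.fst (β := ℕ))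
    have hqT := hqT.comp (Primrec.fst (β := ℕ))
    have hqT' := hqT'.comp (Primrec.fst (β := ℕ))
    have hspec := primrec_token (primrec_tag 3 (primrec_natPair hj (hs.comp Primrec.fst)))
    have hspec' := primrec_token (primrec_tag 3 (primrec_natPair hj (hs'.comp Primrec.fst)))
    have hdon := primrec_token (primrec_tag 5 (primrec_natPair hj hi))
    have hund := primrec_token (primrec_tag 4 (primrec_natPair hj hi))
    have hst := primrec_tag 2 (primrec_natPair hj (primrec_natPair hi
      (primrec_natPair (hp.comp Primrec.fst) (hq'.comp Primrec.fst))))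
    have hdef := primrec_cons hspec' (primrec_singleton hdon)
    exact primrec_cons (primrec_petriEdge hqT (primrec_cons hspec (primrec_singleton hund)) hdef
        hst)
      (primrec_cons (primrec_petriEdge hst
          (primrec_tokens (primrec_tag 6 (primrec_natPair hj hi)) (Primrec.const 1))
          (primrec_tokens (hpT.comp Primrec.fst) (Primrec.const 1)) hst)
        (primrec_cons (primrec_petriEdge hst (Primrec.const []) (Primrec.const []) hqT')
          (primrec_singleton (primrec_petriEdge hqT
            (primrec_cons hspec (primrec_singleton hdon)) hdef hqT'))))

theorem primrec_burstEdges {B : α → List PairList} {K q s q' : α → ℕ} (hB : Primrec B)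
    (hK : Primrec K) (hq : Primrec q) (hs : Primrec s) (hq' : Primrec q') :
    Primrec fun a => burstEdges (B a) (K a) (q a) (s a) (q' a) := by
  have hq := primrec_tag 0 hq
  have hq' := primrec_tag 0 hq'
  exact primrec_append
    (Primrec.list_map hB (primrec_petriEdge (hq.comp Primrec.fst) (primrec_tokens (primrec_tag 2
      (primrec_natPair (hs.comp Primrec.fst) (Primrec.encode.comp Primrec.snd))) (Primrec.const 1))
      (Primrec.const []) (hq'.comp Primrec.fst)).to₂)
    (Primrec.list_map (Primrec.list_range.comp hK) (primrec_petriEdge (hq.comp Primrec.fst)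
      (primrec_tokens (primrec_tag 3 (primrec_natPair Primrec.snd (hs.comp Primrec.fst)))
        (Primrec.const 1)) (Primrec.const []) (hq'.comp Primrec.fst)).to₂)

theorem primrec_clearEdges {I : α → List ℕ} {K qf : α → ℕ} (hI : Primrec I) (hK : Primrec K)
    (hqf : Primrec qf) : Primrec fun a => clearEdges (I a) (K a) (qf a) := by
  have hqf := primrec_tag 0 hqf
  have hnil {γ : Type _} [Primcodable γ] : Primrec fun _ : γ => ([] : PairList) := Primrec.const []
  refine primrec_flatMap_range hK ?_
  have hq := hqf.comp (Primrec.fst (β := ℕ))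
  refine primrec_cons (primrec_petriEdge hq (primrec_tokens (primrec_tag 1 Primrec.snd)
    (Primrec.const 1)) hnil hq) (Primrec.list_flatMap (hI.comp Primrec.fst) ?_)
  have hq := hq.comp (Primrec.fst (β := ℕ))
  have hji : Primrec fun x : (α × ℕ) × ℕ => Nat.pair x.1.2 x.2 :=
    primrec_natPair (Primrec.snd.comp Primrec.fst) Primrec.snd
  have htok := fun n : ℕ => primrec_tokens (primrec_tag n hji) (Primrec.const 1)
  have hst := primrec_tag 3 hji
  exact primrec_cons (primrec_petriEdge hq (htok 4) hnil hst)
    (primrec_cons (primrec_petriEdge hst (htok 6) hnil hst)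
      (primrec_cons (primrec_petriEdge hst hnil hnil hq)
        (primrec_singleton (primrec_petriEdge hq (htok 5) hnil hq))))

theorem primrec_gadget {I : α → List ℕ} {B : α → List PairList} {K : α → ℕ} {c : α → ℕ × ℕ × ℕ}
    (hI : Primrec I) (hB : Primrec B) (hK : Primrec K) (hc : Primrec c) :
    Primrec fun a => gadget (I a) (B a) (K a) (decodeEdge (c a)) := by
  have hq := Primrec.fst.comp hc
  have hq' := Primrec.snd.comp (Primrec.snd.comp hc)
  refine primrec_decodeOp_cases
    (F := fun a op => gadget (I a) (B a) (K a) ((c a).1, op, (c a).2.2))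
    (Primrec.fst.comp (Primrec.snd.comp hc)) ?_ ?_ ?_ ?_
  · exact primrec_deltaEdges (hq.comp Primrec.fst) (Primrec.fst.comp Primrec.snd)
      (Primrec.snd.comp Primrec.snd) (hq'.comp Primrec.fst)
  · exact primrec_inflateEdges (hI.comp Primrec.fst) (hK.comp Primrec.fst) (hq.comp Primrec.fst)
      (Primrec.fst.comp Primrec.snd) (Primrec.snd.comp Primrec.snd) (hq'.comp Primrec.fst)
  · have h2 : Primrec fun x : α × ℕ × ℕ × ℕ × ℕ => x.2.2 := Primrec.snd.comp Primrec.snd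
    exact primrec_deflateEdges (hB.comp Primrec.fst) (hK.comp Primrec.fst) (hq.comp Primrec.fst)
      (Primrec.fst.comp Primrec.snd) (Primrec.fst.comp h2) (Primrec.fst.comp (Primrec.snd.comp h2))
      (Primrec.snd.comp (Primrec.snd.comp h2)) (hq'.comp Primrec.fst)
  · exact primrec_burstEdges (hB.comp Primrec.fst) (hK.comp Primrec.fst) (hq.comp Primrec.fst)
      Primrec.snd (hq'.comp Primrec.fst)

theorem primrec_net {C : α → List (ℕ × ℕ × ℕ)} {I : α → List ℕ} {B : α → List PairList}
    {K qf : α → ℕ} (hC : Primrec C) (hI : Primrec I) (hB : Primrec B) (hK : Primrec K)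
    (hqf : Primrec qf) :
    Primrec fun a => net (decodeEdges (C a)) (I a) (B a) (K a) (qf a) :=
  (primrec_append (primrec_clearEdges hI hK hqf) (Primrec.list_flatMap hC (primrec_gadget
    (hI.comp Primrec.fst) (hB.comp Primrec.fst) (hK.comp Primrec.fst) Primrec.snd).to₂)).of_eq
    fun a => congrArg (clearEdges (I a) (K a) (qf a) ++ ·)
      (List.flatMap_map decodeEdge (gadget (I a) (B a) (K a)) (C a)).symm

theorem primrec_startTokens {K : α → ℕ} {m : α → PairList} (hK : Primrec K) (hm : Primrec m) :
    Primrec fun a => startTokens (K a) (m a) :=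
  primrec_append (primrec_onP hm) (Primrec.list_map (Primrec.list_range.comp hK)
    (primrec_token (primrec_tag 1 Primrec.snd)).to₂)

theorem primrec_netCode : Primrec netCode := by
  refine Primrec.encode.comp (primrec_sortDedup.comp (Primrec.list_flatMap Primrec.id
    ?_))
  have he : Primrec fun x : List PetriEdge × PetriEdge => x.2 := Primrec.snd
  have hmid := Primrec.nat_double_succ.comp (Primrec.encode.comp he)
  have he2 := Primrec.snd.comp he
  refine primrec_cons (Primrec.encode.comp ((Primrec.nat_double.comp (Primrec.fst.comp he)).pair
    (((primrec_vecCode ?_).comp (Primrec.fst.comp he2)).pair hmid)))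
    (primrec_singleton (Primrec.encode.comp (hmid.pair (((primrec_vecCode Primrec.nat_double).comp
      (Primrec.fst.comp (Primrec.snd.comp he2))).pair
      (Primrec.nat_double.comp (Primrec.snd.comp (Primrec.snd.comp he2)))))))
  exact Primrec.nat_sub.comp Primrec.nat_double (Primrec.const 1)

end

/-- The reduction on codes. -/
def reduction (n : ℕ) : ℕ :=
  let C := codedEdges n.unpair.1
  let E := decodeEdges C
  let s := n.unpair.2
  let q₂ := s.unpair.2.unpair.1
  Nat.pair
    (Nat.pair (encode (0 : Multiset ℕ)) (Nat.pair (encode (0 : Multiset ℕ))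
      (netCode (net E (deflPlaces E) (baseContents E) (slotBound E) q₂))))
    (Nat.pair
      (Nat.pair (2 * stQ s.unpair.1.unpair.1)
        (vecCode id (startTokens (slotBound E) (decodeVec s.unpair.1.unpair.2.unpair.1))))
      (Nat.pair (2 * stQ q₂) (vecCode id (onP (decodeVec s.unpair.2.unpair.2.unpair.1)))))

theorem primrec_codedEdges : Primrec codedEdges :=
  (primrec_decodeD _).comp (primrec_right.comp (primrec_right.comp (primrec_right.comp
    primrec_right)))

theorem primrec_reduction : Primrec reduction := by
  have hC := primrec_codedEdges.comp primrec_left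
  have hI := primrec_deflPlaces.comp hC
  have hB := primrec_baseContents.comp hC
  have hK := primrec_slotBound.comp hC
  have h1 := primrec_left.comp primrec_right
  have h2 := primrec_right.comp primrec_right
  have hq := primrec_left.comp h2
  have hm := fun {f : ℕ → ℕ} (hf : Primrec f) =>
    primrec_decodeVec.comp (primrec_left.comp (primrec_right.comp hf))
  have hcode := primrec_vecCode Primrec.id
  exact primrec_natPair (primrec_tag _ (primrec_tag _ (primrec_netCode.comp
      (primrec_net hC hI hB hK hq))))
    (primrec_natPair
      (primrec_natPair (Primrec.nat_double.comp (primrec_tag 0 (primrec_left.comp h1)))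
        (hcode.comp (primrec_startTokens hK (hm h1))))
      (primrec_natPair (Primrec.nat_double.comp (primrec_tag 0 hq))
        (hcode.comp (primrec_onP (hm h2)))))

/-- The reachability problem for VASSB reduces to the
reachability problem for VASS: there is a computable function mapping each
triple `(V, s1, s2)` of a VASSB and two semiconfigurations to a triple
`(V', c1', c2')` of a VASS and two VASS configurations such that `V` has a
run `s1 →* s2` iff `V'` has a run `c1' →* c2'`. -/
theorem vassb_reach_reduces_to_vass_reach :
    ∃ f : ℕ → ℕ, Computable f ∧
      ∀ (V : VASSB) (s1 s2 : VConfig), IsSemi s1 → IsSemi s2 →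
        ∃ (W : VASS) (c1 c2 : ℕ × Vec),
          f (Nat.pair (encodeVASSB V)
              (Nat.pair (encodeVConfig s1) (encodeVConfig s2))) =
            Nat.pair (encodeVASS W)
              (Nat.pair (encodeVassConfig c1) (encodeVassConfig c2)) ∧
          (VReach V s1 s2 ↔ VassReach W c1 c2) := by
  refine ⟨reduction, primrec_reduction.to_comp, ?_⟩
  rintro V ⟨q₁, m₁, b₁⟩ ⟨q₂, m₂, b₂⟩ h₁ h₂
  obtain rfl : b₁ = 0 := h₁
  obtain rfl : b₂ = 0 := h₂
  let E := decodeEdges (codedEdges (encodeVASSB V))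
  have hmem : ∀ e ∈ V.edges, decodeEdge (e.1, encodeVOp e.2.1, e.2.2) ∈ E := fun e he =>
    List.mem_map.2 ⟨_, mem_codedEdges.2 ⟨e, he, rfl⟩, rfl⟩
  have hofMem : ∀ l ∈ E, ∃ e ∈ V.edges, decodeEdge (e.1, encodeVOp e.2.1, e.2.2) = l := by
    intro l hl
    obtain ⟨c, hc, rfl⟩ := List.mem_map.1 hl
    obtain ⟨e, he, rfl⟩ := mem_codedEdges.1 hc
    exact ⟨e, he, rfl⟩
  have htoV : ∀ e : VEdge, (decodeEdge (e.1, encodeVOp e.2.1, e.2.2)).toV = e := fun e =>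
    Prod.ext rfl (Prod.ext (toV_decodeOp e.2.1) rfl)
  refine ⟨petriVASS (net E (deflPlaces E) (baseContents E) (slotBound E) q₂),
    (2 * stQ q₁, toVec (startTokens (slotBound E) (decodeVec (encodeVec m₁)))),
    (2 * stQ q₂, toVec (onP (decodeVec (encodeVec m₂)))), ?_, ?_⟩
  · simp only [reduction, encodeVASS_petriVASS, encodeVassConfig, encodeVec_toVec, encodeVConfig,
      encode_prod_val, encode_nat, Nat.unpair_pair, E]
  · rw [petriVASS_reach_iff]
    conv_lhs => rw [← toVec_decodeVec m₁, ← toVec_decodeVec m₂]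
    refine ⟨petriReach_of_vreach (fun e he => ⟨_, hmem e he, (htoV e).symm⟩) ?_,
      vreach_of_petriReach (fun l hl => ?_) (nodup_sortDedup _)⟩
    · intro l hl neg pos h
      obtain ⟨e, _, rfl⟩ := hofMem l hl
      exact decodeOp_disjoint e.2.1 h
    · obtain ⟨e, he, rfl⟩ := hofMem l hl
      rwa [htoV]

end CBL
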